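/- arXiv:1703.10512 — 2 statements merged into one kernel-verified Lean document; each statement's English description precedes it below -/
import Mathlib

section
/- Let (A,B,C,D,E,F,X,Y,Z,W,𝒞,μ) ∈ ℝ¹² with A,B,C,D,E,F > 0 be a solution of the system (S2) with μ = −1. Then either (A,B,C,D,E,F,X,Y,Z,W,𝒞) = (1,1,1,1,1,1,0,0,0,0,0), or there exist δ ∈ {1, 1/√2} and X ∈ {−1,1} and (Y,𝒞) ∈ ℝ² with Y² + 𝒞² = 1 such that (A,B,C,D,E,F,X,Y,Z,W,𝒞) = (δ, δ, δ, δ⁻¹, δ⁻¹, δ⁻¹, X, Y, XY, −X𝒞, 𝒞). (These are exactly the solutions with μ = −1 and positive A,…,F; all of them correspond to metrics isometric to a multiple of the standard metric on S³×S³.) -/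
/-- The system (S2) of 12 polynomial equations arising from left-invariant Einstein
metrics on S³×S³ invariant under a ℤ₂ subgroup of inner automorphisms.
Here `G` denotes the variable `𝒞`. -/
def SystemS2 (A B C D E F X Y Z W G μ : ℝ) : Prop :=
  A*B*C*D*E*F - 1 = 0 ∧
  -D + E + F + A*B*C*E*F*μ - D*X^2 + A*X*Y*Z - A*W*X*G = 0 ∧
  D - E + F + A*B*C*D*F*μ - E*W^2 - E*Y^2 + B*X*Y*Z - C*W*X*G = 0 ∧
  A - B + C + A*C*D*E*F*μ + A*W^2 - B*W^2 - B*X^2 + C*X^2 - B*W^2*X^2 + E*X*Y*Z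
    + A*Z^2 - B*Z^2 - B*X^2*Z^2 - F*W*X*G = 0 ∧
  D + E - F + A*B*C*D*E*μ + C*X*Y*Z - F*Z^2 - B*W*X*G - F*G^2 = 0 ∧
  -A + B + C + B*C*D*E*F*μ - A*W^2 + B*W^2 - A*Y^2 + C*Y^2 + D*X*Y*Z - A*Z^2 + B*Z^2
    - A*Y^2*Z^2 - D*W*X*G + 2*A*W*Y*Z*G - A*G^2 + C*G^2 - A*W^2*G^2 = 0 ∧
  A + B - C + A*B*D*E*F*μ + B*X^2 - C*X^2 + A*Y^2 - C*Y^2 - C*X^2*Y^2 + F*X*Y*Z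
    - E*W*X*G + A*G^2 - C*G^2 - C*X^2*G^2 = 0 ∧
  -(A*D*W*X) - C*E*W*X - B*F*W*X + A^2*W*Y*Z - A^2*G + 2*A*C*G - C^2*G - F^2*G
    - A^2*W^2*G - C^2*X^2*G = 0 ∧
  A*D*X*Y + B*E*X*Y + C*F*X*Y - A^2*Z + 2*A*B*Z - B^2*Z - F^2*Z - B^2*X^2*Z
    - A^2*Y^2*Z + A^2*W*Y*G = 0 ∧
  -(A^2*Y) + 2*A*C*Y - C^2*Y - E^2*Y - C^2*X^2*Y + A*D*X*Z + B*E*X*Z + C*F*X*Z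
    - A^2*Y*Z^2 + A^2*W*Z*G = 0 ∧
  -(A^2*W) + 2*A*B*W - B^2*W - E^2*W - B^2*W*X^2 - A*D*X*G - C*E*X*G - B*F*X*G
    + A^2*Y*Z*G - A^2*W*G^2 = 0 ∧
  -(B^2*X) + 2*B*C*X - C^2*X - D^2*X - B^2*W^2*X - C^2*X*Y^2 + A*D*Y*Z + B*E*Y*Z
    + C*F*Y*Z - B^2*X*Z^2 - A*D*W*G - C*E*W*G - B*F*W*G - C^2*X*G^2 = 0

lemma ratio_contradiction_of_sq {x y s₁ s₃ N₁ N₃ M₁ M₃ Y e ρ : ℝ} (hx : 0 < x) (hy : 0 < y)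
    (hs₁ : 0 < s₁) (hs₃ : 0 < s₃) (hN₁ : 0 < N₁) (hN₃ : 0 < N₃) (hM₁ : 0 < M₁) (hM₃ : 0 < M₃)
    (hρ : 0 < ρ) (h₁ : x * s₁ * N₃ * M₃ ≤ ρ * (y * s₃ * N₁ * M₁))
    (h₂ : Y * N₁ * N₃ * (ρ^2 - 1) ≤ 8 * ρ * M₁ * M₃ * e) (hY : 0 < Y)
    (h₃ : 0 < Y * (x^2 * s₁^2 * N₃^2 * M₃^2 - y^2 * s₃^2 * N₁^2 * M₁^2)
      - 8 * e * (s₁ * s₃ * x * y * M₁^2 * M₃^2)) : False := by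
  have hP : 0 < x * s₁ * N₃ * M₃ := by positivity
  have hL : 0 < y * s₃ * N₁ * M₁ := by positivity
  have hk : 0 < s₁ * s₃ * x * y * M₁ * M₃ := by positivity
  have h₄ := mul_le_mul_of_nonneg_left h₂ hk.le
  have h₅ : 0 < Y * ((ρ * (x * s₁ * N₃ * M₃) + y * s₃ * N₁ * M₁) *
      (x * s₁ * N₃ * M₃ - ρ * (y * s₃ * N₁ * M₁))) := by
    have h₆ := mul_pos hρ h₃
    linarith
  have h₆ := (mul_pos_iff_of_pos_left (by positivity)).1 ((mul_pos_iff_of_pos_left hY).1 h₅)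
  linarith

lemma ratio_contradiction_of_three_le {x y s₁ s₃ N₁ N₃ M₁ M₃ Y e ρ : ℝ} (hy : 0 < y)
    (hs₃ : 0 < s₃) (hN₁ : 0 < N₁) (hN₃ : 0 < N₃) (hM₁ : 0 < M₁) (hM₃ : 0 < M₃)
    (hρ : 3 ≤ ρ) (h₁ : x * s₁ * N₃ * M₃ ≤ ρ * (y * s₃ * N₁ * M₁))
    (h₂ : Y * N₁ * N₃ * (ρ^2 - 1) ≤ 8 * ρ * M₁ * M₃ * e) (hY : 0 < Y)
    (h₃ : 0 < Y * x * s₁ * N₃^2 - 9 * e * s₃ * M₁^2 * y) : False := by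
  have hρ₀ : 0 < ρ := by linarith
  have h₄ : ρ * (Y * N₁ * N₃ * ρ) ≤ ρ * (9 * M₁ * M₃ * e) := by
    have h₅ : 8 * ρ^2 ≤ 9 * (ρ^2 - 1) := by nlinarith
    have h₆ : 0 < Y * N₁ * N₃ := by positivity
    have h₇ := mul_le_mul_of_nonneg_left h₅ h₆.le
    linarith
  have h₅ := le_of_mul_le_mul_left h₄ hρ₀
  have h₆ : 0 < y * s₃ * M₁ := by positivity
  have h₇ := mul_le_mul_of_nonneg_left h₅ h₆.le
  have h₈ : 0 < Y * N₃ := by positivity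
  have h₉ := mul_le_mul_of_nonneg_left h₁ h₈.le
  have h₁₀ := mul_pos hM₃ h₃
  linarith

set_option maxRecDepth 100000 in
set_option maxHeartbeats 2000000 in
lemma extremal_sq_pos {s₁ s₃ n q : ℝ} (hs : 0 < s₃) (hn : s₃ ≤ n) (hq : 0 ≤ q)
    (he : 0 < s₁ - s₃ - 2 * q) :
    0 < (3 * (s₁ + 2*s₃ + n) + 8*s₁ + 8*s₃ + 4*n + 4*q) *
      (((s₁ + 2*s₃ + n) + 4*s₃)^2 * s₁^2 * (s₁ + n)^2 * (s₁ + n + 2*s₃)^2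
       - ((s₁ + 2*s₃ + n) + 4*s₁ + 4*q)^2 * s₃^2 * (s₃ + n + q)^2 * (s₃ + n + q + 2*s₁)^2)
      - 8 * (s₁ - s₃ - 2 * q) * (s₁ * s₃ * ((s₁ + 2*s₃ + n) + 4*s₃) *
        ((s₁ + 2*s₃ + n) + 4*s₁ + 4*q) * (s₃ + n + q + 2*s₁)^2 * (s₁ + n + 2*s₃)^2) := by
  obtain ⟨m, rfl⟩ : ∃ m, n = s₃ + m := ⟨n - s₃, by ring⟩
  obtain ⟨e, rfl⟩ : ∃ e, s₁ = s₃ + 2 * q + e := ⟨s₁ - s₃ - 2 * q, by ring⟩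
  replace hn : 0 ≤ m := by linarith
  replace he : 0 < e := by linarith
  ring_nf
  positivity

lemma extremal_pos {s₁ s₃ n q : ℝ} (hs : 0 < s₃) (hn : s₃ ≤ n) (hq : 0 ≤ q)
    (he : 0 < s₁ - s₃ - q) :
    0 < (3 * (s₁ + 2*s₃ + n) + 8*s₁ + 8*s₃ + 4*n + 4*q) * ((s₁ + 2*s₃ + n) + 4*s₃) * s₁ *
        (s₁ + n)^2
      - 9 * (s₁ - s₃ - q) * s₃ * (s₃ + n + q + 2*s₁)^2 * ((s₁ + 2*s₃ + n) + 4*s₁ + 4*q) := by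
  obtain ⟨m, rfl⟩ : ∃ m, n = s₃ + m := ⟨n - s₃, by ring⟩
  obtain ⟨e, rfl⟩ : ∃ e, s₁ = s₃ + q + e := ⟨s₁ - s₃ - q, by ring⟩
  replace hn : 0 ≤ m := by linarith
  replace he : 0 < e := by linarith
  have h : 0 ≤ 11 * e^3 * (e - s₃)^2 + 17 * s₃ * e^2 * (e - 3*s₃)^2 + 59 * q * e^2 * (e - 2*s₃)^2
      + 124 * s₃ * q * e * (e - 2*s₃)^2 + 86 * q^2 * e * (e - s₃)^2 := by positivity
  refine lt_of_le_of_lt h (sub_pos.1 ?_)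
  ring_nf
  positivity

lemma extremal_sq_pos_of_eq {s₁ s₃ n q : ℝ} (hs : 0 < s₃) (hn : 0 ≤ n) (hq : 0 ≤ q)
    (he : 0 < s₁ - s₃ - q) :
    0 < (3 * (s₁ + 2*s₃ + n) + 8*s₁ + 8*s₃ + 4*n + 4*q) *
      ((1:ℝ)^2 * s₁^2 * (s₁ + n)^2 * (s₁ + n + 2*s₃)^2
       - (1:ℝ)^2 * s₃^2 * (s₃ + n + q)^2 * (s₃ + n + q + 2*s₁)^2)
      - 8 * (s₁ - s₃ - q) * (s₁ * s₃ * 1 * 1 * (s₃ + n + q + 2*s₁)^2 * (s₁ + n + 2*s₃)^2) := by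
  obtain ⟨e, rfl⟩ : ∃ e, s₁ = s₃ + q + e := ⟨s₁ - s₃ - q, by ring⟩
  replace he : 0 < e := by linarith
  ring_nf
  positivity

lemma false_of_ratio_of_gap {s₁ s₃ n q ρ : ℝ} (hs₁ : 0 < s₁) (hs : 0 < s₃) (hn : s₃ ≤ n)
    (hq : 0 ≤ q) (hρ : 1 < ρ)
    (h₁ : ((s₁ + 2*s₃ + n) + 4*s₃) * s₁ * (s₁ + n) * (s₁ + n + 2*s₃) ≤
      ρ * (((s₁ + 2*s₃ + n) + 4*s₁ + 4*q) * s₃ * (s₃ + n + q) * (s₃ + n + q + 2*s₁)))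
    (h₂ : (3 * (s₁ + 2*s₃ + n) + 8*s₁ + 8*s₃ + 4*n + 4*q) * (s₃ + n + q) * (s₁ + n) *
        (ρ^2 - 1) * (ρ - 1) ≤
      8 * ρ * (s₃ + n + q + 2*s₁) * (s₁ + n + 2*s₃) * ((s₁ - s₃) * (ρ - 1) - (ρ + 1) * q)) :
    False := by
  have hn₀ : 0 < n := by linarith
  have hρ₁ : 0 < ρ - 1 := by linarith
  have hρ₂ : 0 < ρ^2 - 1 := by nlinarith
  have hM : 0 < 8 * ρ * (s₃ + n + q + 2*s₁) * (s₁ + n + 2*s₃) := by positivity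
  have hgap : 0 < (s₁ - s₃) * (ρ - 1) - (ρ + 1) * q := by
    refine (mul_pos_iff_of_pos_left hM).1 (lt_of_lt_of_le ?_ h₂)
    positivity
  rcases le_total ρ 3 with h3 | h3
  · have hle : (s₁ - s₃) * (ρ - 1) - (ρ + 1) * q ≤ (s₁ - s₃ - 2 * q) * (ρ - 1) := by nlinarith
    have he : 0 < s₁ - s₃ - 2 * q := (mul_pos_iff_of_pos_right hρ₁).1 (hgap.trans_le hle)
    refine ratio_contradiction_of_sq (by positivity) (by positivity) hs₁ hs (by positivity)
      (by positivity) (by positivity) (by positivity) (by positivity) h₁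
      (le_of_mul_le_mul_right (a := ρ - 1) ?_ hρ₁) (by positivity) (extremal_sq_pos hs hn hq he)
    calc _ ≤ _ := h₂
      _ ≤ _ := mul_le_mul_of_nonneg_left hle hM.le
      _ = _ := by ring
  · have hle : (s₁ - s₃) * (ρ - 1) - (ρ + 1) * q ≤ (s₁ - s₃ - q) * (ρ - 1) := by nlinarith
    have he : 0 < s₁ - s₃ - q := (mul_pos_iff_of_pos_right hρ₁).1 (hgap.trans_le hle)
    refine ratio_contradiction_of_three_le (by positivity) hs (by positivity)
      (by positivity) (by positivity) (by positivity) h3 h₁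
      (le_of_mul_le_mul_right (a := ρ - 1) ?_ hρ₁) (by positivity) (extremal_pos hs hn hq he)
    calc _ ≤ _ := h₂
      _ ≤ _ := mul_le_mul_of_nonneg_left hle hM.le
      _ = _ := by ring

lemma false_of_ratio_of_gap_of_eq {s₁ s₃ n q ρ : ℝ} (hs₁ : 0 < s₁) (hs : 0 < s₃) (hn : 0 ≤ n)
    (hq : 0 ≤ q) (hρ : 1 < ρ)
    (h₁ : s₁ * (s₁ + n) * (s₁ + n + 2*s₃) ≤ ρ * (s₃ * (s₃ + n + q) * (s₃ + n + q + 2*s₁)))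
    (h₂ : (3 * (s₁ + 2*s₃ + n) + 8*s₁ + 8*s₃ + 4*n + 4*q) * (s₃ + n + q) * (s₁ + n) *
        (ρ^2 - 1) * (ρ - 1) ≤
      8 * ρ * (s₃ + n + q + 2*s₁) * (s₁ + n + 2*s₃) * ((s₁ - s₃) * (ρ - 1) - (ρ + 1) * q)) :
    False := by
  have hρ₁ : 0 < ρ - 1 := by linarith
  have hρ₂ : 0 < ρ^2 - 1 := by nlinarith
  have hM : 0 < 8 * ρ * (s₃ + n + q + 2*s₁) * (s₁ + n + 2*s₃) := by positivity
  have hgap : 0 < (s₁ - s₃) * (ρ - 1) - (ρ + 1) * q := by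
    refine (mul_pos_iff_of_pos_left hM).1 (lt_of_lt_of_le ?_ h₂)
    positivity
  have hle : (s₁ - s₃) * (ρ - 1) - (ρ + 1) * q ≤ (s₁ - s₃ - q) * (ρ - 1) := by nlinarith
  have he : 0 < s₁ - s₃ - q := (mul_pos_iff_of_pos_right hρ₁).1 (hgap.trans_le hle)
  refine ratio_contradiction_of_sq (ρ := ρ) one_pos one_pos hs₁ hs (by positivity) (by positivity)
    (by positivity) (by positivity) (by positivity) (by simpa only [one_mul] using h₁)
    (le_of_mul_le_mul_right (a := ρ - 1) ?_ hρ₁) (by positivity)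
    (extremal_sq_pos_of_eq hs hn hq he)
  calc _ ≤ _ := h₂
    _ ≤ _ := mul_le_mul_of_nonneg_left hle hM.le
    _ = _ := by ring

/-- The relations satisfied by a diagonal solution with nonzero off-diagonal part, written in terms
of the scale factors `a`, `d`, the squared off-diagonal entries `t`, their signed product `τ` and
the defects `s`, `Q`. -/
structure DiagonalData (a₁ a₂ a₃ d₁ d₂ d₃ s₁ s₂ s₃ Q₁ Q₂ Q₃ t₁ t₂ t₃ τ : ℝ) : Prop where
  a₁_pos : 0 < a₁
  a₂_pos : 0 < a₂
  a₃_pos : 0 < a₃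
  d₁_pos : 0 < d₁
  d₂_pos : 0 < d₂
  d₃_pos : 0 < d₃
  s₁_pos : 0 < s₁
  s₂_pos : 0 < s₂
  s₃_pos : 0 < s₃
  t₁_nonneg : 0 ≤ t₁
  t₂_nonneg : 0 ≤ t₂
  t₃_nonneg : 0 ≤ t₃
  τ_pos : 0 < τ
  Q₁_eq : Q₁ = (a₂ - a₃)^2 * t₁
  Q₂_eq : Q₂ = (a₁ - a₃)^2 * t₂
  Q₃_eq : Q₃ = (a₁ - a₂)^2 * t₃
  prod₁ : (s₂ + s₃ + Q₂ + Q₃) * (s₂ + s₃ + Q₂ + Q₃ + 2*s₁) = 4 * s₁ * a₁ * d₁ * τ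
  prod₂ : (s₁ + s₃ + Q₁ + Q₃) * (s₁ + s₃ + Q₁ + Q₃ + 2*s₂) = 4 * s₂ * a₂ * d₂ * τ
  prod₃ : (s₁ + s₂ + Q₁ + Q₂) * (s₁ + s₂ + Q₁ + Q₂ + 2*s₃) = 4 * s₃ * a₃ * d₃ * τ
  cross₁ : (s₁ + s₃ + Q₁ + Q₃ + 2*s₂) * (s₁ + s₂ + Q₁ + Q₂ + 2*s₃) * (a₂ * a₃ * t₁) =
    (s₁ + s₃ + Q₁ + Q₃) * (s₁ + s₂ + Q₁ + Q₂) * (d₂ * d₃)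
  cross₂ : (s₂ + s₃ + Q₂ + Q₃ + 2*s₁) * (s₁ + s₂ + Q₁ + Q₂ + 2*s₃) * (a₁ * a₃ * t₂) =
    (s₂ + s₃ + Q₂ + Q₃) * (s₁ + s₂ + Q₁ + Q₂) * (d₁ * d₃)
  cross₃ : (s₂ + s₃ + Q₂ + Q₃ + 2*s₁) * (s₁ + s₃ + Q₁ + Q₃ + 2*s₂) * (a₁ * a₂ * t₃) =
    (s₂ + s₃ + Q₂ + Q₃) * (s₁ + s₃ + Q₁ + Q₃) * (d₁ * d₂)
  ricci₁ : a₁^2 - (a₂ - a₃)^2 = 1 - s₁ + (a₂^2 - a₁^2) * t₃ + (a₃^2 - a₁^2) * t₂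
  ricci₂ : a₂^2 - (a₁ - a₃)^2 = 1 - s₂ + (a₁^2 - a₂^2) * t₃ + (a₃^2 - a₂^2) * t₁
  ricci₃ : a₃^2 - (a₁ - a₂)^2 = 1 - s₃ + (a₁^2 - a₃^2) * t₂ + (a₂^2 - a₃^2) * t₁
  sum_eq : d₁^2 - (d₂ - d₃)^2 + (d₂^2 - (d₁ - d₃)^2) + (d₃^2 - (d₁ - d₂)^2) =
    3 + 2 * (s₁ + s₂ + s₃) + (Q₁ + Q₂ + Q₃)

namespace DiagonalData

variable {a₁ a₂ a₃ d₁ d₂ d₃ s₁ s₂ s₃ Q₁ Q₂ Q₃ t₁ t₂ t₃ τ : ℝ}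

lemma swap₁₂ (h : DiagonalData a₁ a₂ a₃ d₁ d₂ d₃ s₁ s₂ s₃ Q₁ Q₂ Q₃ t₁ t₂ t₃ τ) :
    DiagonalData a₂ a₁ a₃ d₂ d₁ d₃ s₂ s₁ s₃ Q₂ Q₁ Q₃ t₂ t₁ t₃ τ where
  a₁_pos := h.a₂_pos
  a₂_pos := h.a₁_pos
  a₃_pos := h.a₃_pos
  d₁_pos := h.d₂_pos
  d₂_pos := h.d₁_pos
  d₃_pos := h.d₃_pos
  s₁_pos := h.s₂_pos
  s₂_pos := h.s₁_pos
  s₃_pos := h.s₃_pos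
  t₁_nonneg := h.t₂_nonneg
  t₂_nonneg := h.t₁_nonneg
  t₃_nonneg := h.t₃_nonneg
  τ_pos := h.τ_pos
  Q₁_eq := h.Q₂_eq
  Q₂_eq := h.Q₁_eq
  Q₃_eq := by linear_combination h.Q₃_eq
  prod₁ := by linear_combination h.prod₂
  prod₂ := by linear_combination h.prod₁
  prod₃ := by linear_combination h.prod₃
  cross₁ := by linear_combination h.cross₂
  cross₂ := by linear_combination h.cross₁
  cross₃ := by linear_combination h.cross₃
  ricci₁ := by linear_combination h.ricci₂
  ricci₂ := by linear_combination h.ricci₁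
  ricci₃ := by linear_combination h.ricci₃
  sum_eq := by linear_combination h.sum_eq

lemma swap₂₃ (h : DiagonalData a₁ a₂ a₃ d₁ d₂ d₃ s₁ s₂ s₃ Q₁ Q₂ Q₃ t₁ t₂ t₃ τ) :
    DiagonalData a₁ a₃ a₂ d₁ d₃ d₂ s₁ s₃ s₂ Q₁ Q₃ Q₂ t₁ t₃ t₂ τ where
  a₁_pos := h.a₁_pos
  a₂_pos := h.a₃_pos
  a₃_pos := h.a₂_pos
  d₁_pos := h.d₁_pos
  d₂_pos := h.d₃_pos
  d₃_pos := h.d₂_pos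
  s₁_pos := h.s₁_pos
  s₂_pos := h.s₃_pos
  s₃_pos := h.s₂_pos
  t₁_nonneg := h.t₁_nonneg
  t₂_nonneg := h.t₃_nonneg
  t₃_nonneg := h.t₂_nonneg
  τ_pos := h.τ_pos
  Q₁_eq := by linear_combination h.Q₁_eq
  Q₂_eq := h.Q₃_eq
  Q₃_eq := h.Q₂_eq
  prod₁ := by linear_combination h.prod₁
  prod₂ := by linear_combination h.prod₃
  prod₃ := by linear_combination h.prod₂
  cross₁ := by linear_combination h.cross₁
  cross₂ := by linear_combination h.cross₃
  cross₃ := by linear_combination h.cross₂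
  ricci₁ := by linear_combination h.ricci₁
  ricci₂ := by linear_combination h.ricci₃
  ricci₃ := by linear_combination h.ricci₂
  sum_eq := by linear_combination h.sum_eq

lemma Q_nonneg (h : DiagonalData a₁ a₂ a₃ d₁ d₂ d₃ s₁ s₂ s₃ Q₁ Q₂ Q₃ t₁ t₂ t₃ τ) :
    0 ≤ Q₁ ∧ 0 ≤ Q₂ ∧ 0 ≤ Q₃ := by
  have := h.t₁_nonneg
  have := h.t₂_nonneg
  have := h.t₃_nonneg
  refine ⟨?_, ?_, ?_⟩
  · rw [h.Q₁_eq]; positivity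
  · rw [h.Q₂_eq]; positivity
  · rw [h.Q₃_eq]; positivity

lemma s_sub (h : DiagonalData a₁ a₂ a₃ d₁ d₂ d₃ s₁ s₂ s₃ Q₁ Q₂ Q₃ t₁ t₂ t₃ τ) :
    s₁ - s₃ = 2 * (a₁ + a₃ - a₂) * (a₃ - a₁) + 2 * t₂ * (a₃^2 - a₁^2) + t₃ * (a₂^2 - a₁^2)
      + t₁ * (a₃^2 - a₂^2) := by
  linear_combination h.ricci₁ - h.ricci₃

lemma s_gap (h : DiagonalData a₁ a₂ a₃ d₁ d₂ d₃ s₁ s₂ s₃ Q₁ Q₂ Q₃ t₁ t₂ t₃ τ)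
    (h₁₂ : a₁ ≤ a₂) (h₂₃ : a₂ ≤ a₃) : Q₁ + 2 * Q₂ + Q₃ ≤ s₁ - s₃ := by
  have ha := h.a₁_pos
  have e₁ : 0 ≤ t₁ * (a₂ * (a₃ - a₂)) :=
    mul_nonneg h.t₁_nonneg (mul_nonneg h.a₂_pos.le (by linarith))
  have e₂ : 0 ≤ t₂ * (a₁ * (a₃ - a₁)) :=
    mul_nonneg h.t₂_nonneg (mul_nonneg h.a₁_pos.le (by linarith))
  have e₃ : 0 ≤ t₃ * (a₁ * (a₂ - a₁)) :=
    mul_nonneg h.t₃_nonneg (mul_nonneg h.a₁_pos.le (by linarith))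
  have e₄ : 0 ≤ (a₁ + a₃ - a₂) * (a₃ - a₁) := mul_nonneg (by linarith) (by linarith)
  rw [h.s_sub, h.Q₁_eq, h.Q₂_eq, h.Q₃_eq]
  linarith

lemma s_sum_le (h : DiagonalData a₁ a₂ a₃ d₁ d₂ d₃ s₁ s₂ s₃ Q₁ Q₂ Q₃ t₁ t₂ t₃ τ)
    (h₁₂ : a₁ ≤ a₂) (h₂₃ : a₂ ≤ a₃) : s₁ + s₂ + 2 * s₃ + Q₁ + Q₂ ≤ 4 := by
  have e₁ : 0 ≤ t₁ * (a₂ * (a₃ - a₂)) :=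
    mul_nonneg h.t₁_nonneg (mul_nonneg h.a₂_pos.le (by linarith))
  have e₂ : 0 ≤ t₂ * (a₁ * (a₃ - a₁)) :=
    mul_nonneg h.t₂_nonneg (mul_nonneg h.a₁_pos.le (by linarith))
  have e₃ : 0 ≤ a₁ * (a₃ - a₁) := mul_nonneg h.a₁_pos.le (by linarith)
  have e₄ : 0 ≤ a₂ * (a₃ - a₂) := mul_nonneg h.a₂_pos.le (by linarith)
  have e₅ : 0 < a₁ * a₂ := mul_pos h.a₁_pos h.a₂_pos
  have r₁ := h.ricci₁
  have r₂ := h.ricci₂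
  have r₃ := h.ricci₃
  rw [h.Q₁_eq, h.Q₂_eq]
  linarith

lemma theta_le (h : DiagonalData a₁ a₂ a₃ d₁ d₂ d₃ s₁ s₂ s₃ Q₁ Q₂ Q₃ t₁ t₂ t₃ τ)
    (h₁₂ : a₁ ≤ a₂) (h₂₃ : a₂ ≤ a₃) :
    (3 * (s₁ + 2*s₃ + (s₂ + Q₂)) + 8*s₁ + 8*s₃ + 4*(s₂ + Q₂) + 4*Q₃) * (s₃ + (s₂ + Q₂) + Q₃) *
      (s₁ + (s₂ + Q₂)) ≤
    16 * (a₁ * a₃ * t₂) * (s₃ + (s₂ + Q₂) + Q₃ + 2*s₁) * (s₁ + (s₂ + Q₂) + 2*s₃) := by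
  obtain ⟨q₁, q₂, q₃⟩ := h.Q_nonneg
  have p₁ := h.s₁_pos
  have p₂ := h.s₂_pos
  have p₃ := h.s₃_pos
  have hθ : 0 ≤ a₁ * a₃ * t₂ :=
    mul_nonneg (mul_nonneg h.a₁_pos.le h.a₃_pos.le) h.t₂_nonneg
  have hY : 3 * (s₁ + 2*s₃ + (s₂ + Q₂)) + 8*s₁ + 8*s₃ + 4*(s₂ + Q₂) + 4*Q₃ ≤ 16 * (d₁ * d₃) := by
    have := h.s_sum_le h₁₂ h₂₃
    have := h.sum_eq
    nlinarith [sq_nonneg (d₁ + d₃ - d₂)]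
  have hN : 0 < s₁ + s₂ + Q₁ + Q₂ + 2*s₃ := by positivity
  refine le_of_mul_le_mul_right ?_ hN
  have e₁ : (s₁ + (s₂ + Q₂)) * (s₁ + s₂ + Q₁ + Q₂ + 2*s₃) ≤
      (s₁ + s₂ + Q₁ + Q₂) * (s₁ + (s₂ + Q₂) + 2*s₃) := by nlinarith
  calc _ = (3 * (s₁ + 2*s₃ + (s₂ + Q₂)) + 8*s₁ + 8*s₃ + 4*(s₂ + Q₂) + 4*Q₃) *
        (s₃ + (s₂ + Q₂) + Q₃) * ((s₁ + (s₂ + Q₂)) * (s₁ + s₂ + Q₁ + Q₂ + 2*s₃)) := by ring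
    _ ≤ (3 * (s₁ + 2*s₃ + (s₂ + Q₂)) + 8*s₁ + 8*s₃ + 4*(s₂ + Q₂) + 4*Q₃) *
        (s₃ + (s₂ + Q₂) + Q₃) * ((s₁ + s₂ + Q₁ + Q₂) * (s₁ + (s₂ + Q₂) + 2*s₃)) :=
      mul_le_mul_of_nonneg_left e₁ (by positivity)
    _ = (3 * (s₁ + 2*s₃ + (s₂ + Q₂)) + 8*s₁ + 8*s₃ + 4*(s₂ + Q₂) + 4*Q₃) *
        ((s₃ + (s₂ + Q₂) + Q₃) * ((s₁ + s₂ + Q₁ + Q₂) * (s₁ + (s₂ + Q₂) + 2*s₃))) := by ring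
    _ ≤ 16 * (d₁ * d₃) *
        ((s₃ + (s₂ + Q₂) + Q₃) * ((s₁ + s₂ + Q₁ + Q₂) * (s₁ + (s₂ + Q₂) + 2*s₃))) :=
      mul_le_mul_of_nonneg_right hY (by positivity)
    _ = _ := by linear_combination -16 * (s₁ + (s₂ + Q₂) + 2*s₃) * h.cross₂

lemma gap_le (h : DiagonalData a₁ a₂ a₃ d₁ d₂ d₃ s₁ s₂ s₃ Q₁ Q₂ Q₃ t₁ t₂ t₃ τ)
    (h₁₂ : a₁ ≤ a₂) (h₂₃ : a₂ ≤ a₃) (h₁₃ : a₁ < a₃) :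
    (3 * (s₁ + 2*s₃ + (s₂ + Q₂)) + 8*s₁ + 8*s₃ + 4*(s₂ + Q₂) + 4*Q₃) * (s₃ + (s₂ + Q₂) + Q₃) *
      (s₁ + (s₂ + Q₂)) * ((a₃ / a₁)^2 - 1) * (a₃ / a₁ - 1) ≤
    8 * (a₃ / a₁) * (s₃ + (s₂ + Q₂) + Q₃ + 2*s₁) * (s₁ + (s₂ + Q₂) + 2*s₃) *
      ((s₁ - s₃) * (a₃ / a₁ - 1) - (a₃ / a₁ + 1) * Q₃) := by
  obtain ⟨q₁, q₂, q₃⟩ := h.Q_nonneg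
  have p₁ := h.s₁_pos
  have p₂ := h.s₂_pos
  have p₃ := h.s₃_pos
  have ha := h.a₁_pos
  have hρ : 1 < a₃ / a₁ := (one_lt_div ha).2 h₁₃
  have ha₃ : a₃ = a₃ / a₁ * a₁ := by field_simp
  have hgap : 2 * (a₁ * a₃ * t₂) * ((a₃ / a₁)^2 - 1) * (a₃ / a₁ - 1) ≤
      a₃ / a₁ * ((s₁ - s₃) * (a₃ / a₁ - 1) - (a₃ / a₁ + 1) * Q₃) := by
    have e₀ : 0 ≤ (a₁ + a₃ - a₂) * (a₃ - a₁) * (a₃ - a₁) :=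
      mul_nonneg (mul_nonneg (by linarith) (by linarith)) (by linarith)
    have e₁ : 0 ≤ t₁ * (a₃^2 - a₂^2) * (a₃ - a₁) :=
      mul_nonneg (mul_nonneg h.t₁_nonneg (by nlinarith [h.a₂_pos])) (by linarith)
    have e₃ : 0 ≤ t₃ * ((a₂ - a₁) * (a₁ * (a₃ - a₂))) := mul_nonneg h.t₃_nonneg
      (mul_nonneg (by linarith) (mul_nonneg ha.le (by linarith)))
    have e₄ : 2 * t₂ * (a₃^2 - a₁^2) * (a₃ - a₁) ≤ (s₁ - s₃) * (a₃ - a₁) - (a₃ + a₁) * Q₃ := by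
      rw [h.s_sub, h.Q₃_eq]
      linarith
    have e₅ : 0 < a₃ / a₁ / a₁ := by have := h.a₃_pos; positivity
    calc _ = a₃ / a₁ / a₁ * (2 * t₂ * (a₃^2 - a₁^2) * (a₃ - a₁)) := by field_simp
      _ ≤ a₃ / a₁ / a₁ * ((s₁ - s₃) * (a₃ - a₁) - (a₃ + a₁) * Q₃) :=
        mul_le_mul_of_nonneg_left e₄ e₅.le
      _ = _ := by field_simp
  have hρ₂ : 0 ≤ ((a₃ / a₁)^2 - 1) * (a₃ / a₁ - 1) :=
    mul_nonneg (by nlinarith) (by linarith)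
  have hM : 0 ≤ 8 * (s₃ + (s₂ + Q₂) + Q₃ + 2*s₁) * (s₁ + (s₂ + Q₂) + 2*s₃) := by positivity
  have e₁ := mul_le_mul_of_nonneg_right (h.theta_le h₁₂ h₂₃) hρ₂
  have e₂ := mul_le_mul_of_nonneg_left hgap hM
  linarith

lemma ratio_eq (h : DiagonalData a₁ a₂ a₃ d₁ d₂ d₃ s₁ s₂ s₃ Q₁ Q₂ Q₃ t₁ t₂ t₃ τ) :
    d₁ * (s₁ * (s₁ + s₂ + Q₁ + Q₂) * (s₁ + s₂ + Q₁ + Q₂ + 2*s₃)) =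
      d₃ * (a₃ / a₁ * (s₃ * (s₂ + s₃ + Q₂ + Q₃) * (s₂ + s₃ + Q₂ + Q₃ + 2*s₁))) := by
  have ha := h.a₁_pos
  field_simp
  linear_combination d₁ * s₁ * a₁ * h.prod₃ - d₃ * s₃ * a₃ * h.prod₁

lemma false_of_lt (h : DiagonalData a₁ a₂ a₃ d₁ d₂ d₃ s₁ s₂ s₃ Q₁ Q₂ Q₃ t₁ t₂ t₃ τ)
    (h₁₂ : a₁ ≤ a₂) (h₂₃ : a₂ ≤ a₃) (h₁₃ : a₁ < a₃) (hn : s₃ ≤ s₂ + Q₂)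
    (hr : d₃ * (1 + s₂ + s₃) ≤ d₁ * (1 + s₁ + s₂ + Q₃)) : False := by
  obtain ⟨q₁, q₂, q₃⟩ := h.Q_nonneg
  have p₁ := h.s₁_pos
  have p₂ := h.s₂_pos
  have p₃ := h.s₃_pos
  have hgap := h.s_gap h₁₂ h₂₃
  have hsum := h.s_sum_le h₁₂ h₂₃
  have ha := h.a₁_pos
  refine false_of_ratio_of_gap p₁ p₃ hn q₃ ((one_lt_div ha).2 h₁₃) ?_ (h.gap_le h₁₂ h₂₃ h₁₃)
  have hr' : d₃ * ((s₁ + 2*s₃ + (s₂ + Q₂)) + 4*s₃) ≤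
      d₁ * ((s₁ + 2*s₃ + (s₂ + Q₂)) + 4*s₁ + 4*Q₃) := by
    have hpos : 0 < 1 + s₁ + s₂ + Q₃ := by positivity
    refine le_of_mul_le_mul_right ?_ hpos
    have e₁ : ((s₁ + 2*s₃ + (s₂ + Q₂)) + 4*s₃) * (1 + s₁ + s₂ + Q₃) ≤
        (1 + s₂ + s₃) * ((s₁ + 2*s₃ + (s₂ + Q₂)) + 4*s₁ + 4*Q₃) := by
      have : 0 ≤ (4 + 4*s₂ - (s₁ + 2*s₃ + (s₂ + Q₂))) * (s₁ + Q₃ - s₃) :=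
        mul_nonneg (by linarith) (by linarith)
      linarith
    have e₂ := mul_le_mul_of_nonneg_left e₁ h.d₃_pos.le
    have e₃ := mul_le_mul_of_nonneg_right hr
      (show 0 ≤ (s₁ + 2*s₃ + (s₂ + Q₂)) + 4*s₁ + 4*Q₃ by positivity)
    linarith
  refine le_of_mul_le_mul_left ?_ h.d₃_pos
  calc _ = d₃ * ((s₁ + 2*s₃ + (s₂ + Q₂)) + 4*s₃) *
        (s₁ * (s₁ + (s₂ + Q₂)) * (s₁ + (s₂ + Q₂) + 2*s₃)) := by ring
    _ ≤ d₁ * ((s₁ + 2*s₃ + (s₂ + Q₂)) + 4*s₁ + 4*Q₃) *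
        (s₁ * (s₁ + s₂ + Q₁ + Q₂) * (s₁ + s₂ + Q₁ + Q₂ + 2*s₃)) := by
      have := h.d₁_pos
      have := h.d₃_pos
      gcongr ?_ * (s₁ * ?_ * ?_)
      · linarith
      · linarith
    _ = _ := by
      linear_combination ((s₁ + 2*s₃ + (s₂ + Q₂)) + 4*s₁ + 4*Q₃) * h.ratio_eq

lemma false_of_lt_of_eq (h : DiagonalData a₁ a₂ a₃ d₁ d₂ d₃ s₁ s₂ s₃ Q₁ Q₂ Q₃ t₁ t₂ t₃ τ)
    (h₁₂ : a₁ ≤ a₂) (h₂₃ : a₂ ≤ a₃) (h₁₃ : a₁ < a₃) (hd : d₁ = d₃) : False := by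
  obtain ⟨q₁, q₂, q₃⟩ := h.Q_nonneg
  have p₁ := h.s₁_pos
  have p₂ := h.s₂_pos
  have p₃ := h.s₃_pos
  refine false_of_ratio_of_gap_of_eq p₁ p₃ (add_nonneg p₂.le q₂) q₃
    ((one_lt_div h.a₁_pos).2 h₁₃) ?_ (h.gap_le h₁₂ h₂₃ h₁₃)
  have hratio := h.ratio_eq
  rw [hd] at hratio
  calc s₁ * (s₁ + (s₂ + Q₂)) * (s₁ + (s₂ + Q₂) + 2*s₃)
      ≤ s₁ * (s₁ + s₂ + Q₁ + Q₂) * (s₁ + s₂ + Q₁ + Q₂ + 2*s₃) := by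
        gcongr s₁ * ?_ * ?_ <;> linarith
    _ = _ := by rw [mul_left_cancel₀ h.d₃_pos.ne' hratio]; ring

lemma prod_le (h : DiagonalData a₁ a₂ a₃ d₁ d₂ d₃ s₁ s₂ s₃ Q₁ Q₂ Q₃ t₁ t₂ t₃ τ) (h₂₃ : a₂ ≤ a₃) :
    (s₁ + s₃ + Q₁ + Q₃) * (s₁ + s₃ + Q₁ + Q₃ + 2*s₂) * (s₃ * d₃) ≤
      (s₁ + s₂ + Q₁ + Q₂) * (s₁ + s₂ + Q₁ + Q₂ + 2*s₃) * (s₂ * d₂) := by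
  rw [h.prod₂, h.prod₃]
  have := h.s₂_pos
  have := h.s₃_pos
  have := h.d₂_pos
  have := h.d₃_pos
  have := h.τ_pos
  have e := mul_le_mul_of_nonneg_left h₂₃ (show 0 ≤ 4 * s₂ * s₃ * d₂ * d₃ * τ by positivity)
  linarith

lemma prod_sub_lt (h : DiagonalData a₁ a₂ a₃ d₁ d₂ d₃ s₁ s₂ s₃ Q₁ Q₂ Q₃ t₁ t₂ t₃ τ)
    (hn : s₂ + Q₂ < s₃) :
    (s₁ + s₂ + Q₁ + Q₂)^2 * (s₃ - s₂) <
      (s₁ + s₃ + Q₁ + Q₃) * (s₁ + s₃ + Q₁ + Q₃ + 2*s₂) * s₃ -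
        (s₁ + s₂ + Q₁ + Q₂) * (s₁ + s₂ + Q₁ + Q₂ + 2*s₃) * s₂ := by
  obtain ⟨q₁, q₂, q₃⟩ := h.Q_nonneg
  have p₁ := h.s₁_pos
  have p₂ := h.s₂_pos
  have p₃ := h.s₃_pos
  have e : 0 < (s₁ + s₃ + Q₁ + Q₃ - (s₁ + s₂ + Q₁ + Q₂)) *
      (s₃ * (s₁ + s₃ + Q₁ + Q₃ + (s₁ + s₂ + Q₁ + Q₂)) + 2 * s₂ * s₃) :=
    mul_pos (by linarith) (by positivity)
  linarith

lemma s₃_le_of_d_eq (h : DiagonalData a₁ a₂ a₃ d₁ d₂ d₃ s₁ s₂ s₃ Q₁ Q₂ Q₃ t₁ t₂ t₃ τ)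
    (h₂₃ : a₂ ≤ a₃) (hd : d₂ = d₃) : s₃ ≤ s₂ + Q₂ := by
  by_contra! hn
  obtain ⟨q₁, q₂, q₃⟩ := h.Q_nonneg
  have hprod := h.prod_le h₂₃
  rw [hd, ← mul_assoc, ← mul_assoc] at hprod
  have hprod' := le_of_mul_le_mul_right hprod h.d₃_pos
  have hpos : 0 ≤ (s₁ + s₂ + Q₁ + Q₂)^2 * (s₃ - s₂) := mul_nonneg (sq_nonneg _) (by linarith)
  linarith [h.prod_sub_lt hn]

lemma s₃_le_of_bound (h : DiagonalData a₁ a₂ a₃ d₁ d₂ d₃ s₁ s₂ s₃ Q₁ Q₂ Q₃ t₁ t₂ t₃ τ)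
    (h₁₂ : a₁ ≤ a₂) (h₂₃ : a₂ ≤ a₃)
    (hd : s₂ + Q₂ < s₃ → (d₂ - d₃) * (1 + s₁ + s₂ + Q₃) ≤ d₃ * (s₃ - s₂)) : s₃ ≤ s₂ + Q₂ := by
  by_contra! hn
  obtain ⟨q₁, q₂, q₃⟩ := h.Q_nonneg
  have p₁ := h.s₁_pos
  have p₂ := h.s₂_pos
  have p₃ := h.s₃_pos
  have hgap := h.s_gap h₁₂ h₂₃
  have hlt : 0 < s₃ - s₂ := by linarith
  have hy : 0 < 1 + s₁ + s₂ + Q₃ := by positivity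
  have hprod := mul_le_mul_of_nonneg_right (h.prod_le h₂₃) hy.le
  have hsub := mul_lt_mul_of_pos_right (h.prod_sub_lt hn) (mul_pos h.d₃_pos hy)
  have hNM : 0 < (s₁ + s₂ + Q₁ + Q₂) * (s₁ + s₂ + Q₁ + Q₂ + 2*s₃) * s₂ := by positivity
  have hdd := mul_le_mul_of_nonneg_left (hd hn) hNM.le
  have hk : 0 < d₃ * (s₁ + s₂ + Q₁ + Q₂) * (s₃ - s₂) := by
    have := h.d₃_pos
    positivity
  have hmain : (s₁ + s₂ + Q₁ + Q₂) * (1 + s₁ + s₂ + Q₃) < (s₁ + s₂ + Q₁ + Q₂ + 2*s₃) * s₂ := by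
    refine lt_of_mul_lt_mul_left ?_ hk.le
    linarith
  have e₁ : 0 ≤ (Q₁ + Q₂) * (1 + s₁ + Q₃) := by positivity
  have e₂ : 0 ≤ (s₁ + s₂) * (1 + Q₃) := by positivity
  have e₃ : 0 ≤ s₁ * (s₁ - s₃) := mul_nonneg p₁.le (by linarith)
  have e₄ : 0 ≤ s₃ * (s₁ - s₂) := mul_nonneg p₃.le (by linarith)
  have e₅ : 0 ≤ s₂ * (s₁ - s₃) := mul_nonneg p₂.le (by linarith)
  linarith

lemma not_lt_of_forall_ricci
    (h : DiagonalData a₁ a₂ a₃ d₁ d₂ d₃ s₁ s₂ s₃ Q₁ Q₂ Q₃ t₁ t₂ t₃ τ)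
    (y₁ : d₁^2 - (d₂ - d₃)^2 = 1 + s₂ + s₃ + Q₁) (y₂ : d₂^2 - (d₁ - d₃)^2 = 1 + s₁ + s₃ + Q₂)
    (y₃ : d₃^2 - (d₁ - d₂)^2 = 1 + s₁ + s₂ + Q₃)
    (h₁₂ : a₁ ≤ a₂) (h₂₃ : a₂ ≤ a₃) : ¬ a₁ < a₃ := by
  intro h₁₃
  obtain ⟨q₁, q₂, q₃⟩ := h.Q_nonneg
  have p₁ := h.s₁_pos
  have p₂ := h.s₂_pos
  have p₃ := h.s₃_pos
  have hd₁ := h.d₁_pos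
  have hd₂ := h.d₂_pos
  have hd₃ := h.d₃_pos
  have hgap := h.s_gap h₁₂ h₂₃
  have hf₁₂ : 0 < (d₂ + d₃ - d₁) * (d₁ + d₃ - d₂) := by linarith
  obtain ⟨hf₁, hf₂⟩ : 0 < d₂ + d₃ - d₁ ∧ 0 < d₁ + d₃ - d₂ := by
    rcases pos_and_pos_or_neg_and_neg_of_mul_pos hf₁₂ with hf | hf
    · exact hf
    · linarith
  refine h.false_of_lt h₁₂ h₂₃ h₁₃ (h.s₃_le_of_bound h₁₂ h₂₃ fun hn ↦ ?_) ?_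
  · have e₁ : d₁ ≤ d₃ := by
      have : 0 ≤ (d₁ + d₃ - d₂) * (d₃ - d₁) := by linarith
      linarith [(mul_nonneg_iff_of_pos_left hf₂).1 this]
    rcases le_total d₂ d₃ with h₁ | h₁
    · have : (d₂ - d₃) * (1 + s₁ + s₂ + Q₃) ≤ 0 :=
        mul_nonpos_of_nonpos_of_nonneg (by linarith) (by positivity)
      have : 0 ≤ d₃ * (s₃ - s₂) := mul_nonneg hd₃.le (by linarith)
      linarith
    · have e₂ : (d₂ - d₃) * (2 * (1 + s₁ + s₂ + Q₃)) ≤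
          (d₂ - d₃) * (2 * ((d₂ + d₃ - d₁) * d₃)) := by
        refine mul_le_mul_of_nonneg_left ?_ (by linarith)
        have := mul_nonneg hf₁.le (show 0 ≤ d₂ - d₁ by linarith)
        linarith
      have e₃ : d₃ * (2 * ((d₂ + d₃ - d₁) * (d₂ - d₃))) ≤ d₃ * (2 * (s₃ - s₂)) :=
        mul_le_mul_of_nonneg_left (by linarith) hd₃.le
      linarith
  · rcases le_total d₃ d₁ with h₁ | h₁
    · exact mul_le_mul h₁ (by linarith) (by positivity) hd₁.le
    · have e₁ : d₃ * (1 + s₂ + s₃) ≤ d₃ * (1 + s₂ + s₃ + Q₁) :=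
        mul_le_mul_of_nonneg_left (by linarith) hd₃.le
      have e₂ : 0 ≤ (d₁ + d₃ - d₂) * ((d₃ - d₁) * (d₁ + d₃ - d₂)) :=
        mul_nonneg hf₂.le (mul_nonneg (by linarith) hf₂.le)
      rw [← y₃]
      rw [← y₁] at e₁
      linarith

lemma not_lt_of_ricci₁ (h : DiagonalData a₁ a₂ a₃ d₁ d₂ d₃ s₁ s₂ s₃ Q₁ Q₂ Q₃ t₁ t₂ t₃ τ)
    (hd : d₂ = d₃) (y₁ : d₁^2 = 1 + s₂ + s₃ + Q₁) (h₁₂ : a₁ ≤ a₂) (h₂₃ : a₂ ≤ a₃) :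
    ¬ a₁ < a₃ := by
  intro h₁₃
  obtain ⟨q₁, q₂, q₃⟩ := h.Q_nonneg
  have p₁ := h.s₁_pos
  have p₂ := h.s₂_pos
  have p₃ := h.s₃_pos
  have hn := h.s₃_le_of_d_eq h₂₃ hd
  have hgap := h.s_gap h₁₂ h₂₃
  have hsum := h.sum_eq
  subst hd
  refine h.false_of_lt h₁₂ h₂₃ h₁₃ hn (le_of_mul_le_mul_left ?_ h.d₁_pos)
  have hdd : 2 * (d₁ * d₂) ≤ 2 * (1 + s₁ + s₂ + Q₃) := by linarith
  have e₁ := mul_le_mul_of_nonneg_right hdd (show 0 ≤ 1 + s₂ + s₃ by positivity)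
  have e₂ : (1 + s₂ + s₃) * (1 + s₁ + s₂ + Q₃) ≤ d₁^2 * (1 + s₁ + s₂ + Q₃) :=
    mul_le_mul_of_nonneg_right (by linarith) (by positivity)
  linarith

lemma not_lt_of_ricci₃ (h : DiagonalData a₁ a₂ a₃ d₁ d₂ d₃ s₁ s₂ s₃ Q₁ Q₂ Q₃ t₁ t₂ t₃ τ)
    (hd : d₁ = d₂) (y₃ : d₃^2 = 1 + s₁ + s₂ + Q₃) (h₁₂ : a₁ ≤ a₂) (h₂₃ : a₂ ≤ a₃) :
    ¬ a₁ < a₃ := by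
  intro h₁₃
  obtain ⟨q₁, q₂, q₃⟩ := h.Q_nonneg
  have p₁ := h.s₁_pos
  have p₂ := h.s₂_pos
  have p₃ := h.s₃_pos
  have hd₃ := h.d₃_pos
  have hs₂ := h.swap₂₃.swap₁₂.s₃_le_of_d_eq h₁₂ hd
  have hgap := h.s_gap h₁₂ h₂₃
  have hsum := h.sum_eq
  subst hd
  refine h.false_of_lt h₁₂ h₂₃ h₁₃ (h.s₃_le_of_bound h₁₂ h₂₃ fun hn ↦ ?_) ?_
  · rw [← y₃]
    have e := mul_le_mul_of_nonneg_left
      (show 2 * (d₃ * (d₁ - d₃)) ≤ 2 * (s₃ - s₂) by linarith) hd₃.le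
    linarith
  · rw [← y₃]
    have e := mul_le_mul_of_nonneg_left
      (show 2 * (1 + s₂ + s₃) ≤ 2 * (d₁ * d₃) by linarith) hd₃.le
    linarith

lemma a_eq_of_forall_ricci
    (h : DiagonalData a₁ a₂ a₃ d₁ d₂ d₃ s₁ s₂ s₃ Q₁ Q₂ Q₃ t₁ t₂ t₃ τ)
    (y₁ : d₁^2 - (d₂ - d₃)^2 = 1 + s₂ + s₃ + Q₁) (y₂ : d₂^2 - (d₁ - d₃)^2 = 1 + s₁ + s₃ + Q₂)
    (y₃ : d₃^2 - (d₁ - d₂)^2 = 1 + s₁ + s₂ + Q₃) : a₁ = a₂ ∧ a₂ = a₃ := by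
  rcases le_total a₁ a₂ with h₁₂ | h₁₂ <;> rcases le_total a₂ a₃ with h₂₃ | h₂₃ <;>
    rcases le_total a₁ a₃ with h₁₃ | h₁₃
  · have := h.not_lt_of_forall_ricci y₁ y₂ y₃ h₁₂ h₂₃
    constructor <;> linarith
  · constructor <;> linarith
  · have := h.swap₂₃.not_lt_of_forall_ricci (by linarith) (by linarith) (by linarith) h₁₃ h₂₃
    constructor <;> linarith
  · have := h.swap₂₃.swap₁₂.not_lt_of_forall_ricci (by linarith) (by linarith) (by linarith)
      h₁₃ h₁₂
    constructor <;> linarith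
  · have := h.swap₁₂.not_lt_of_forall_ricci (by linarith) (by linarith) (by linarith) h₁₂ h₁₃
    constructor <;> linarith
  · have := h.swap₁₂.swap₂₃.not_lt_of_forall_ricci (by linarith) (by linarith) (by linarith)
      h₂₃ h₁₃
    constructor <;> linarith
  · constructor <;> linarith
  · have := h.swap₁₂.swap₂₃.swap₁₂.not_lt_of_forall_ricci (by linarith) (by linarith)
      (by linarith) h₂₃ h₁₂
    constructor <;> linarith

lemma a_eq_of_ricci₁_of_le (h : DiagonalData a₁ a₂ a₃ d₁ d₂ d₃ s₁ s₂ s₃ Q₁ Q₂ Q₃ t₁ t₂ t₃ τ)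
    (hd : d₂ = d₃) (y₁ : d₁^2 = 1 + s₂ + s₃ + Q₁) (h₂₃ : a₂ ≤ a₃) : a₁ = a₂ ∧ a₂ = a₃ := by
  rcases le_total a₁ a₂ with h₁₂ | h₁₂
  · have := h.not_lt_of_ricci₁ hd y₁ h₁₂ h₂₃
    constructor <;> linarith
  rcases le_total a₁ a₃ with h₁₃ | h₁₃
  · have h' : ¬ a₂ < a₃ := fun hlt ↦ h.swap₁₂.false_of_lt_of_eq h₁₂ h₁₃ hlt hd
    constructor <;> linarith
  · have := h.swap₁₂.swap₂₃.not_lt_of_ricci₃ hd (by linarith) h₂₃ h₁₃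
    constructor <;> linarith

lemma a_eq_of_ricci₁ (h : DiagonalData a₁ a₂ a₃ d₁ d₂ d₃ s₁ s₂ s₃ Q₁ Q₂ Q₃ t₁ t₂ t₃ τ)
    (hd : d₂ = d₃) (y₁ : d₁^2 = 1 + s₂ + s₃ + Q₁) : a₁ = a₂ ∧ a₂ = a₃ := by
  rcases le_total a₂ a₃ with h₂₃ | h₂₃
  · exact h.a_eq_of_ricci₁_of_le hd y₁ h₂₃
  · obtain ⟨e₁, e₂⟩ := h.swap₂₃.a_eq_of_ricci₁_of_le hd.symm (by linarith) h₂₃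
    exact ⟨e₁.trans e₂, e₂.symm⟩

end DiagonalData

lemma eq_one_of_mul_eq_one {p q r : ℝ} (hp : 0 < p) (h₁ : p * (q + r - p) = 1)
    (h₂ : q * (p + r - q) = 1) (h₃ : r * (p + q - r) = 1) : p = 1 ∧ q = 1 ∧ r = 1 := by
  have f₂ : p + r - q ≠ 0 := fun h ↦ by simp [h] at h₂
  have f₃ : p + q - r ≠ 0 := fun h ↦ by simp [h] at h₃
  have e₁ : (r - p) * (p + r - q) = 0 := by linear_combination h₁ - h₃
  have e₂ : (q - p) * (p + q - r) = 0 := by linear_combination h₁ - h₂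
  obtain rfl : r = p := sub_eq_zero.1 ((mul_eq_zero.1 e₁).resolve_right f₂)
  obtain rfl : q = r := sub_eq_zero.1 ((mul_eq_zero.1 e₂).resolve_right f₃)
  have : q = 1 := by nlinarith
  exact ⟨this, this, this⟩

/-- The equations satisfied by a solution whose off-diagonal part is the diagonal matrix with entries
`x₁, x₂, x₃`. When `d₂ = d₃`, only the sum of the last two Ricci equations is required. -/
structure DiagonalSystem (a₁ a₂ a₃ d₁ d₂ d₃ x₁ x₂ x₃ : ℝ) : Prop where
  a₁_pos : 0 < a₁
  a₂_pos : 0 < a₂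
  a₃_pos : 0 < a₃
  d₁_pos : 0 < d₁
  d₂_pos : 0 < d₂
  d₃_pos : 0 < d₃
  volume : a₁ * a₂ * a₃ * d₁ * d₂ * d₃ = 1
  off₁ : x₁ * ((a₂ - a₃)^2 + d₁^2 + a₃^2 * x₂^2 + a₂^2 * x₃^2) =
    (a₁ * d₁ + a₂ * d₂ + a₃ * d₃) * (x₂ * x₃)
  off₂ : x₂ * ((a₁ - a₃)^2 + d₂^2 + a₃^2 * x₁^2 + a₁^2 * x₃^2) =
    (a₁ * d₁ + a₂ * d₂ + a₃ * d₃) * (x₁ * x₃)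
  off₃ : x₃ * ((a₁ - a₂)^2 + d₃^2 + a₂^2 * x₁^2 + a₁^2 * x₂^2) =
    (a₁ * d₁ + a₂ * d₂ + a₃ * d₃) * (x₁ * x₂)
  ricciA₁ : a₁ * (a₂ + a₃ - a₁) = 1 + a₁ * (a₁ - a₂) * x₃^2 + a₁ * (a₁ - a₃) * x₂^2
    - a₁ * (x₂ * x₃) * (d₁ * x₁ - a₁ * (x₂ * x₃))
  ricciA₂ : a₂ * (a₁ + a₃ - a₂) = 1 + a₂ * (a₂ - a₁) * x₃^2 + a₂ * (a₂ - a₃) * x₁^2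
    - a₂ * (x₁ * x₃) * (d₂ * x₂ - a₂ * (x₁ * x₃))
  ricciA₃ : a₃ * (a₁ + a₂ - a₃) = 1 + a₃ * (a₃ - a₁) * x₂^2 + a₃ * (a₃ - a₂) * x₁^2
    - a₃ * (x₁ * x₂) * (d₃ * x₃ - a₃ * (x₁ * x₂))
  ricciD₁ : d₁ * (d₂ + d₃ - d₁) = 1 + d₁ * x₁ * (d₁ * x₁ - a₁ * (x₂ * x₃))
  ricciD_sum : d₂ * (d₁ + d₃ - d₂) + d₃ * (d₁ + d₂ - d₃) =
    2 + d₂ * x₂ * (d₂ * x₂ - a₂ * (x₁ * x₃)) + d₃ * x₃ * (d₃ * x₃ - a₃ * (x₁ * x₂))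
  ricciD₂ : d₂ = d₃ ∨ d₂ * (d₁ + d₃ - d₂) = 1 + d₂ * x₂ * (d₂ * x₂ - a₂ * (x₁ * x₃))

namespace DiagonalSystem

variable {a₁ a₂ a₃ d₁ d₂ d₃ x₁ x₂ x₃ : ℝ}

lemma d_eq_one (h : DiagonalSystem a₁ a₂ a₃ d₁ d₂ d₃ x₁ x₂ x₃)
    (w₁ : x₁ * (d₁ * x₁ - a₁ * (x₂ * x₃)) = 0) (w₂ : x₂ * (d₂ * x₂ - a₂ * (x₁ * x₃)) = 0)
    (w₃ : x₃ * (d₃ * x₃ - a₃ * (x₁ * x₂)) = 0) : d₁ = 1 ∧ d₂ = 1 ∧ d₃ = 1 := by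
  have e₁ : d₁ * (d₂ + d₃ - d₁) = 1 := by linear_combination h.ricciD₁ + d₁ * w₁
  have e₂ : d₂ * (d₁ + d₃ - d₂) + d₃ * (d₁ + d₂ - d₃) = 2 := by
    linear_combination h.ricciD_sum + d₂ * w₂ + d₃ * w₃
  rcases h.ricciD₂ with h₂ | h₂
  · refine eq_one_of_mul_eq_one h.d₁_pos e₁ ?_ ?_ <;> subst h₂ <;> linarith
  · have e₃ : d₂ * (d₁ + d₃ - d₂) = 1 := by linear_combination h₂ + d₂ * w₂
    exact eq_one_of_mul_eq_one h.d₁_pos e₁ e₃ (by linarith)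

lemma prod_nonneg (h : DiagonalSystem a₁ a₂ a₃ d₁ d₂ d₃ x₁ x₂ x₃) :
    d₁^2 * x₁^2 ≤ (a₁ * d₁ + a₂ * d₂ + a₃ * d₃) * (x₁ * x₂ * x₃) ∧
    d₂^2 * x₂^2 ≤ (a₁ * d₁ + a₂ * d₂ + a₃ * d₃) * (x₁ * x₂ * x₃) ∧
    d₃^2 * x₃^2 ≤ (a₁ * d₁ + a₂ * d₂ + a₃ * d₃) * (x₁ * x₂ * x₃) := by
  refine ⟨?_, ?_, ?_⟩
  · have : 0 ≤ x₁^2 * ((a₂ - a₃)^2 + a₃^2 * x₂^2 + a₂^2 * x₃^2) := by positivity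
    linear_combination this + x₁ * h.off₁
  · have : 0 ≤ x₂^2 * ((a₁ - a₃)^2 + a₃^2 * x₁^2 + a₁^2 * x₃^2) := by positivity
    linear_combination this + x₂ * h.off₂
  · have : 0 ≤ x₃^2 * ((a₁ - a₂)^2 + a₂^2 * x₁^2 + a₁^2 * x₂^2) := by positivity
    linear_combination this + x₃ * h.off₃

lemma eq_one_of_prod_eq_zero (h : DiagonalSystem a₁ a₂ a₃ d₁ d₂ d₃ x₁ x₂ x₃)
    (hx : x₁ * x₂ * x₃ = 0) : (a₁ = 1 ∧ a₂ = 1 ∧ a₃ = 1) ∧ (d₁ = 1 ∧ d₂ = 1 ∧ d₃ = 1) ∧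
      x₁ = 0 ∧ x₂ = 0 ∧ x₃ = 0 := by
  obtain ⟨e₁, e₂, e₃⟩ := h.prod_nonneg
  rw [hx, mul_zero] at e₁ e₂ e₃
  have key : ∀ {d x : ℝ}, 0 < d → d^2 * x^2 ≤ 0 → x = 0 := fun {d x} hd hx ↦ by
    have h₁ : d^2 * x^2 = 0 := le_antisymm hx (by positivity)
    simpa [hd.ne'] using h₁
  obtain rfl := key h.d₁_pos e₁
  obtain rfl := key h.d₂_pos e₂
  obtain rfl := key h.d₃_pos e₃
  refine ⟨eq_one_of_mul_eq_one h.a₁_pos ?_ ?_ ?_,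
    h.d_eq_one (by ring) (by ring) (by ring), rfl, rfl, rfl⟩
  · linear_combination h.ricciA₁
  · linear_combination h.ricciA₂
  · linear_combination h.ricciA₃

lemma beta₁ (h : DiagonalSystem a₁ a₂ a₃ d₁ d₂ d₃ x₁ x₂ x₃) :
    (d₂ * x₂ - a₂ * (x₁ * x₃))^2 + (d₃ * x₃ - a₃ * (x₁ * x₂))^2 + (a₁ - a₃)^2 * x₂^2
      + (a₁ - a₂)^2 * x₃^2 = 2 * (a₁ * (x₂ * x₃) * (d₁ * x₁ - a₁ * (x₂ * x₃))) := by
  linear_combination x₂ * h.off₂ + x₃ * h.off₃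

lemma beta₂ (h : DiagonalSystem a₁ a₂ a₃ d₁ d₂ d₃ x₁ x₂ x₃) :
    (d₁ * x₁ - a₁ * (x₂ * x₃))^2 + (d₃ * x₃ - a₃ * (x₁ * x₂))^2 + (a₂ - a₃)^2 * x₁^2
      + (a₁ - a₂)^2 * x₃^2 = 2 * (a₂ * (x₁ * x₃) * (d₂ * x₂ - a₂ * (x₁ * x₃))) := by
  linear_combination x₁ * h.off₁ + x₃ * h.off₃

lemma beta₃ (h : DiagonalSystem a₁ a₂ a₃ d₁ d₂ d₃ x₁ x₂ x₃) :
    (d₁ * x₁ - a₁ * (x₂ * x₃))^2 + (d₂ * x₂ - a₂ * (x₁ * x₃))^2 + (a₂ - a₃)^2 * x₁^2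
      + (a₁ - a₃)^2 * x₂^2 = 2 * (a₃ * (x₁ * x₂) * (d₃ * x₃ - a₃ * (x₁ * x₂))) := by
  linear_combination x₁ * h.off₁ + x₂ * h.off₂

lemma defect_eq_zero (h : DiagonalSystem a₁ a₂ a₃ d₁ d₂ d₃ x₁ x₂ x₃)
    (hw : d₁ * x₁ = a₁ * (x₂ * x₃) ∨ d₂ * x₂ = a₂ * (x₁ * x₃) ∨ d₃ * x₃ = a₃ * (x₁ * x₂)) :
    (d₁ * x₁ = a₁ * (x₂ * x₃) ∧ d₂ * x₂ = a₂ * (x₁ * x₃) ∧ d₃ * x₃ = a₃ * (x₁ * x₂)) ∧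
      (a₁ - a₂) * x₃ = 0 ∧ (a₁ - a₃) * x₂ = 0 := by
  have b₁ := h.beta₁
  have b₂ := h.beta₂
  have b₃ := h.beta₃
  have key : ∀ {p q r s : ℝ}, 0 ≤ r → 0 ≤ s → p^2 + q^2 + r + s = 0 →
      p = 0 ∧ q = 0 ∧ r = 0 ∧ s = 0 := by
    intro p q r s hr hs hsum
    have hp := sq_nonneg p
    have hq := sq_nonneg q
    exact ⟨pow_eq_zero_iff two_ne_zero |>.1 (by linarith),
      pow_eq_zero_iff two_ne_zero |>.1 (by linarith), by linarith, by linarith⟩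
  have hw₁ : d₁ * x₁ - a₁ * (x₂ * x₃) = 0 := by
    rcases hw with hw | hw | hw <;> rw [← sub_eq_zero] at hw
    · exact hw
    · rw [hw, mul_zero, mul_zero] at b₂
      exact (key (by positivity) (by positivity) b₂).1
    · rw [hw, mul_zero, mul_zero] at b₃
      exact (key (by positivity) (by positivity) b₃).1
  rw [hw₁, mul_zero, mul_zero] at b₁
  obtain ⟨e₁, e₂, e₃, e₄⟩ := key (by positivity) (by positivity) b₁
  rw [← mul_pow, pow_eq_zero_iff two_ne_zero] at e₃ e₄
  exact ⟨⟨sub_eq_zero.1 hw₁, sub_eq_zero.1 e₁, sub_eq_zero.1 e₂⟩, e₄, e₃⟩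

lemma eq_one_of_defect_eq_zero (h : DiagonalSystem a₁ a₂ a₃ d₁ d₂ d₃ x₁ x₂ x₃)
    (hx : x₁ * x₂ * x₃ ≠ 0)
    (hw : d₁ * x₁ = a₁ * (x₂ * x₃) ∨ d₂ * x₂ = a₂ * (x₁ * x₃) ∨ d₃ * x₃ = a₃ * (x₁ * x₂)) :
    (a₁ = 1 ∧ a₂ = 1 ∧ a₃ = 1) ∧ (d₁ = 1 ∧ d₂ = 1 ∧ d₃ = 1) ∧
      (x₁^2 = 1 ∧ x₂^2 = 1 ∧ x₃^2 = 1) ∧ x₁ * x₂ * x₃ = 1 := by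
  obtain ⟨⟨w₁, w₂, w₃⟩, q₃, q₂⟩ := h.defect_eq_zero hw
  have hx₁ : x₁ ≠ 0 := fun h₀ ↦ hx (by rw [h₀]; ring)
  have hx₂ : x₂ ≠ 0 := fun h₀ ↦ hx (by rw [h₀]; ring)
  have hx₃ : x₃ ≠ 0 := fun h₀ ↦ hx (by rw [h₀]; ring)
  have ha₂ : a₂ = a₁ := (sub_eq_zero.1 ((mul_eq_zero.1 q₃).resolve_right hx₃)).symm
  have ha₃ : a₃ = a₁ := (sub_eq_zero.1 ((mul_eq_zero.1 q₂).resolve_right hx₂)).symm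
  obtain ⟨rfl, rfl, rfl⟩ := h.d_eq_one (by rw [w₁]; ring) (by rw [w₂]; ring) (by rw [w₃]; ring)
  have ha := h.a₁_pos
  have hA := h.ricciA₁
  subst ha₂ ha₃
  have ha₁ : a₃ = 1 := by
    rw [w₁] at hA
    nlinarith
  subst ha₁
  simp only [one_mul] at w₁ w₂ w₃
  have e₁ : x₁^2 = 1 := mul_right_cancel₀ hx₂ (by linear_combination -x₁ * w₃ - w₂)
  have e₂ : x₂^2 = 1 := mul_right_cancel₀ hx₁ (by linear_combination -x₂ * w₃ - w₁)
  have e₃ : x₃^2 = 1 := mul_right_cancel₀ hx₁ (by linear_combination -x₃ * w₂ - w₁)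
  exact ⟨⟨rfl, rfl, rfl⟩, ⟨rfl, rfl, rfl⟩, ⟨e₁, e₂, e₃⟩, by linear_combination e₁ - x₁ * w₁⟩

lemma diagonalData (h : DiagonalSystem a₁ a₂ a₃ d₁ d₂ d₃ x₁ x₂ x₃) (hx : 0 < x₁ * x₂ * x₃)
    (w₁ : d₁ * x₁ ≠ a₁ * (x₂ * x₃)) (w₂ : d₂ * x₂ ≠ a₂ * (x₁ * x₃))
    (w₃ : d₃ * x₃ ≠ a₃ * (x₁ * x₂)) :
    DiagonalData a₁ a₂ a₃ d₁ d₂ d₃ ((d₁ * x₁ - a₁ * (x₂ * x₃))^2) ((d₂ * x₂ - a₂ * (x₁ * x₃))^2)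
      ((d₃ * x₃ - a₃ * (x₁ * x₂))^2) ((a₂ - a₃)^2 * x₁^2) ((a₁ - a₃)^2 * x₂^2)
      ((a₁ - a₂)^2 * x₃^2) (x₁^2) (x₂^2) (x₃^2) (x₁ * x₂ * x₃) where
  a₁_pos := h.a₁_pos
  a₂_pos := h.a₂_pos
  a₃_pos := h.a₃_pos
  d₁_pos := h.d₁_pos
  d₂_pos := h.d₂_pos
  d₃_pos := h.d₃_pos
  s₁_pos := by have := sub_ne_zero.2 w₁; positivity
  s₂_pos := by have := sub_ne_zero.2 w₂; positivity
  s₃_pos := by have := sub_ne_zero.2 w₃; positivity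
  t₁_nonneg := sq_nonneg _
  t₂_nonneg := sq_nonneg _
  t₃_nonneg := sq_nonneg _
  τ_pos := hx
  Q₁_eq := rfl
  Q₂_eq := rfl
  Q₃_eq := rfl
  prod₁ := by rw [h.beta₁]; ring
  prod₂ := by rw [h.beta₂]; ring
  prod₃ := by rw [h.beta₃]; ring
  cross₁ := by rw [h.beta₂, h.beta₃]; ring
  cross₂ := by rw [h.beta₁, h.beta₃]; ring
  cross₃ := by rw [h.beta₁, h.beta₂]; ring
  ricci₁ := by linear_combination h.ricciA₂ + h.ricciA₃ - h.ricciA₁ + x₁ * h.off₁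
  ricci₂ := by linear_combination h.ricciA₁ + h.ricciA₃ - h.ricciA₂ + x₂ * h.off₂
  ricci₃ := by linear_combination h.ricciA₁ + h.ricciA₂ - h.ricciA₃ + x₃ * h.off₃
  sum_eq := by
    linear_combination h.ricciD₁ + h.ricciD_sum - x₁ * h.off₁ - x₂ * h.off₂ - x₃ * h.off₃

lemma a_eq (h : DiagonalSystem a₁ a₂ a₃ d₁ d₂ d₃ x₁ x₂ x₃) (hx : 0 < x₁ * x₂ * x₃)
    (w₁ : d₁ * x₁ ≠ a₁ * (x₂ * x₃)) (w₂ : d₂ * x₂ ≠ a₂ * (x₁ * x₃))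
    (w₃ : d₃ * x₃ ≠ a₃ * (x₁ * x₂)) : a₁ = a₂ ∧ a₂ = a₃ := by
  have hdata := h.diagonalData hx w₁ w₂ w₃
  rcases h.ricciD₂ with h₂ | h₂
  · refine hdata.a_eq_of_ricci₁ h₂ ?_
    subst h₂
    linear_combination h.ricciD_sum - h.ricciD₁ - x₁ * h.off₁
  · refine hdata.a_eq_of_forall_ricci ?_ ?_ ?_
    · linear_combination h.ricciD_sum - h.ricciD₁ - x₁ * h.off₁
    · linear_combination h.ricciD_sum + h.ricciD₁ - 2 * h₂ - x₂ * h.off₂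
    · linear_combination h.ricciD₁ - h.ricciD_sum + 2 * h₂ - x₃ * h.off₃

lemma eq_of_defect_ne_zero (h : DiagonalSystem a₁ a₂ a₃ d₁ d₂ d₃ x₁ x₂ x₃)
    (hx : 0 < x₁ * x₂ * x₃) (w₁ : d₁ * x₁ ≠ a₁ * (x₂ * x₃)) (w₂ : d₂ * x₂ ≠ a₂ * (x₁ * x₃))
    (w₃ : d₃ * x₃ ≠ a₃ * (x₁ * x₂)) :
    a₁^2 = 1 / 2 ∧ (a₂ = a₁ ∧ a₃ = a₁) ∧ (d₁ = a₁⁻¹ ∧ d₂ = a₁⁻¹ ∧ d₃ = a₁⁻¹) ∧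
      (x₁^2 = 1 ∧ x₂^2 = 1 ∧ x₃^2 = 1) ∧ x₁ * x₂ * x₃ = 1 := by
  have hdata := h.diagonalData hx w₁ w₂ w₃
  obtain ⟨rfl, rfl⟩ := h.a_eq hx w₁ w₂ w₃
  have b₁ := h.beta₁
  have b₂ := h.beta₂
  have b₃ := h.beta₃
  have hvol := h.volume
  have hD₁ := h.ricciD₁
  have hD := h.ricciD_sum
  have ha := h.a₁_pos
  have hd₁ := h.d₁_pos
  obtain ⟨-, -, -, -, -, -, hs₁, -, -, -, -, -, -, -, -, -, p₁, p₂, p₃, -, -, -, r₁, r₂, r₃, -⟩ := hdata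
  obtain ⟨σ, hσ⟩ : ∃ σ, σ = (d₁ * x₁ - a₁ * (x₂ * x₃))^2 := ⟨_, rfl⟩
  have hσ₂ : (d₂ * x₂ - a₁ * (x₁ * x₃))^2 = σ := by linarith
  have hσ₃ : (d₃ * x₃ - a₁ * (x₁ * x₂))^2 = σ := by linarith
  rw [← hσ, hσ₂, hσ₃] at p₁ p₂ p₃
  rw [hσ₂, hσ₃] at b₁
  rw [← hσ, hσ₃] at b₂
  rw [← hσ, hσ₂] at b₃
  rw [← hσ] at r₁ hs₁
  have hk : 4 * σ * a₁ * (x₁ * x₂ * x₃) ≠ 0 := by positivity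
  have e₂ : d₂ = d₁ := mul_left_cancel₀ hk (by linarith)
  have e₃ : d₃ = d₁ := mul_left_cancel₀ hk (by linarith)
  subst e₂ e₃
  have had : a₁ * d₃ = 1 := by
    have : (a₁ * d₃)^3 = 1 := by linarith
    exact (pow_eq_one_iff_of_nonneg (by positivity) three_ne_zero).1 this
  have hdd : d₃^2 = 1 + 2 * σ := by linarith
  have hσ' : σ = 1 / 2 := by
    have : σ * (1 - 2 * σ) = 0 := by
      linear_combination (a₁ * d₃ + 1) * had - d₃^2 * r₁ - (1 - σ) * hdd
    have := (mul_eq_zero.1 this).resolve_left hs₁.ne'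
    linarith
  subst hσ'
  have haa : a₁^2 = 1 / 2 := by linarith
  have hdd' : d₃^2 = 2 := by linarith
  have hd : d₃ = a₁⁻¹ := eq_inv_of_mul_eq_one_right had
  have t₁ : 2 * x₁^2 = 1 + x₁ * x₂ * x₃ := by
    linear_combination -hσ - 1 / 2 * b₁ - x₁^2 * hdd' + x₁ * x₂ * x₃ * had
  have t₂ : 2 * x₂^2 = 1 + x₁ * x₂ * x₃ := by
    linear_combination hσ₂ - 1 / 2 * b₂ - x₂^2 * hdd' + x₁ * x₂ * x₃ * had
  have t₃ : 2 * x₃^2 = 1 + x₁ * x₂ * x₃ := by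
    linear_combination hσ₃ - 1 / 2 * b₃ - x₃^2 * hdd' + x₁ * x₂ * x₃ * had
  have t₄ : 2 * (x₁ * x₂ * x₃) - x₂^2 * x₃^2 = 1 := by
    linear_combination -b₁ - 2 * (x₁ * x₂ * x₃) * had + 2 * (x₂^2 * x₃^2) * haa
  have hτ : (x₁ * x₂ * x₃)^2 = x₁^2 * x₂^2 * x₃^2 := by ring
  generalize x₁ * x₂ * x₃ = τ at *
  have u₁ : x₁^2 = (1 + τ) / 2 := by linarith
  have u₂ : x₂^2 = (1 + τ) / 2 := by linarith
  have u₃ : x₃^2 = (1 + τ) / 2 := by linarith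
  rw [u₁, u₂, u₃] at hτ
  rw [u₂, u₃] at t₄
  have hτ₁ : τ = 1 := by
    have e : (τ - 1) * (τ - 5) = 0 := by linear_combination -4 * t₄
    rcases mul_eq_zero.1 e with e | e
    · linarith
    · obtain rfl : τ = 5 := by linarith
      norm_num at hτ
  subst hτ₁
  exact ⟨haa, ⟨rfl, rfl⟩, ⟨hd, hd, hd⟩, ⟨by linarith, by linarith, by linarith⟩, rfl⟩

theorem classification (h : DiagonalSystem a₁ a₂ a₃ d₁ d₂ d₃ x₁ x₂ x₃) :
    ((a₁ = 1 ∧ a₂ = 1 ∧ a₃ = 1) ∧ (d₁ = 1 ∧ d₂ = 1 ∧ d₃ = 1) ∧ x₁ = 0 ∧ x₂ = 0 ∧ x₃ = 0) ∨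
    ∃ δ : ℝ, (δ = 1 ∨ δ = (Real.sqrt 2)⁻¹) ∧ (a₁ = δ ∧ a₂ = δ ∧ a₃ = δ) ∧
      (d₁ = δ⁻¹ ∧ d₂ = δ⁻¹ ∧ d₃ = δ⁻¹) ∧ (x₁^2 = 1 ∧ x₂^2 = 1 ∧ x₃^2 = 1) ∧
      x₁ * x₂ * x₃ = 1 := by
  by_cases hx : x₁ * x₂ * x₃ = 0
  · exact Or.inl (h.eq_one_of_prod_eq_zero hx)
  right
  by_cases hw : d₁ * x₁ = a₁ * (x₂ * x₃) ∨ d₂ * x₂ = a₂ * (x₁ * x₃) ∨ d₃ * x₃ = a₃ * (x₁ * x₂)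
  · obtain ⟨ha, hd, hs⟩ := h.eq_one_of_defect_eq_zero hx hw
    exact ⟨1, Or.inl rfl, ha, by rwa [inv_one], hs⟩
  · push Not at hw
    have hpos : 0 < x₁ * x₂ * x₃ := by
      have := h.a₁_pos
      have := h.a₂_pos
      have := h.a₃_pos
      have := h.d₁_pos
      have := h.d₂_pos
      have := h.d₃_pos
      have hL : 0 < a₁ * d₁ + a₂ * d₂ + a₃ * d₃ := by positivity
      have hsq : 0 ≤ d₁^2 * x₁^2 := by positivity
      exact lt_of_le_of_ne ((mul_nonneg_iff_of_pos_left hL).1 (hsq.trans h.prod_nonneg.1))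
        (Ne.symm hx)
    obtain ⟨ha, ⟨ha₂, ha₃⟩, hd, hs⟩ := h.eq_of_defect_ne_zero hpos hw.1 hw.2.1 hw.2.2
    refine ⟨a₁, Or.inr ?_, ⟨rfl, ha₂, ha₃⟩, hd, hs⟩
    rw [← Real.sqrt_inv, eq_comm, Real.sqrt_eq_iff_mul_self_eq_of_pos h.a₁_pos]
    linarith

end DiagonalSystem

lemma sq_eq_mul_of_cross {m m' k u v : ℝ} (hu : u ≠ 0) (hv : v ≠ 0)
    (h₁ : m * u = k * v) (h₂ : m' * v = k * u) : k^2 = m * m' := by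
  refine mul_right_cancel₀ (mul_ne_zero hu hv) ?_
  linear_combination -(m' * v) * h₁ - k * v * h₂

lemma exists_scale_of_cross {m m' k u v : ℝ} (hm : 0 < m) (hu : u ≠ 0) (hv : v ≠ 0)
    (h₁ : m * u = k * v) (h₂ : m' * v = k * u) :
    ∃ p, 0 ≤ p ∧ v^2 = p * m ∧ u^2 = p * m' ∧ u * v = p * k := by
  have hk := sq_eq_mul_of_cross hu hv h₁ h₂
  refine ⟨v^2 / m, by positivity, by field_simp, ?_, ?_⟩
  · field_simp
    refine mul_left_cancel₀ hm.ne' ?_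
    linear_combination (m * u + k * v) * h₁ + v^2 * hk
  · field_simp
    linear_combination h₁

lemma false_of_gap_le {D g β w : ℝ} (h₁ : D * (g - D) = 1 + w^2 + β) (h₂ : (g - D) * g ≤ β) :
    False := by
  nlinarith [sq_nonneg (g - D), sq_nonneg w]

/-- A solution whose four mixed off-diagonal entries are all nonzero has `E = F`. -/
lemma eq_of_mixed_ne_zero {A B C D E F X Y Z W G : ℝ} (hE : 0 < E) (hF : 0 < F)
    (hY : Y ≠ 0) (hZ : Z ≠ 0) (hW : W ≠ 0) (hG : G ≠ 0)
    (hYZ : (E^2 + C^2 * X^2 + (A - C)^2) * Y =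
      (A * (D * X - A * (Y * Z - W * G)) + (B * E + C * F) * X) * Z)
    (hZY : (F^2 + B^2 * X^2 + (A - B)^2) * Z =
      (A * (D * X - A * (Y * Z - W * G)) + (B * E + C * F) * X) * Y)
    (hWG : (E^2 + B^2 * X^2 + (A - B)^2) * W =
      -(A * (D * X - A * (Y * Z - W * G)) + (C * E + B * F) * X) * G)
    (hGW : (F^2 + C^2 * X^2 + (A - C)^2) * G =
      -(A * (D * X - A * (Y * Z - W * G)) + (C * E + B * F) * X) * W)
    (hD : D * (E + F - D) = 1 + D * X * (D * X - A * (Y * Z - W * G)))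
    (hEF : E * (D + F - E) - F * (D + E - F) =
      E^2 * (W^2 + Y^2) - B * E * (X * (Y * Z)) + C * E * (X * (W * G))
        - (F^2 * (Z^2 + G^2) - C * F * (X * (Y * Z)) + B * F * (X * (W * G)))) : E = F := by
  by_contra hne
  have hne' : E - F ≠ 0 := sub_ne_zero.2 hne
  generalize hδ : Y * Z - W * G = δ at *
  generalize hw : D * X - A * δ = w at *
  have hk := sq_eq_mul_of_cross hY hZ hYZ hZY
  have hk' := sq_eq_mul_of_cross hW hG hWG hGW
  obtain ⟨p, hp, hZ₂, hY₂, hYZ₂⟩ := exists_scale_of_cross (by positivity) hY hZ hYZ hZY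
  obtain ⟨n, hn, hG₂, hW₂, hWG₂⟩ := exists_scale_of_cross (by positivity) hW hG hWG hGW
  have hδ' : δ = p * (A * w + (B * E + C * F) * X) + n * (A * w + (C * E + B * F) * X) := by
    linear_combination hYZ₂ - hWG₂ - hδ
  rw [hZ₂, hG₂, hY₂, hW₂, hYZ₂, hWG₂] at hEF
  refine false_of_gap_le (D := D) (g := E + F) (β := A * w * δ) (w := w)
    (by linear_combination hD + w * hw) ?_
  have hS : 0 ≤ (p + n) * (A * w)^2 := by positivity
  have hfac : (B - C) * (2 * (A * w * X) - (E + F) * (B + C - 2 * A)) = 0 := by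
    refine (mul_eq_zero.1 (?_ : (E - F) * _ = 0)).resolve_left hne'
    linear_combination hk - hk'
  rcases mul_eq_zero.1 hfac with h | h
  · obtain rfl : B = C := sub_eq_zero.1 h
    have hf : E + F - D = (p + n) * (A * w * X * B - (A - B)^2 * (E + F)) := by
      refine mul_left_cancel₀ hne' ?_
      linear_combination -hEF
    have h₀ : 0 ≤ (p + n) * ((A - B)^2 * (E + F)^2) := by positivity
    rw [hf, hδ']
    linear_combination h₀ + hS
  · have hω : A * w * X = (E + F) * (B + C - 2 * A) / 2 := by linarith
    have hf : E + F - D = (p + n) * ((E + F) * (B + C - 2 * A) * (B + C)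
        - 2 * ((A - C)^2 + (A - B)^2) * (E + F)) / 4
          - (p - n) * (B - C) * (B + C - 2 * A) * (E - F) / 4 := by
      refine mul_left_cancel₀ hne' ?_
      linear_combination -hEF + (p * (B * E - C * F) + n * (C * E - B * F)) * hω
    have h₀ : 0 ≤ (E + F) * (p * (E * (B - A)^2 + F * (C - A)^2)
        + n * (E * (C - A)^2 + F * (B - A)^2)) := by positivity
    have hβ : A * w * δ = (p + n) * (A * w)^2 + (E + F) * (B + C - 2 * A) / 2 *
        (p * (B * E + C * F) + n * (C * E + B * F)) := by
      rw [hδ']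
      linear_combination (p * (B * E + C * F) + n * (C * E + B * F)) * hω
    rw [hβ, hf]
    linear_combination h₀ + hS

/-- The system (S2) with `μ = -1` and positive `A, …, F`, where every Ricci equation is multiplied
by the corresponding scale factor and the volume constraint is used to remove the products. -/
structure MixedSystem (A B C D E F X Y Z W G : ℝ) : Prop where
  A_pos : 0 < A
  B_pos : 0 < B
  C_pos : 0 < C
  D_pos : 0 < D
  E_pos : 0 < E
  F_pos : 0 < F
  volume : A * B * C * D * E * F = 1
  offX : X * ((B - C)^2 + D^2 + C^2 * (Y^2 + G^2) + B^2 * (W^2 + Z^2)) =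
    A * D * (Y * Z - W * G) + (B * E + C * F) * (Y * Z) - (C * E + B * F) * (W * G)
  offY : (E^2 + C^2 * X^2 + (A - C)^2) * Y =
    (A * (D * X - A * (Y * Z - W * G)) + (B * E + C * F) * X) * Z
  offZ : (F^2 + B^2 * X^2 + (A - B)^2) * Z =
    (A * (D * X - A * (Y * Z - W * G)) + (B * E + C * F) * X) * Y
  offW : (E^2 + B^2 * X^2 + (A - B)^2) * W =
    -(A * (D * X - A * (Y * Z - W * G)) + (C * E + B * F) * X) * G
  offG : (F^2 + C^2 * X^2 + (A - C)^2) * G =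
    -(A * (D * X - A * (Y * Z - W * G)) + (C * E + B * F) * X) * W
  ricciA : A * (B + C - A) = 1 + A * (A - B) * (W^2 + Z^2) + A * (A - C) * (Y^2 + G^2)
    - A * (Y * Z - W * G) * (D * X - A * (Y * Z - W * G))
  ricciB : B * (A + C - B) = 1 + B * (B - A) * (W^2 + Z^2) + B * (B - C) * X^2
    + B^2 * X^2 * (W^2 + Z^2) - B * E * (X * (Y * Z)) + B * F * (X * (W * G))
  ricciC : C * (A + B - C) = 1 + C * (C - A) * (Y^2 + G^2) + C * (C - B) * X^2
    + C^2 * X^2 * (Y^2 + G^2) - C * F * (X * (Y * Z)) + C * E * (X * (W * G))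
  ricciD : D * (E + F - D) = 1 + D * X * (D * X - A * (Y * Z - W * G))
  ricciE : E * (D + F - E) =
    1 + E^2 * (W^2 + Y^2) - B * E * (X * (Y * Z)) + C * E * (X * (W * G))
  ricciF : F * (D + E - F) =
    1 + F^2 * (Z^2 + G^2) - C * F * (X * (Y * Z)) + B * F * (X * (W * G))

lemma SystemS2.mixedSystem {A B C D E F X Y Z W G : ℝ} (hA : 0 < A) (hB : 0 < B) (hC : 0 < C)
    (hD : 0 < D) (hE : 0 < E) (hF : 0 < F) (h : SystemS2 A B C D E F X Y Z W G (-1)) :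
    MixedSystem A B C D E F X Y Z W G := by
  obtain ⟨hV, rD, rE, rB, rF, rA, rC, oG, oZ, oY, oW, oX⟩ := h
  constructor
  any_goals assumption
  · linear_combination hV
  · linear_combination -oX
  · linear_combination -oY
  · linear_combination -oZ
  · linear_combination -oW
  · linear_combination -oG
  · linear_combination A * rA + hV
  · linear_combination B * rB + hV
  · linear_combination C * rC + hV
  · linear_combination D * rD + hV
  · linear_combination E * rE + hV
  · linear_combination F * rF + hV

namespace MixedSystem

variable {A B C D E F X Y Z W G : ℝ}

lemma Z_eq_zero_of_Y (h : MixedSystem A B C D E F X Y Z W G) (hY : Y = 0) : Z = 0 := by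
  have hF := h.F_pos
  have := h.offZ
  rw [hY, mul_zero] at this
  exact (mul_eq_zero.1 this).resolve_left (by positivity)

lemma Y_eq_zero_of_Z (h : MixedSystem A B C D E F X Y Z W G) (hZ : Z = 0) : Y = 0 := by
  have hE := h.E_pos
  have := h.offY
  rw [hZ, mul_zero] at this
  exact (mul_eq_zero.1 this).resolve_left (by positivity)

lemma G_eq_zero_of_W (h : MixedSystem A B C D E F X Y Z W G) (hW : W = 0) : G = 0 := by
  have hF := h.F_pos
  have := h.offG
  rw [hW, mul_zero] at this
  exact (mul_eq_zero.1 this).resolve_left (by positivity)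

lemma W_eq_zero_of_G (h : MixedSystem A B C D E F X Y Z W G) (hG : G = 0) : W = 0 := by
  have hE := h.E_pos
  have := h.offW
  rw [hG, mul_zero] at this
  exact (mul_eq_zero.1 this).resolve_left (by positivity)

lemma diagonal_of_W_G_eq_zero (h : MixedSystem A B C D E F X Y Z 0 0) :
    DiagonalSystem A B C D E F X Y Z where
  a₁_pos := h.A_pos
  a₂_pos := h.B_pos
  a₃_pos := h.C_pos
  d₁_pos := h.D_pos
  d₂_pos := h.E_pos
  d₃_pos := h.F_pos
  volume := h.volume
  off₁ := by linear_combination h.offX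
  off₂ := by linear_combination h.offY
  off₃ := by linear_combination h.offZ
  ricciA₁ := by linear_combination h.ricciA
  ricciA₂ := by linear_combination h.ricciB
  ricciA₃ := by linear_combination h.ricciC
  ricciD₁ := by linear_combination h.ricciD
  ricciD_sum := by linear_combination h.ricciE + h.ricciF
  ricciD₂ := Or.inr (by linear_combination h.ricciE)

lemma diagonal_of_Y_Z_eq_zero (h : MixedSystem A B C D E F X 0 0 W G) :
    DiagonalSystem A B C D F E X G (-W) where
  a₁_pos := h.A_pos
  a₂_pos := h.B_pos
  a₃_pos := h.C_pos
  d₁_pos := h.D_pos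
  d₂_pos := h.F_pos
  d₃_pos := h.E_pos
  volume := by linear_combination h.volume
  off₁ := by linear_combination h.offX
  off₂ := by linear_combination h.offG
  off₃ := by linear_combination -h.offW
  ricciA₁ := by linear_combination h.ricciA
  ricciA₂ := by linear_combination h.ricciB
  ricciA₃ := by linear_combination h.ricciC
  ricciD₁ := by linear_combination h.ricciD
  ricciD_sum := by linear_combination h.ricciE + h.ricciF
  ricciD₂ := Or.inr (by linear_combination h.ricciF)

lemma E_eq_F (h : MixedSystem A B C D E F X Y Z W G)
    (hY : Y ≠ 0) (hZ : Z ≠ 0) (hW : W ≠ 0) (hG : G ≠ 0) : E = F :=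
  eq_of_mixed_ne_zero h.E_pos h.F_pos hY hZ hW hG h.offY h.offZ h.offW h.offG h.ricciD
    (by linear_combination h.ricciE - h.ricciF)

/-- When `E = F`, the mixed block can be diagonalised by rotations preserving the metric. -/
lemma exists_diagonal_of_E_eq_F (h : MixedSystem A B C D E E X Y Z W G) (hY : Y ≠ 0) (hZ : Z ≠ 0) :
    ∃ x₂ x₃ : ℝ, x₂^2 = Y^2 + G^2 ∧ x₃^2 = W^2 + Z^2 ∧ x₂ * x₃ = Y * Z - W * G ∧
      DiagonalSystem A B C D E E X x₂ x₃ := by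
  have hE := h.E_pos
  have horth : Y * W + G * Z = 0 := by
    refine (mul_eq_zero.1 (?_ : (E^2 + C^2 * X^2 + (A - C)^2) * _ = 0)).resolve_left
      (by positivity)
    linear_combination W * h.offY + Z * h.offG
  obtain ⟨x₂, hx₂, hx₂_sq⟩ : ∃ x₂ : ℝ, x₂ ≠ 0 ∧ x₂^2 = Y^2 + G^2 :=
    ⟨√(Y^2 + G^2), by positivity, Real.sq_sqrt (by positivity)⟩
  obtain ⟨x₃, hx⟩ : ∃ x₃ : ℝ, x₂ * x₃ = Y * Z - W * G :=
    ⟨(Y * Z - W * G) / x₂, mul_div_cancel₀ _ hx₂⟩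
  have hx₃_sq : x₃^2 = W^2 + Z^2 := by
    refine mul_left_cancel₀ (pow_ne_zero 2 hx₂) ?_
    linear_combination (x₂ * x₃ + (Y * Z - W * G)) * hx - (W^2 + Z^2) * hx₂_sq
      - (Y * W + G * Z) * horth
  have hx₃ : x₃ ≠ 0 := by
    rintro rfl
    have : 0 < W^2 + Z^2 := by positivity
    linarith
  refine ⟨x₂, x₃, hx₂_sq, hx₃_sq, hx, ?_⟩
  exact
    { a₁_pos := h.A_pos
      a₂_pos := h.B_pos
      a₃_pos := h.C_pos
      d₁_pos := h.D_pos
      d₂_pos := h.E_pos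
      d₃_pos := h.E_pos
      volume := h.volume
      off₁ := by
        rw [hx₂_sq, hx₃_sq, hx]
        linear_combination h.offX
      off₂ := by
        refine mul_left_cancel₀ hx₂ ?_
        linear_combination Y * h.offY + G * h.offG
          + (E^2 + C^2 * X^2 + (A - C)^2) * hx₂_sq
          + (A^2 * (x₂ * x₃ + Y * Z - W * G) - (A * D + B * E + C * E) * X) * hx
      off₃ := by
        refine mul_left_cancel₀ hx₃ ?_
        linear_combination Z * h.offZ + W * h.offW
          + (E^2 + B^2 * X^2 + (A - B)^2) * hx₃_sq
          + (A^2 * (x₂ * x₃ + Y * Z - W * G) - (A * D + B * E + C * E) * X) * hx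
      ricciA₁ := by
        rw [hx₂_sq, hx₃_sq, hx]
        exact h.ricciA
      ricciA₂ := by
        linear_combination h.ricciB - (B * (B - A) + B^2 * X^2) * hx₃_sq + B * E * X * hx
      ricciA₃ := by
        linear_combination h.ricciC - (C * (C - A) + C^2 * X^2) * hx₂_sq + C * E * X * hx
      ricciD₁ := by
        rw [hx]
        exact h.ricciD
      ricciD_sum := by
        linear_combination h.ricciE + h.ricciF - E^2 * hx₂_sq - E^2 * hx₃_sq
          + (B + C) * E * X * hx
      ricciD₂ := Or.inl rfl }

end MixedSystem

/-- Classification of the solutions of (S2) with `μ = -1` and positive `A,…,F`: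
either the trivial solution `(1,1,1,1,1,1,0,0,0,0,0)`, or a member of the
one-parameter families `(δ,δ,δ,δ⁻¹,δ⁻¹,δ⁻¹,X,Y,XY,-X𝒞,𝒞)` with
`δ ∈ {1,1/√2}`, `X ∈ {-1,1}` and `Y² + 𝒞² = 1`. -/
theorem systemS2_mu_neg_one_classification
    (A B C D E F X Y Z W 𝒞 μ : ℝ)
    (hA : 0 < A) (hB : 0 < B) (hC : 0 < C)
    (hD : 0 < D) (hE : 0 < E) (hF : 0 < F)
    (hμ : μ = -1)
    (hsol : SystemS2 A B C D E F X Y Z W 𝒞 μ) :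
    (A = 1 ∧ B = 1 ∧ C = 1 ∧ D = 1 ∧ E = 1 ∧ F = 1 ∧
      X = 0 ∧ Y = 0 ∧ Z = 0 ∧ W = 0 ∧ 𝒞 = 0) ∨
    (∃ δ : ℝ, (δ = 1 ∨ δ = (Real.sqrt 2)⁻¹) ∧
      A = δ ∧ B = δ ∧ C = δ ∧ D = δ⁻¹ ∧ E = δ⁻¹ ∧ F = δ⁻¹ ∧
      (X = -1 ∨ X = 1) ∧ Y^2 + 𝒞^2 = 1 ∧ Z = X*Y ∧ W = -(X*𝒞)) := by
  subst hμ
  have h := hsol.mixedSystem hA hB hC hD hE hF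
  have sign {x : ℝ} (hx : x^2 = 1) : x = -1 ∨ x = 1 :=
    (sq_eq_one_iff.1 hx).symm
  by_cases hG : 𝒞 = 0
  · obtain rfl := h.W_eq_zero_of_G hG
    subst hG
    rcases h.diagonal_of_W_G_eq_zero.classification with
      ⟨⟨a₁, a₂, a₃⟩, ⟨d₁, d₂, d₃⟩, x₁, x₂, x₃⟩ |
      ⟨δ, hδ, ⟨a₁, a₂, a₃⟩, ⟨d₁, d₂, d₃⟩, ⟨x₁, x₂, x₃⟩, hx⟩
    · exact Or.inl ⟨a₁, a₂, a₃, d₁, d₂, d₃, x₁, x₂, x₃, rfl, rfl⟩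
    · refine Or.inr ⟨δ, hδ, a₁, a₂, a₃, d₁, d₂, d₃, sign x₁, by simpa using x₂, ?_, by simp⟩
      linear_combination X * Y * x₃ - Z * hx
  by_cases hY : Y = 0
  · obtain rfl := h.Z_eq_zero_of_Y hY
    subst hY
    rcases h.diagonal_of_Y_Z_eq_zero.classification with
      ⟨⟨a₁, a₂, a₃⟩, ⟨d₁, d₂, d₃⟩, x₁, x₂, x₃⟩ |
      ⟨δ, hδ, ⟨a₁, a₂, a₃⟩, ⟨d₁, d₂, d₃⟩, ⟨x₁, x₂, x₃⟩, hx⟩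
    · exact absurd x₂ hG
    · refine Or.inr ⟨δ, hδ, a₁, a₂, a₃, d₁, d₃, d₂, sign x₁, by simpa using x₂, by simp, ?_⟩
      linear_combination -(X * 𝒞) * x₃ - W * hx
  have hZ : Z ≠ 0 := fun hZ ↦ hY (h.Y_eq_zero_of_Z hZ)
  have hW : W ≠ 0 := fun hW ↦ hG (h.G_eq_zero_of_W hW)
  obtain rfl := h.E_eq_F hY hZ hW hG
  obtain ⟨y, z, hy, hz, hyz, hdiag⟩ := h.exists_diagonal_of_E_eq_F hY hZ
  rcases hdiag.classification with
    ⟨-, -, -, y₀, -⟩ | ⟨δ, hδ, ⟨a₁, a₂, a₃⟩, ⟨d₁, d₂, d₃⟩, ⟨x₁, x₂, x₃⟩, hx⟩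
  · have : 0 < Y^2 + 𝒞^2 := by positivity
    rw [← hy, y₀] at this
    norm_num at this
  · have hsum : (Z - X * Y)^2 + (W + X * 𝒞)^2 = 0 := by
      linear_combination x₃ - hz + X^2 * (x₂ - hy) + x₁ - 2 * hx + 2 * X * hyz
    have hZ₀ : Z - X * Y = 0 := by nlinarith [sq_nonneg (W + X * 𝒞)]
    have hW₀ : W + X * 𝒞 = 0 := by nlinarith [sq_nonneg (Z - X * Y)]
    exact Or.inr ⟨δ, hδ, a₁, a₂, a₃, d₁, d₂, d₃, sign x₁, by rw [← hy, x₂],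
      by linear_combination hZ₀, by linear_combination hW₀⟩
end

section
/- Let (A,B,C,D,E,F,X,Y,Z,W,𝒞,μ) ∈ ℝ¹² with A,B,C,D,E,F > 0 be a solution of the system (S2) with μ = −5/(3√3). Then A = B = C = 3^{1/4}/√2, D = E = F = √2/3^{1/4}, X ∈ {−1/√3, 1/√3}, Y² + 𝒞² = 1/3, Z = √3·XY, and W = −√3·X𝒞. (These are exactly the solutions with μ = −5/(3√3) and positive A,…,F; all of them correspond to metrics isometric to a multiple of the nearly Kähler metric on S³×S³.) -/
/-- The diagonal Einstein equations written in variables for which exchanging `p` and `q` and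
permuting the three indices simultaneously are manifest symmetries; `δ` measures the failure of
the second and third `p`-equations. Here `n i = 1 / x i`. -/
structure PairedSystem (p₁ p₂ p₃ q₁ q₂ q₃ x₁ x₂ x₃ n₁ n₂ n₃ ρ m δ : ℝ) : Prop where
  p₁_pos : 0 < p₁
  p₂_pos : 0 < p₂
  p₃_pos : 0 < p₃
  q₁_pos : 0 < q₁
  q₂_pos : 0 < q₂
  q₃_pos : 0 < q₃
  x₁_pos : 0 < x₁
  x₂_pos : 0 < x₂
  x₃_pos : 0 < x₃
  n₁_pos : 0 < n₁
  n₂_pos : 0 < n₂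
  n₃_pos : 0 < n₃
  ρ_pos : 0 < ρ
  m_pos : 0 < m
  xn₁ : x₁ * n₁ = 1
  xn₂ : x₂ * n₂ = 1
  xn₃ : x₃ * n₃ = 1
  ρ_sq : ρ ^ 2 * ((1 + n₁) * (1 + n₂) * (1 + n₃)) = 1
  P₁ : p₁ * (p₂ + p₃) - (1 + x₁) * p₁ ^ 2 + ρ * ((1 + x₁) * (p₁ * q₁)) = m
  P₂ : p₂ * (p₁ + p₃) - (1 + x₂) * p₂ ^ 2 + ρ * ((1 + x₂) * (p₂ * q₂)) = m + δ
  P₃ : p₃ * (p₁ + p₂) - (1 + x₃) * p₃ ^ 2 + ρ * ((1 + x₃) * (p₃ * q₃)) = m - δ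
  Q₁ : q₁ * (q₂ + q₃) - (1 + x₁) * q₁ ^ 2 + ρ * ((1 + x₁) * (p₁ * q₁)) = m
  Q₂ : q₂ * (q₁ + q₃) - (1 + x₂) * q₂ ^ 2 + ρ * ((1 + x₂) * (p₂ * q₂)) = m
  Q₃ : q₃ * (q₁ + q₂) - (1 + x₃) * q₃ ^ 2 + ρ * ((1 + x₃) * (p₃ * q₃)) = m
  R₁ : (1 + x₁) * p₁ ^ 2 + (1 + x₂) * q₂ ^ 2 + (1 + x₃) * q₃ ^ 2 - 2 * q₂ * q₃ =
    ρ * ((1 + x₁) * (p₁ * q₁) + (1 + x₂) * (p₂ * q₂) + (1 + x₃) * (p₃ * q₃)) * (1 + n₁)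
  R₂ : (1 + x₂) * p₂ ^ 2 + (1 + x₁) * q₁ ^ 2 + (1 + x₃) * q₃ ^ 2 - 2 * q₁ * q₃ =
    ρ * ((1 + x₁) * (p₁ * q₁) + (1 + x₂) * (p₂ * q₂) + (1 + x₃) * (p₃ * q₃)) * (1 + n₂)
  R₃ : (1 + x₃) * p₃ ^ 2 + (1 + x₁) * q₁ ^ 2 + (1 + x₂) * q₂ ^ 2 - 2 * q₁ * q₂ =
    ρ * ((1 + x₁) * (p₁ * q₁) + (1 + x₂) * (p₂ * q₂) + (1 + x₃) * (p₃ * q₃)) * (1 + n₃)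

namespace PairedSystem

theorem add_le_mul_of_relation {p₂ q₁ q₃ x₁ x₂ x₃ n₁ n₂ n₃ ρ K d : ℝ}
    (hx₃ : 0 < x₃) (hn₁ : 0 < n₁) (hn₃ : 0 < n₃)
    (xn₁ : x₁ * n₁ = 1) (xn₃ : x₃ * n₃ = 1)
    (ρ_sq : ρ ^ 2 * ((1 + n₁) * (1 + n₂) * (1 + n₃)) = 1)
    (R : (1 + x₂) * p₂ ^ 2 + (1 + x₁) * q₁ ^ 2 + (1 + x₃) * q₃ ^ 2 - 2 * q₁ * q₃ =
      ρ * K * (1 + n₂) + d) :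
    (1 + n₁) * ((1 + x₂) * p₂ ^ 2) + (1 + x₃) * q₃ ^ 2 ≤
      (1 + n₁) * ((1 + n₂) * (ρ * (K - ρ * (1 + n₁) * (1 + x₁) * q₁ ^ 2)) + d) := by
  have h : (1 + n₂) * (ρ * (K - ρ * (1 + n₁) * (1 + x₁) * q₁ ^ 2)) + d =
      (1 + x₂) * p₂ ^ 2 + (1 + x₃) * q₃ ^ 2 - 2 * q₁ * q₃ + (1 + x₁) * q₁ ^ 2 -
        ρ ^ 2 * ((1 + n₁) * (1 + n₂) * (1 + n₃)) * ((1 + x₁) * q₁ ^ 2) / (1 + n₃) := by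
    rw [eq_sub_iff_add_eq, ← eq_sub_iff_add_eq', div_eq_iff (by positivity)]
    linear_combination -(1 + n₃) * R
  rw [h, ρ_sq]
  have h₃ : (1 + x₁) * q₁ ^ 2 - 1 * ((1 + x₁) * q₁ ^ 2) / (1 + n₃) =
      (1 + x₁) * q₁ ^ 2 / (1 + x₃) := by
    field_simp
    linear_combination (1 + x₁) * q₁ ^ 2 * xn₃
  have h₄ : (1 + n₁) * ((1 + x₃) * q₃ ^ 2 - 2 * q₁ * q₃ + (1 + x₁) * q₁ ^ 2 / (1 + x₃)) -
      (1 + x₃) * q₃ ^ 2 = n₁ * ((1 + x₁) * q₁ - (1 + x₃) * q₃) ^ 2 / (1 + x₃) := by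
    field_simp
    linear_combination (2 * q₁ * q₃ * (1 + x₃) - (1 + x₁) * q₁ ^ 2) * xn₁
  have h₅ : 0 ≤ n₁ * ((1 + x₁) * q₁ - (1 + x₃) * q₃) ^ 2 / (1 + x₃) := by positivity
  linear_combination h₅ - h₄ - (1 + n₁) * h₃

/-- A Cauchy–Schwarz argument, allowing for errors `d₂` and `d₃` in the two relations used. -/
theorem mul_le_of_relations {p₁ p₂ p₃ q₁ q₂ q₃ x₁ x₂ x₃ n₁ n₂ n₃ ρ d₂ d₃ : ℝ}
    (hp₂ : 0 < p₂) (hp₃ : 0 < p₃) (hq₁ : 0 < q₁) (hq₂ : 0 < q₂) (hq₃ : 0 < q₃)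
    (hx₁ : 0 < x₁) (hx₂ : 0 < x₂) (hx₃ : 0 < x₃) (hn₁ : 0 < n₁) (hn₂ : 0 < n₂) (hn₃ : 0 < n₃)
    (hρ : 0 < ρ) (xn₁ : x₁ * n₁ = 1) (xn₂ : x₂ * n₂ = 1) (xn₃ : x₃ * n₃ = 1)
    (ρ_sq : ρ ^ 2 * ((1 + n₁) * (1 + n₂) * (1 + n₃)) = 1)
    (R₂ : (1 + x₂) * p₂ ^ 2 + (1 + x₁) * q₁ ^ 2 + (1 + x₃) * q₃ ^ 2 - 2 * q₁ * q₃ =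
      ρ * ((1 + x₁) * (p₁ * q₁) + (1 + x₂) * (p₂ * q₂) + (1 + x₃) * (p₃ * q₃)) * (1 + n₂) + d₂)
    (R₃ : (1 + x₃) * p₃ ^ 2 + (1 + x₁) * q₁ ^ 2 + (1 + x₂) * q₂ ^ 2 - 2 * q₁ * q₂ =
      ρ * ((1 + x₁) * (p₁ * q₁) + (1 + x₂) * (p₂ * q₂) + (1 + x₃) * (p₃ * q₃)) * (1 + n₃) + d₃)
    (hd₂ : 0 ≤ d₂) (hd₃ : d₃ ≤ 0) (hd : (1 + n₂) * d₃ + (1 + n₃) * d₂ ≤ 0) :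
    ρ * (1 + n₁) * q₁ ≤ p₁ := by
  have h₂ := add_le_mul_of_relation hx₃ hn₁ hn₃ xn₁ xn₃ ρ_sq R₂
  have h₃ := add_le_mul_of_relation hx₂ hn₁ hn₂ xn₁ xn₂
    (by linear_combination ρ_sq : ρ ^ 2 * ((1 + n₁) * (1 + n₃) * (1 + n₂)) = 1) R₃
  set S := (1 + x₂) * (p₂ * q₂) + (1 + x₃) * (p₃ * q₃) with hS
  rw [add_assoc ((1 + x₁) * (p₁ * q₁)), ← hS] at h₂ h₃
  set t := ρ * ((1 + x₁) * (p₁ * q₁) + S - ρ * (1 + n₁) * (1 + x₁) * q₁ ^ 2) with ht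
  have hSpos : 0 < S := by positivity
  have ht_pos : 0 < t := by
    have h : 0 < (1 + n₁) * ((1 + n₃) * t + d₃) := lt_of_lt_of_le (by positivity) h₃
    have := (mul_pos_iff_of_pos_left (by positivity)).1 h
    exact (mul_pos_iff_of_pos_left (by positivity : 0 < 1 + n₃)).1 (by linarith)
  have hprod : (1 + n₁) * S ^ 2 ≤
      ((1 + n₁) * ((1 + n₂) * t + d₂)) * ((1 + n₁) * ((1 + n₃) * t + d₃)) := by
    refine le_trans ?_ (mul_le_mul h₂ h₃ (by positivity) (le_trans (by positivity) h₂))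
    have : 0 ≤ (1 + x₂) * (1 + x₃) * ((1 + n₁) * p₂ * p₃ - q₂ * q₃) ^ 2 := by positivity
    rw [hS]
    linear_combination this
  have hle : S ^ 2 ≤ (1 + n₁) * ((1 + n₂) * (1 + n₃) * t ^ 2) := by
    refine le_of_mul_le_mul_left ?_ (by positivity : 0 < 1 + n₁)
    have h₁ : 0 ≤ t * -((1 + n₂) * d₃ + (1 + n₃) * d₂) := mul_nonneg ht_pos.le (by linarith)
    have h₄ : 0 ≤ d₂ * -d₃ := mul_nonneg hd₂ (by linarith)
    have h₅ : 0 ≤ (1 + n₁) ^ 2 * (t * -((1 + n₂) * d₃ + (1 + n₃) * d₂) + d₂ * -d₃) := by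
      positivity
    linear_combination hprod + h₅
  have hsq : (ρ * S) ^ 2 ≤ t ^ 2 := by
    have : ρ ^ 2 * S ^ 2 ≤ ρ ^ 2 * ((1 + n₁) * ((1 + n₂) * (1 + n₃) * t ^ 2)) := by gcongr
    linear_combination this + t ^ 2 * ρ_sq
  have hfin : ρ * S ≤ t := (pow_le_pow_iff_left₀ (by positivity) ht_pos.le two_ne_zero).1 hsq
  have h : 0 ≤ (ρ * (1 + x₁) * q₁) * (p₁ - ρ * (1 + n₁) * q₁) := by
    rw [ht] at hfin
    linear_combination hfin
  exact sub_nonneg.1 ((mul_nonneg_iff_of_pos_left (by positivity)).1 h)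

variable {p₁ p₂ p₃ q₁ q₂ q₃ x₁ x₂ x₃ n₁ n₂ n₃ ρ m δ : ℝ}

theorem swap (h : PairedSystem p₁ p₂ p₃ q₁ q₂ q₃ x₁ x₂ x₃ n₁ n₂ n₃ ρ m δ) :
    PairedSystem p₁ p₃ p₂ q₁ q₃ q₂ x₁ x₃ x₂ n₁ n₃ n₂ ρ m (-δ) where
  p₁_pos := h.p₁_pos
  p₂_pos := h.p₃_pos
  p₃_pos := h.p₂_pos
  q₁_pos := h.q₁_pos
  q₂_pos := h.q₃_pos
  q₃_pos := h.q₂_pos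
  x₁_pos := h.x₁_pos
  x₂_pos := h.x₃_pos
  x₃_pos := h.x₂_pos
  n₁_pos := h.n₁_pos
  n₂_pos := h.n₃_pos
  n₃_pos := h.n₂_pos
  ρ_pos := h.ρ_pos
  m_pos := h.m_pos
  xn₁ := h.xn₁
  xn₂ := h.xn₃
  xn₃ := h.xn₂
  ρ_sq := by linear_combination h.ρ_sq
  P₁ := by linear_combination h.P₁
  P₂ := by linear_combination h.P₃
  P₃ := by linear_combination h.P₂
  Q₁ := by linear_combination h.Q₁
  Q₂ := by linear_combination h.Q₃
  Q₃ := by linear_combination h.Q₂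
  R₁ := by linear_combination h.R₁
  R₂ := by linear_combination h.R₃
  R₃ := by linear_combination h.R₂

theorem dual_R₁ (h : PairedSystem p₁ p₂ p₃ q₁ q₂ q₃ x₁ x₂ x₃ n₁ n₂ n₃ ρ m δ) :
    (1 + x₁) * q₁ ^ 2 + (1 + x₂) * p₂ ^ 2 + (1 + x₃) * p₃ ^ 2 - 2 * p₂ * p₃ =
      ρ * ((1 + x₁) * (q₁ * p₁) + (1 + x₂) * (q₂ * p₂) + (1 + x₃) * (q₃ * p₃)) * (1 + n₁) := by
  linear_combination h.R₁ + h.P₁ - h.P₂ - h.P₃ - h.Q₁ + h.Q₂ + h.Q₃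

theorem dual_R₂ (h : PairedSystem p₁ p₂ p₃ q₁ q₂ q₃ x₁ x₂ x₃ n₁ n₂ n₃ ρ m δ) :
    (1 + x₂) * q₂ ^ 2 + (1 + x₁) * p₁ ^ 2 + (1 + x₃) * p₃ ^ 2 - 2 * p₁ * p₃ =
      ρ * ((1 + x₁) * (q₁ * p₁) + (1 + x₂) * (q₂ * p₂) + (1 + x₃) * (q₃ * p₃)) * (1 + n₂) +
        2 * δ := by
  linear_combination h.R₂ + h.P₂ - h.P₁ - h.P₃ - h.Q₂ + h.Q₁ + h.Q₃

theorem dual_R₃ (h : PairedSystem p₁ p₂ p₃ q₁ q₂ q₃ x₁ x₂ x₃ n₁ n₂ n₃ ρ m δ) :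
    (1 + x₃) * q₃ ^ 2 + (1 + x₁) * p₁ ^ 2 + (1 + x₂) * p₂ ^ 2 - 2 * p₁ * p₂ =
      ρ * ((1 + x₁) * (q₁ * p₁) + (1 + x₂) * (q₂ * p₂) + (1 + x₃) * (q₃ * p₃)) * (1 + n₃) +
        -(2 * δ) := by
  linear_combination h.R₃ + h.P₃ - h.P₁ - h.P₂ - h.Q₃ + h.Q₁ + h.Q₂

theorem rotate (h : PairedSystem p₁ p₂ p₃ q₁ q₂ q₃ x₁ x₂ x₃ n₁ n₂ n₃ ρ m 0) :
    PairedSystem p₂ p₃ p₁ q₂ q₃ q₁ x₂ x₃ x₁ n₂ n₃ n₁ ρ m 0 where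
  p₁_pos := h.p₂_pos
  p₂_pos := h.p₃_pos
  p₃_pos := h.p₁_pos
  q₁_pos := h.q₂_pos
  q₂_pos := h.q₃_pos
  q₃_pos := h.q₁_pos
  x₁_pos := h.x₂_pos
  x₂_pos := h.x₃_pos
  x₃_pos := h.x₁_pos
  n₁_pos := h.n₂_pos
  n₂_pos := h.n₃_pos
  n₃_pos := h.n₁_pos
  ρ_pos := h.ρ_pos
  m_pos := h.m_pos
  xn₁ := h.xn₂
  xn₂ := h.xn₃
  xn₃ := h.xn₁
  ρ_sq := by linear_combination h.ρ_sq
  P₁ := by linear_combination h.P₂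
  P₂ := by linear_combination h.P₃
  P₃ := by linear_combination h.P₁
  Q₁ := by linear_combination h.Q₂
  Q₂ := by linear_combination h.Q₃
  Q₃ := by linear_combination h.Q₁
  R₁ := by linear_combination h.R₂
  R₂ := by linear_combination h.R₃
  R₃ := by linear_combination h.R₁

theorem dual (h : PairedSystem p₁ p₂ p₃ q₁ q₂ q₃ x₁ x₂ x₃ n₁ n₂ n₃ ρ m 0) :
    PairedSystem q₁ q₂ q₃ p₁ p₂ p₃ x₁ x₂ x₃ n₁ n₂ n₃ ρ m 0 where
  p₁_pos := h.q₁_pos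
  p₂_pos := h.q₂_pos
  p₃_pos := h.q₃_pos
  q₁_pos := h.p₁_pos
  q₂_pos := h.p₂_pos
  q₃_pos := h.p₃_pos
  x₁_pos := h.x₁_pos
  x₂_pos := h.x₂_pos
  x₃_pos := h.x₃_pos
  n₁_pos := h.n₁_pos
  n₂_pos := h.n₂_pos
  n₃_pos := h.n₃_pos
  ρ_pos := h.ρ_pos
  m_pos := h.m_pos
  xn₁ := h.xn₁
  xn₂ := h.xn₂
  xn₃ := h.xn₃
  ρ_sq := h.ρ_sq
  P₁ := by linear_combination h.Q₁
  P₂ := by linear_combination h.Q₂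
  P₃ := by linear_combination h.Q₃
  Q₁ := by linear_combination h.P₁
  Q₂ := by linear_combination h.P₂
  Q₃ := by linear_combination h.P₃
  R₁ := by linear_combination h.dual_R₁
  R₂ := by linear_combination h.dual_R₂
  R₃ := by linear_combination h.dual_R₃

theorem bound₁ (h : PairedSystem p₁ p₂ p₃ q₁ q₂ q₃ x₁ x₂ x₃ n₁ n₂ n₃ ρ m δ) :
    ρ * (1 + n₁) * q₁ ≤ p₁ :=
  mul_le_of_relations h.p₂_pos h.p₃_pos h.q₁_pos h.q₂_pos h.q₃_pos h.x₁_pos h.x₂_pos h.x₃_pos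
    h.n₁_pos h.n₂_pos h.n₃_pos h.ρ_pos h.xn₁ h.xn₂ h.xn₃ h.ρ_sq
    (d₂ := 0) (d₃ := 0) (by linear_combination h.R₂) (by linear_combination h.R₃)
    le_rfl le_rfl (by simp)

theorem bound₂ (h : PairedSystem p₁ p₂ p₃ q₁ q₂ q₃ x₁ x₂ x₃ n₁ n₂ n₃ ρ m δ) :
    ρ * (1 + n₂) * q₂ ≤ p₂ :=
  mul_le_of_relations h.p₁_pos h.p₃_pos h.q₂_pos h.q₁_pos h.q₃_pos h.x₂_pos h.x₁_pos h.x₃_pos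
    h.n₂_pos h.n₁_pos h.n₃_pos h.ρ_pos h.xn₂ h.xn₁ h.xn₃ (by linear_combination h.ρ_sq)
    (d₂ := 0) (d₃ := 0) (by linear_combination h.R₁) (by linear_combination h.R₃)
    le_rfl le_rfl (by simp)

theorem bound₃ (h : PairedSystem p₁ p₂ p₃ q₁ q₂ q₃ x₁ x₂ x₃ n₁ n₂ n₃ ρ m δ) :
    ρ * (1 + n₃) * q₃ ≤ p₃ := h.swap.bound₂

theorem dual_bound₂ (h : PairedSystem p₁ p₂ p₃ q₁ q₂ q₃ x₁ x₂ x₃ n₁ n₂ n₃ ρ m δ)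
    (hδ : 0 ≤ δ) : ρ * (1 + n₂) * p₂ ≤ q₂ :=
  mul_le_of_relations h.q₁_pos h.q₃_pos h.p₂_pos h.p₁_pos h.p₃_pos h.x₂_pos h.x₁_pos h.x₃_pos
    h.n₂_pos h.n₁_pos h.n₃_pos h.ρ_pos h.xn₂ h.xn₁ h.xn₃ (by linear_combination h.ρ_sq)
    (d₂ := 0) (d₃ := -(2 * δ)) (by linear_combination h.dual_R₁)
    (by linear_combination h.dual_R₃) le_rfl (by linarith)
    (by have := mul_nonneg (add_nonneg zero_le_one h.n₁_pos.le) hδ; linarith)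

theorem dual_bound₁ (h : PairedSystem p₁ p₂ p₃ q₁ q₂ q₃ x₁ x₂ x₃ n₁ n₂ n₃ ρ m δ)
    (hδ : 0 ≤ δ) (hn : n₃ ≤ n₂) : ρ * (1 + n₁) * p₁ ≤ q₁ :=
  mul_le_of_relations h.q₂_pos h.q₃_pos h.p₁_pos h.p₂_pos h.p₃_pos h.x₁_pos h.x₂_pos h.x₃_pos
    h.n₁_pos h.n₂_pos h.n₃_pos h.ρ_pos h.xn₁ h.xn₂ h.xn₃ h.ρ_sq
    h.dual_R₂ h.dual_R₃ (by linarith) (by linarith)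
    (by have := mul_nonneg (sub_nonneg.2 hn) hδ; linarith)

theorem quad₁ (h : PairedSystem p₁ p₂ p₃ q₁ q₂ q₃ x₁ x₂ x₃ n₁ n₂ n₃ ρ m δ) :
    (1 + x₁) * (p₁ ^ 2 + q₁ ^ 2 - 2 * ρ * (p₁ * q₁)) =
      ρ * ((1 + x₁) * (p₁ * q₁) + (1 + x₂) * (p₂ * q₂) + (1 + x₃) * (p₃ * q₃)) * n₁ + m := by
  linear_combination h.R₁ - h.Q₁ + h.Q₂ + h.Q₃

theorem quad₂ (h : PairedSystem p₁ p₂ p₃ q₁ q₂ q₃ x₁ x₂ x₃ n₁ n₂ n₃ ρ m δ) :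
    (1 + x₂) * (p₂ ^ 2 + q₂ ^ 2 - 2 * ρ * (p₂ * q₂)) =
      ρ * ((1 + x₁) * (p₁ * q₁) + (1 + x₂) * (p₂ * q₂) + (1 + x₃) * (p₃ * q₃)) * n₂ + m := by
  linear_combination h.R₂ - h.Q₂ + h.Q₁ + h.Q₃

theorem quad₃ (h : PairedSystem p₁ p₂ p₃ q₁ q₂ q₃ x₁ x₂ x₃ n₁ n₂ n₃ ρ m δ) :
    (1 + x₃) * (p₃ ^ 2 + q₃ ^ 2 - 2 * ρ * (p₃ * q₃)) =
      ρ * ((1 + x₁) * (p₁ * q₁) + (1 + x₂) * (p₂ * q₂) + (1 + x₃) * (p₃ * q₃)) * n₃ + m := by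
  linear_combination h.R₃ - h.Q₃ + h.Q₁ + h.Q₂

/-- The bound on `m` obtained from one `q`-equation and the corresponding Cauchy–Schwarz bound. -/
theorem le_of_equation {a b c x n r M : ℝ} (ha : 0 < a) (hx : 0 < x) (xn : x * n = 1)
    (hQ : a * (b + c) - (1 + x) * a ^ 2 + ρ * ((1 + x) * (r * a)) = M)
    (hb : ρ * (1 + n) * r ≤ a) : M ≤ a * (b + c - a) := by
  have h : 0 ≤ x * a * (a - ρ * (1 + n) * r) :=
    mul_nonneg (by positivity) (sub_nonneg.2 hb)
  linear_combination h - hQ - a * ρ * r * xn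

/-- The averaging estimate obtained by combining the six Cauchy–Schwarz bounds. -/
theorem m_mul_le (h : PairedSystem p₁ p₂ p₃ q₁ q₂ q₃ x₁ x₂ x₃ n₁ n₂ n₃ ρ m δ)
    (h₁ : ρ * (1 + n₁) * p₁ ≤ q₁) (h₂ : ρ * (1 + n₂) * p₂ ≤ q₂) (h₃ : ρ * (1 + n₃) * p₃ ≤ q₃) :
    m * (n₁ + n₂ + n₃) ≤
      ρ * ((1 + x₁) * (p₁ * q₁) + (1 + x₂) * (p₂ * q₂) + (1 + x₃) * (p₃ * q₃)) *
        (n₁ * n₂ * n₃) := by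
  have e₁ := h.quad₁
  have e₂ := h.quad₂
  have e₃ := h.quad₃
  have b₁ := h.bound₁
  have b₂ := h.bound₂
  have b₃ := h.bound₃
  obtain ⟨hp₁, hp₂, hp₃, hq₁, hq₂, hq₃, hx₁, hx₂, hx₃, hn₁, hn₂, hn₃, hρ, hm, -, -, -, hρ2,
    -, -, -, -, -, -, -, -, -⟩ := h
  have key : ∀ {p q x n n' n'' g : ℝ}, 0 < x → 0 < n' → 0 < n'' →
      ρ ^ 2 * ((1 + n) * (1 + n') * (1 + n'')) = 1 → ρ * (1 + n) * q ≤ p → ρ * (1 + n) * p ≤ q →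
      (1 + x) * (p ^ 2 + q ^ 2 - 2 * ρ * (p * q)) = g →
      g ≤ ρ * ((1 + x) * (p * q)) * (n + n' + n'' + n' * n'') := by
    intro p q x n n' n'' g hx hn' hn'' hr ha hb hg
    have h₀ := mul_nonneg (sub_nonneg.2 ha) (sub_nonneg.2 hb)
    have h₁ : 0 ≤ (1 + x) * (ρ * (1 + n') * (1 + n'')) *
        ((p - ρ * (1 + n) * q) * (q - ρ * (1 + n) * p)) := mul_nonneg (by positivity) h₀
    rw [← hg]
    linear_combination h₁ + (1 + x) * (ρ * p * q * (1 + n) - (p ^ 2 + q ^ 2)) * hr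
  have k₁ := key hx₁ hn₂ hn₃ hρ2 b₁ h₁ e₁
  have k₂ := key hx₂ hn₁ hn₃ (by linear_combination hρ2) b₂ h₂ e₂
  have k₃ := key hx₃ hn₁ hn₂ (by linear_combination hρ2) b₃ h₃ e₃
  set w₁ := ρ * ((1 + x₁) * (p₁ * q₁)) with hw₁
  set w₂ := ρ * ((1 + x₂) * (p₂ * q₂)) with hw₂
  set w₃ := ρ * ((1 + x₃) * (p₃ * q₃)) with hw₃
  have hL : ρ * ((1 + x₁) * (p₁ * q₁) + (1 + x₂) * (p₂ * q₂) + (1 + x₃) * (p₃ * q₃)) =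
    w₁ + w₂ + w₃ := by rw [hw₁, hw₂, hw₃]; ring
  rw [hL] at k₁ k₂ k₃ ⊢
  by_contra! hlt
  set σ := n₁ + n₂ + n₃ with hσ
  have hσ0 : 0 < σ := by positivity
  set L := w₁ + w₂ + w₃ with hLdef
  have d₁ : L * n₁ < w₁ * σ := by
    refine lt_of_mul_lt_mul_right (a := σ + n₂ * n₃) ?_ (by positivity)
    have := mul_le_mul_of_nonneg_right k₁ hσ0.le
    linear_combination this + hlt
  have d₂ : L * n₂ < w₂ * σ := by
    refine lt_of_mul_lt_mul_right (a := σ + n₁ * n₃) ?_ (by positivity)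
    have := mul_le_mul_of_nonneg_right k₂ hσ0.le
    linear_combination this + hlt
  have d₃ : L * n₃ < w₃ * σ := by
    refine lt_of_mul_lt_mul_right (a := σ + n₁ * n₂) ?_ (by positivity)
    have := mul_le_mul_of_nonneg_right k₃ hσ0.le
    linear_combination this + hlt
  have : L * σ < L * σ := by
    calc L * σ = L * n₁ + L * n₂ + L * n₃ := by rw [hσ]; ring
      _ < w₁ * σ + w₂ * σ + w₃ * σ := by linarith
      _ = L * σ := by rw [hLdef]; ring
  exact lt_irrefl _ this

theorem le_mul_of_le_mul_sub {a b c M : ℝ} (hb₀ : 0 < b) (hc₀ : 0 < c)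
    (ha : M ≤ a * (b + c - a)) (hb : M ≤ b * (a + c - b)) (hc : M ≤ c * (a + b - c)) :
    M ≤ b * c := by
  rcases le_total a b with h | h
  · nlinarith
  rcases le_total a c with h' | h'
  · nlinarith
  nlinarith [mul_nonneg (sub_nonneg.2 h) (sub_nonneg.2 h')]

theorem lt_of_m_mul_le {L M a b c : ℝ} (hM : 0 < M) (ha : 0 < a) (hb : 0 < b) (hc : 0 < c)
    (h : M * (a + b + c) ≤ L * (a * b * c)) : M < L * (b * c) := by
  have : a * M < a * (L * (b * c)) := by nlinarith [mul_pos hM hb, mul_pos hM hc]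
  exact lt_of_mul_lt_mul_left this ha.le

theorem bracket_pos {L M : ℝ} (hp₁ : 0 < p₁) (hp₂ : 0 < p₂) (hp₃ : 0 < p₃)
    (hn₂ : 0 < n₂) (hn₃ : 0 < n₃) (xn₂ : x₂ * n₂ = 1) (xn₃ : x₃ * n₃ = 1)
    (hL : 0 < L) (hle : M ≤ p₂ * p₃) (hlt : M < L * (n₂ * n₃))
    (h₂ : p₂ * (p₁ + p₃) - (1 + x₂) * p₂ ^ 2 + ρ * ((1 + x₂) * (p₂ * q₂)) = M)
    (h₃ : p₃ * (p₁ + p₂) - (1 + x₃) * p₃ ^ 2 + ρ * ((1 + x₃) * (p₃ * q₃)) = M) :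
    0 < L * ((1 + n₂) * (1 + n₃)) * (p₂ - ρ * q₂ + (p₃ - ρ * q₃)) -
      (((1 + n₂) * (1 + n₃) - 1) * L + M) * p₁ := by
  have e₂ : (1 + n₂) * (p₂ - ρ * q₂) = n₂ * (p₁ + p₃ - M / p₂) := by
    field_simp
    linear_combination (-n₂) * h₂ - p₂ * (p₂ - ρ * q₂) * xn₂
  have e₃ : (1 + n₃) * (p₃ - ρ * q₃) = n₃ * (p₁ + p₂ - M / p₃) := by
    field_simp
    linear_combination (-n₃) * h₃ - p₃ * (p₃ - ρ * q₃) * xn₃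
  have f₂ : 0 ≤ p₃ - M / p₂ := by
    rw [sub_nonneg, div_le_iff₀ hp₂]; linarith
  have f₃ : 0 ≤ p₂ - M / p₃ := by
    rw [sub_nonneg, div_le_iff₀ hp₃]; linarith
  have hpos : 0 < L * ((1 + n₃) * n₂ * (p₃ - M / p₂) + (1 + n₂) * n₃ * (p₂ - M / p₃)) +
      (L * (n₂ * n₃) - M) * p₁ := by
    have := mul_pos (sub_pos.2 hlt) hp₁
    positivity
  convert hpos using 1
  linear_combination L * (1 + n₃) * e₂ + L * (1 + n₂) * e₃

theorem lambda_pos (h : PairedSystem p₁ p₂ p₃ q₁ q₂ q₃ x₁ x₂ x₃ n₁ n₂ n₃ ρ m δ) :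
    0 < ρ * ((1 + x₁) * (p₁ * q₁) + (1 + x₂) * (p₂ * q₂) + (1 + x₃) * (p₃ * q₃)) := by
  obtain ⟨hp₁, hp₂, hp₃, hq₁, hq₂, hq₃, hx₁, hx₂, hx₃, hn₁, hn₂, hn₃, hρ, -⟩ := h
  positivity

theorem quad_sub (h : PairedSystem p₁ p₂ p₃ q₁ q₂ q₃ x₁ x₂ x₃ n₁ n₂ n₃ ρ m δ) {L : ℝ}
    (hL : L = ρ * ((1 + x₁) * (p₁ * q₁) + (1 + x₂) * (p₂ * q₂) + (1 + x₃) * (p₃ * q₃))) :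
    (1 + n₂) * (1 + n₃) * ((p₂ - p₃) * (p₂ - ρ * q₂ + (p₃ - ρ * q₃)) +
      (q₂ - q₃) * (q₂ - ρ * p₂ + (q₃ - ρ * p₃))) =
      (((1 + n₂) * (1 + n₃) - 1) * L + m) * (n₂ - n₃) := by
  have e₂ := h.quad₂
  have e₃ := h.quad₃
  rw [← hL] at e₂ e₃
  linear_combination (1 + n₃) * n₂ * e₂ - (1 + n₂) * n₃ * e₃ -
    (1 + n₃) * (p₂ ^ 2 + q₂ ^ 2 - 2 * ρ * (p₂ * q₂)) * h.xn₂ +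
    (1 + n₂) * (p₃ ^ 2 + q₃ ^ 2 - 2 * ρ * (p₃ * q₃)) * h.xn₃

theorem sum_sub (h : PairedSystem p₁ p₂ p₃ q₁ q₂ q₃ x₁ x₂ x₃ n₁ n₂ n₃ ρ m δ) {L : ℝ}
    (hL : L = ρ * ((1 + x₁) * (p₁ * q₁) + (1 + x₂) * (p₂ * q₂) + (1 + x₃) * (p₃ * q₃))) :
    p₁ * (p₂ - p₃) + q₁ * (q₂ - q₃) = 2 * δ + L * (n₂ - n₃) := by
  rw [hL]
  linear_combination h.R₂ - h.R₃ + h.P₂ - h.P₃ - h.Q₂ + h.Q₃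

theorem eq_of_le_of_le (h : PairedSystem p₁ p₂ p₃ q₁ q₂ q₃ x₁ x₂ x₃ n₁ n₂ n₃ ρ m 0)
    (hn : n₃ ≤ n₂) (hp : p₃ ≤ p₂) : p₂ = p₃ ∧ q₂ = q₃ ∧ n₂ = n₃ := by
  obtain ⟨L, hL⟩ : ∃ L, L = ρ * ((1 + x₁) * (p₁ * q₁) + (1 + x₂) * (p₂ * q₂) +
    (1 + x₃) * (p₃ * q₃)) := ⟨_, rfl⟩
  have hLpos : 0 < L := hL ▸ h.lambda_pos
  have hq := h.quad_sub hL
  have hs := h.sum_sub hL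
  have hkm := h.m_mul_le h.dual.bound₁ h.dual.bound₂ h.dual.bound₃
  rw [← hL] at hkm
  have hk := lt_of_m_mul_le h.m_pos h.n₁_pos h.n₂_pos h.n₃_pos hkm
  have hp₂₃ : m ≤ p₂ * p₃ := by
    have P₁ := h.P₁
    have P₂ := h.P₂
    have P₃ := h.P₃
    exact le_mul_of_le_mul_sub h.p₂_pos h.p₃_pos
      (le_of_equation h.p₁_pos h.x₁_pos h.xn₁ (by linarith) h.bound₁)
      (le_of_equation h.p₂_pos h.x₂_pos h.xn₂ (by linarith) h.bound₂)
      (le_of_equation h.p₃_pos h.x₃_pos h.xn₃ (by linarith) h.bound₃)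
  have hq₂₃ : m ≤ q₂ * q₃ :=
    le_mul_of_le_mul_sub h.q₂_pos h.q₃_pos
      (le_of_equation h.q₁_pos h.x₁_pos h.xn₁ h.Q₁ h.dual.bound₁)
      (le_of_equation h.q₂_pos h.x₂_pos h.xn₂ h.Q₂ h.dual.bound₂)
      (le_of_equation h.q₃_pos h.x₃_pos h.xn₃ h.Q₃ h.dual.bound₃)
  have Bp := bracket_pos h.p₁_pos h.p₂_pos h.p₃_pos h.n₂_pos h.n₃_pos h.xn₂ h.xn₃ hLpos hp₂₃ hk
    (by simpa using h.P₂) (by simpa using h.P₃)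
  have Bq := bracket_pos (q₂ := p₂) (q₃ := p₃) (ρ := ρ) h.q₁_pos h.q₂_pos h.q₃_pos h.n₂_pos
    h.n₃_pos h.xn₂ h.xn₃ hLpos hq₂₃ hk (by linear_combination h.Q₂) (by linear_combination h.Q₃)
  have hzero : (p₂ - p₃) * (L * ((1 + n₂) * (1 + n₃)) * (p₂ - ρ * q₂ + (p₃ - ρ * q₃)) -
      (((1 + n₂) * (1 + n₃) - 1) * L + m) * p₁) +
      (q₂ - q₃) * (L * ((1 + n₂) * (1 + n₃)) * (q₂ - ρ * p₂ + (q₃ - ρ * p₃)) -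
      (((1 + n₂) * (1 + n₃) - 1) * L + m) * q₁) = 0 := by
    linear_combination L * hq - (((1 + n₂) * (1 + n₃) - 1) * L + m) * hs
  have hq₃ := h.q₃_pos
  have hq₂ := h.q₂_pos
  have hx₃ := h.x₃_pos
  have hx : x₂ ≤ x₃ := by
    have e : x₃ - x₂ = (n₂ - n₃) * (x₂ * x₃) := by
      linear_combination -x₃ * h.xn₂ + x₂ * h.xn₃
    have := mul_nonneg (sub_nonneg.2 hn) (mul_pos h.x₂_pos h.x₃_pos).le
    linarith
  have hb₂ : 0 ≤ q₂ - ρ * p₂ := by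
    have := h.dual.bound₂
    have := mul_pos (mul_pos h.ρ_pos h.n₂_pos) h.p₂_pos
    linarith
  have hbr : 0 < (1 + x₃) * (q₂ + (q₃ - ρ * p₃)) - q₁ := by
    refine pos_of_mul_pos_right (a := q₃) ?_ hq₃.le
    have : 0 < (1 + x₃) * (q₂ * q₃) + (q₂ * q₃ - m) :=
      add_pos_of_pos_of_nonneg (by positivity) (by linarith)
    linear_combination this + h.Q₃
  have hdiff : (q₂ - q₃) * ((1 + x₃) * (q₂ + (q₃ - ρ * p₃)) - q₁) =
      (x₃ - x₂) * (q₂ * (q₂ - ρ * p₂)) + ρ * (1 + x₃) * q₂ * (p₂ - p₃) := by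
    linear_combination h.Q₃ - h.Q₂
  have hrhs : 0 ≤ (x₃ - x₂) * (q₂ * (q₂ - ρ * p₂)) + ρ * (1 + x₃) * q₂ * (p₂ - p₃) := by
    have := h.ρ_pos
    have := sub_nonneg.2 hx
    have := sub_nonneg.2 hp
    positivity
  have hqge : 0 ≤ q₂ - q₃ := by
    by_contra! hneg
    have := mul_neg_of_neg_of_pos hneg hbr
    linarith
  have t₁ := mul_nonneg (sub_nonneg.2 hp) Bp.le
  have t₂ := mul_nonneg hqge Bq.le
  have z₁ : p₂ - p₃ = 0 := by
    have : (p₂ - p₃) * _ = 0 := le_antisymm (by linarith) t₁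
    exact (mul_eq_zero.1 this).resolve_right Bp.ne'
  have z₂ : q₂ - q₃ = 0 := by
    have : (q₂ - q₃) * _ = 0 := le_antisymm (by linarith) t₂
    exact (mul_eq_zero.1 this).resolve_right Bq.ne'
  refine ⟨sub_eq_zero.1 z₁, sub_eq_zero.1 z₂, ?_⟩
  rw [z₁, z₂] at hs
  have : L * (n₂ - n₃) = 0 := by linarith
  exact sub_eq_zero.1 ((mul_eq_zero.1 this).resolve_left hLpos.ne')

theorem eq_of_le (h : PairedSystem p₁ p₂ p₃ q₁ q₂ q₃ x₁ x₂ x₃ n₁ n₂ n₃ ρ m 0)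
    (hn : n₃ ≤ n₂) : p₂ = p₃ ∧ q₂ = q₃ ∧ n₂ = n₃ := by
  rcases le_total p₃ p₂ with hp | hp
  · exact h.eq_of_le_of_le hn hp
  rcases le_total q₃ q₂ with hq | hq
  · obtain ⟨a, b, c⟩ := h.dual.eq_of_le_of_le hn hq
    exact ⟨b, a, c⟩
  obtain ⟨L, hL⟩ : ∃ L, L = ρ * ((1 + x₁) * (p₁ * q₁) + (1 + x₂) * (p₂ * q₂) +
    (1 + x₃) * (p₃ * q₃)) := ⟨_, rfl⟩
  have hLpos : 0 < L := hL ▸ h.lambda_pos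
  have hs := h.sum_sub hL
  have t₁ := mul_nonneg h.p₁_pos.le (sub_nonneg.2 hp)
  have t₂ := mul_nonneg h.q₁_pos.le (sub_nonneg.2 hq)
  have hn' : n₂ = n₃ := by
    have : L * (n₂ - n₃) ≤ 0 := by linarith
    exact le_antisymm (by nlinarith) hn
  have hp' : p₂ = p₃ := by
    subst hn'
    have : p₁ * (p₃ - p₂) ≤ 0 := by linarith
    exact le_antisymm hp (by nlinarith [h.p₁_pos])
  exact h.eq_of_le_of_le hn hp'.ge

theorem eq₂₃ (h : PairedSystem p₁ p₂ p₃ q₁ q₂ q₃ x₁ x₂ x₃ n₁ n₂ n₃ ρ m 0) :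
    p₂ = p₃ ∧ q₂ = q₃ ∧ n₂ = n₃ := by
  rcases le_total n₃ n₂ with hn | hn
  · exact h.eq_of_le hn
  · have h' := h.swap
    rw [neg_zero] at h'
    obtain ⟨a, b, c⟩ := h'.eq_of_le hn
    exact ⟨a.symm, b.symm, c.symm⟩

variable {e : ℝ}

theorem defect_nonpos_of_add_pos
    (h : PairedSystem p₁ e e q₁ q₂ q₃ x₁ x₂ x₃ n₁ n₂ n₃ ρ m δ)
    (hg : 0 < q₂ - ρ * e + (q₃ - ρ * e)) : δ ≤ 0 := by
  by_contra! hδ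
  obtain ⟨L, hL⟩ : ∃ L, L = ρ * ((1 + x₁) * (p₁ * q₁) + (1 + x₂) * (e * q₂) +
    (1 + x₃) * (e * q₃)) := ⟨_, rfl⟩
  have hLpos : 0 < L := hL ▸ h.lambda_pos
  have hq := h.quad_sub hL
  have hs := h.sum_sub hL
  have hn₂ := h.n₂_pos
  have hn₃ := h.n₃_pos
  have hρ := h.ρ_pos
  have he := h.p₂_pos
  have hm := h.m_pos
  have hqpos := h.q₂_pos
  have hq₃pos := h.q₃_pos
  have hx₃ := h.x₃_pos
  have hcoef : 0 < ((1 + n₂) * (1 + n₃) - 1) * L + m := by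
    have : 0 < (n₂ + n₃ + n₂ * n₃) * L + m := by positivity
    linarith
  have ha : 0 < e - ρ * q₂ := by
    have := h.bound₂
    have := mul_pos (mul_pos hρ hn₂) hqpos
    linarith
  have hP : n₂ * n₃ * (2 * δ) =
      e * ((n₂ - n₃) * (e - ρ * q₂) + ρ * ((1 + n₃) * n₂) * (q₂ - q₃)) := by
    linear_combination n₂ * n₃ * (h.P₃ - h.P₂) + e * n₃ * (ρ * q₂ - e) * h.xn₂ +
      e * n₂ * (e - ρ * q₃) * h.xn₃
  have hq' : (1 + n₂) * (1 + n₃) * (q₂ - ρ * e + (q₃ - ρ * e)) * (q₂ - q₃) =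
      (((1 + n₂) * (1 + n₃) - 1) * L + m) * (n₂ - n₃) := by linear_combination hq
  have hV : 0 < n₂ - n₃ := by
    by_contra! hneg
    have hΔ : q₂ - q₃ ≤ 0 := by
      by_contra! hpos
      have h₁ : 0 < (1 + n₂) * (1 + n₃) * (q₂ - ρ * e + (q₃ - ρ * e)) * (q₂ - q₃) := by
        positivity
      have h₂ := mul_nonpos_of_nonneg_of_nonpos hcoef.le hneg
      linarith
    have h₁ := mul_nonpos_of_nonpos_of_nonneg hneg ha.le
    have h₂ : ρ * ((1 + n₃) * n₂) * (q₂ - q₃) ≤ 0 :=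
      mul_nonpos_of_nonneg_of_nonpos (by positivity) hΔ
    have h₃ := mul_nonpos_of_nonneg_of_nonpos he.le (add_nonpos h₁ h₂)
    have h₄ : 0 < n₂ * n₃ * (2 * δ) := by positivity
    linarith
  have hΔ : 0 < q₂ - q₃ := by
    have h₁ : 0 < (1 + n₂) * (1 + n₃) * (q₂ - ρ * e + (q₃ - ρ * e)) := by positivity
    exact (mul_pos_iff_of_pos_left h₁).1 (hq' ▸ mul_pos hcoef hV)
  have d₁ := h.dual_bound₁ hδ.le (sub_nonneg.1 hV.le)
  have d₂ := h.dual_bound₂ hδ.le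
  have m₁ := le_of_equation h.q₁_pos h.x₁_pos h.xn₁ h.Q₁ d₁
  have m₂ := le_of_equation h.q₂_pos h.x₂_pos h.xn₂ h.Q₂ d₂
  have m₂₃ : m ≤ q₂ * q₃ := by
    rcases le_total q₁ q₂ with hc | hc <;> nlinarith
  have m₁₃ : m ≤ q₁ * q₃ := by
    rcases le_total q₁ q₂ with hc | hc <;> nlinarith [h.q₁_pos]
  have d₃ : ρ * (1 + n₃) * e ≤ q₃ := by
    have h₁ : 0 ≤ q₃ * ((q₂ - ρ * (1 + n₂) * e) + ρ * e * (n₂ - n₃)) + (q₁ * q₃ - m) := by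
      have := sub_nonneg.2 d₂
      have := sub_nonneg.2 m₁₃
      positivity
    have h₂ : 0 ≤ (q₃ * (1 + x₃)) * (q₃ - ρ * (1 + n₃) * e) := by
      linear_combination h₁ + h.Q₃ + q₃ * ρ * e * h.xn₃
    exact sub_nonneg.1 ((mul_nonneg_iff_of_pos_left (by positivity)).1 h₂)
  have hkm := h.m_mul_le d₁ d₂ d₃
  rw [← hL] at hkm
  have hk := lt_of_m_mul_le h.m_pos h.n₁_pos h.n₂_pos h.n₃_pos hkm
  have Bq := bracket_pos (q₂ := e) (q₃ := e) (ρ := ρ) h.q₁_pos h.q₂_pos h.q₃_pos h.n₂_pos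
    h.n₃_pos h.xn₂ h.xn₃ hLpos m₂₃ hk (by linear_combination h.Q₂) (by linear_combination h.Q₃)
  have h₁ := mul_pos hΔ Bq
  have h₂ := mul_pos hcoef hδ
  have : (0 : ℝ) < 0 := by
    linear_combination h₁ + 2 * h₂ + L * hq' - (((1 + n₂) * (1 + n₃) - 1) * L + m) * hs
  exact lt_irrefl _ this

theorem defect_nonpos_of_add_nonpos
    (h : PairedSystem p₁ e e q₁ q₂ q₃ x₁ x₂ x₃ n₁ n₂ n₃ ρ m δ)
    (hg : q₂ - ρ * e + (q₃ - ρ * e) ≤ 0) : δ ≤ 0 := by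
  by_contra! hδ
  obtain ⟨L, hL⟩ : ∃ L, L = ρ * ((1 + x₁) * (p₁ * q₁) + (1 + x₂) * (e * q₂) +
    (1 + x₃) * (e * q₃)) := ⟨_, rfl⟩
  have hq := h.quad_sub hL
  have hs := h.sum_sub hL
  have d₂ := h.dual_bound₂ hδ.le
  have dR₁ := h.dual_R₁
  have cs := add_le_mul_of_relation (K := (1 + x₁) * (q₁ * p₁) + (1 + x₂) * (q₂ * e) +
    (1 + x₃) * (q₃ * e)) h.x₂_pos h.n₁_pos h.n₂_pos h.xn₁ h.xn₂
    (by linear_combination h.ρ_sq : ρ ^ 2 * ((1 + n₁) * (1 + n₃) * (1 + n₂)) = 1) h.dual_R₃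
  have hLpos : 0 < L := hL ▸ h.lambda_pos
  obtain ⟨hp₁, he, -, hq₁, hq₂, hq₃, hx₁, hx₂, hx₃, hn₁, hn₂, hn₃, hρ, hm, xn₁, xn₂, xn₃, hρ2,
    P₁, P₂, P₃, Q₁, Q₂, Q₃, R₁, R₂, R₃⟩ := h
  obtain ⟨r, hr⟩ : ∃ r, r = ρ * e := ⟨_, rfl⟩
  obtain ⟨a, ha⟩ : ∃ a, a = q₂ - ρ * e := ⟨_, rfl⟩
  obtain ⟨b, hb⟩ : ∃ b, b = ρ * e - q₃ := ⟨_, rfl⟩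
  have hr₀ : 0 < r := hr ▸ mul_pos hρ he
  have ha₀ : n₂ * r ≤ a := by rw [ha, hr]; linarith
  have hab : a ≤ b := by linarith
  have hbr : b < r := by linarith
  have hapos : 0 < a := lt_of_lt_of_le (by positivity) ha₀
  have hbpos : 0 < b := by linarith
  have eq₂ : q₂ = r + a := by linarith
  have eq₃ : q₃ = r - b := by linarith
  have hcoef : 0 < ((1 + n₂) * (1 + n₃) - 1) * L + m := by
    have : 0 < (n₂ + n₃ + n₂ * n₃) * L + m := by positivity
    linarith
  have hV : 0 ≤ n₃ - n₂ := by
    by_contra! hneg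
    have h₁ := mul_pos_of_neg_of_neg (neg_neg_of_pos hcoef) hneg
    have h₂ : 0 ≤ (1 + n₂) * (1 + n₃) * ((a + b) * (b - a)) := by
      have := sub_nonneg.2 hab
      positivity
    have : (0 : ℝ) < 0 := by
      subst ha hb
      linear_combination h₁ + h₂ - hq
    exact lt_irrefl _ this
  have hsum : (a + b) * q₁ = (1 + x₂) * a * (r + a) + (1 + x₃) * b * (r - b) := by
    subst ha hb hr
    linear_combination Q₂ - Q₃
  have hLle : (1 + x₂) * (1 + n₃) * r ^ 2 ≤ L := by
    have h₁ : (1 + n₁) * L =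
        (1 + n₁) * (x₁ * q₁ ^ 2 + (x₂ + x₃) * ((1 + n₂) * (1 + n₃)) * r ^ 2) := by
      rw [hL, hr]
      linear_combination -dR₁ - q₁ ^ 2 * xn₁ - (x₂ + x₃) * e ^ 2 * hρ2
    have h₂ := mul_left_cancel₀ (by positivity : (1 + n₁) ≠ 0) h₁
    rw [h₂]
    have h₃ : 0 ≤ x₁ * q₁ ^ 2 + x₃ * ((1 + n₂) * (1 + n₃)) * r ^ 2 := by positivity
    linear_combination h₃ - (1 + n₃) * r ^ 2 * xn₂
  have hδL : 2 * δ = q₁ * (a + b) + L * (n₃ - n₂) := by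
    subst ha hb
    linear_combination -hs
  have hLV := mul_le_mul_of_nonneg_right hLle hV
  obtain ⟨t, ht⟩ : ∃ t, t = ρ * ((1 + x₁) * (q₁ * p₁) + (1 + x₂) * (q₂ * e) +
    (1 + x₃) * (q₃ * e) - ρ * (1 + n₁) * (1 + x₁) * p₁ ^ 2) := ⟨_, rfl⟩
  rw [← ht] at cs
  have hcs : (1 + x₃) * q₃ ^ 2 + (1 + x₂) * ((1 + n₂) * (1 + n₃)) * r ^ 2 + 2 * δ ≤
      (1 + n₃) * t := by
    refine le_of_mul_le_mul_left ?_ (by positivity : 0 < 1 + n₁)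
    rw [hr]
    linear_combination cs + (1 + x₂) * e ^ 2 * hρ2
  have hfin : r * ((1 + x₂) * q₂ + (1 + x₃) * q₃) ≤ t := by
    refine le_of_mul_le_mul_left ?_ (by positivity : 0 < 1 + n₃)
    have h₁ : 0 ≤ (1 + x₂) * (a * (a - n₂ * r)) := by
      have := sub_nonneg.2 ha₀
      positivity
    have h₂ : 0 ≤ (1 + x₂) * (r * (n₃ - n₂) * ((r - a) + n₃ * r)) := by
      have : 0 ≤ r - a := by linarith
      positivity
    have h₃ : 0 ≤ (1 + n₃) * r * (b + n₂ * r) := by positivity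
    rw [eq₃] at hcs
    rw [eq₂, eq₃]
    linear_combination hcs + h₁ + h₂ + h₃ + hLV - hδL - hsum -
      (1 + n₃) * r ^ 2 * xn₂ + r * (r - b) * xn₃
  have d₁ : ρ * (1 + n₁) * p₁ ≤ q₁ := by
    have h₁ : 0 ≤ (ρ * (1 + x₁) * p₁) * (q₁ - ρ * (1 + n₁) * p₁) := by
      rw [hr, ht] at hfin
      linear_combination hfin
    exact sub_nonneg.1 ((mul_nonneg_iff_of_pos_left (by positivity)).1 h₁)
  have m₁ := le_of_equation hq₁ hx₁ xn₁ Q₁ d₁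
  have m₂ := le_of_equation hq₂ hx₂ xn₂ Q₂ d₂
  have m₃ : q₃ * (q₁ + q₂) ≤ m := by
    have : 0 ≤ (1 + x₃) * q₃ * b := by positivity
    rw [hb] at this
    linear_combination this + Q₃
  have h₁₂ : q₂ < q₁ := by
    have h₁ := mul_pos hq₃ hq₁
    by_contra! hle
    have h₂ := mul_nonneg hq₂.le (sub_nonneg.2 hle)
    linarith
  have h₁ := mul_pos hq₃ hq₂
  have h₂ := mul_nonneg hq₁.le (sub_nonneg.2 h₁₂.le)
  linarith

theorem defect_eq_zero
    (h : PairedSystem p₁ e e q₁ q₂ q₃ x₁ x₂ x₃ n₁ n₂ n₃ ρ m δ) : δ = 0 := by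
  have key : ∀ {q₂ q₃ x₂ x₃ n₂ n₃ δ : ℝ},
      PairedSystem p₁ e e q₁ q₂ q₃ x₁ x₂ x₃ n₁ n₂ n₃ ρ m δ → δ ≤ 0 := fun {q₂ q₃ _ _ _ _ _} h ↦ by
    rcases lt_or_ge 0 (q₂ - ρ * e + (q₃ - ρ * e)) with hg | hg
    · exact h.defect_nonpos_of_add_pos hg
    · exact h.defect_nonpos_of_add_nonpos hg
  exact le_antisymm (key h) (by linarith [key h.swap])

end PairedSystem

/-- The Einstein equations for a diagonal coupling with squared entries `x`, `y`, `z` and product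
of the entries `κ`, where the equations of `E` and `F` are only required up to a defect `δ` and
`-δ`. -/
structure DiagonalSystem_s7 (A B C D E F x y z κ m δ : ℝ) : Prop where
  A_pos : 0 < A
  B_pos : 0 < B
  C_pos : 0 < C
  D_pos : 0 < D
  E_pos : 0 < E
  F_pos : 0 < F
  x_pos : 0 < x
  y_pos : 0 < y
  z_pos : 0 < z
  κ_pos : 0 < κ
  m_pos : 0 < m
  κ_sq : κ ^ 2 = x * y * z
  eqD : D * (E + F - D) - D ^ 2 * x + A * D * κ = m
  eqE : E * (D + F - E) - E ^ 2 * y + B * E * κ = m + δ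
  eqF : F * (D + E - F) - F ^ 2 * z + C * F * κ = m - δ
  eqA : A * B * (1 + z) + A * C * (1 + y) - A ^ 2 * ((1 + y) * (1 + z)) + A * D * κ = m
  eqB : A * B * (1 + z) + B * C * (1 + x) - B ^ 2 * ((1 + x) * (1 + z)) + B * E * κ = m
  eqC : A * C * (1 + y) + B * C * (1 + x) - C ^ 2 * ((1 + x) * (1 + y)) + C * F * κ = m
  eqX : x * (D ^ 2 + (B - C) ^ 2 + B ^ 2 * z + C ^ 2 * y) = (A * D + B * E + C * F) * κ
  eqY : y * (E ^ 2 + (A - C) ^ 2 + A ^ 2 * z + C ^ 2 * x) = (A * D + B * E + C * F) * κ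
  eqZ : z * (F ^ 2 + (A - B) ^ 2 + A ^ 2 * y + B ^ 2 * x) = (A * D + B * E + C * F) * κ

namespace DiagonalSystem_s7

variable {A B C D E F x y z κ m δ : ℝ}

theorem pairedSystem (h : DiagonalSystem_s7 A B C D E F x y z κ m δ) {R : ℝ} (hR : 0 < R)
    (hR2 : R ^ 2 = (1 + x) * (1 + y) * (1 + z)) :
    PairedSystem D E F (R * A / (1 + x)) (R * B / (1 + y)) (R * C / (1 + z)) x y z x⁻¹ y⁻¹ z⁻¹
      (κ / R) m δ := by
  obtain ⟨hA, hB, hC, hD, hE, hF, hx, hy, hz, hκ, hm, κ_sq, eqD, eqE, eqF, eqA, eqB, eqC, eqX, eqY,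
    eqZ⟩ := h
  have h₁ : κ / R * ((1 + x) * (D * (R * A / (1 + x)))) = A * D * κ := by field_simp
  have h₂ : κ / R * ((1 + y) * (E * (R * B / (1 + y)))) = B * E * κ := by field_simp
  have h₃ : κ / R * ((1 + z) * (F * (R * C / (1 + z)))) = C * F * κ := by field_simp
  have hK : κ / R * ((1 + x) * (D * (R * A / (1 + x))) + (1 + y) * (E * (R * B / (1 + y))) +
      (1 + z) * (F * (R * C / (1 + z)))) = (A * D + B * E + C * F) * κ := by
    linear_combination h₁ + h₂ + h₃
  have h₁₂ : R * A / (1 + x) * (R * B / (1 + y)) = A * B * (1 + z) := by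
    field_simp
    linear_combination hR2
  have h₁₃ : R * A / (1 + x) * (R * C / (1 + z)) = A * C * (1 + y) := by
    field_simp
    linear_combination hR2
  have h₂₃ : R * B / (1 + y) * (R * C / (1 + z)) = B * C * (1 + x) := by
    field_simp
    linear_combination hR2
  have s₁ : (1 + x) * (R * A / (1 + x)) ^ 2 = A ^ 2 * ((1 + y) * (1 + z)) := by
    field_simp
    linear_combination hR2
  have s₂ : (1 + y) * (R * B / (1 + y)) ^ 2 = B ^ 2 * ((1 + x) * (1 + z)) := by
    field_simp
    linear_combination hR2
  have s₃ : (1 + z) * (R * C / (1 + z)) ^ 2 = C ^ 2 * ((1 + x) * (1 + y)) := by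
    field_simp
    linear_combination hR2
  refine ⟨hD, hE, hF, by positivity, by positivity, by positivity, hx, hy, hz, by positivity,
    by positivity, by positivity, by positivity, hm, mul_inv_cancel₀ hx.ne',
    mul_inv_cancel₀ hy.ne', mul_inv_cancel₀ hz.ne', ?_, ?_, ?_, ?_, ?_, ?_, ?_, ?_, ?_, ?_⟩
  · field_simp
    rw [hR2, κ_sq]
    ring
  · linear_combination eqD + h₁
  · linear_combination eqE + h₂
  · linear_combination eqF + h₃
  · linear_combination eqA + h₁ + h₁₂ + h₁₃ - s₁
  · linear_combination eqB + h₂ + h₁₂ + h₂₃ - s₂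
  · linear_combination eqC + h₃ + h₁₃ + h₂₃ - s₃
  · rw [hK, ← eqX, mul_assoc 2, h₂₃, s₂, s₃]
    field_simp
    ring
  · rw [hK, ← eqY, mul_assoc 2, h₁₃, s₁, s₃]
    field_simp
    ring
  · rw [hK, ← eqZ, mul_assoc 2, h₁₂, s₁, s₂]
    field_simp
    ring

theorem all_eq (h : DiagonalSystem_s7 A B C D E F x y z κ m δ) (hδ : δ = 0 ∨ E = F) :
    (A = B ∧ B = C) ∧ (D = E ∧ E = F) ∧ x = y ∧ y = z := by
  obtain ⟨hA, hB, hC, hD, hE, hF, hx, hy, hz, -⟩ := id h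
  have hR : 0 < (1 + x) * (1 + y) * (1 + z) := by positivity
  have hp := h.pairedSystem (Real.sqrt_pos.2 hR) (Real.sq_sqrt hR.le)
  set R := √((1 + x) * (1 + y) * (1 + z))
  have hRpos : 0 < R := Real.sqrt_pos.2 hR
  obtain rfl : δ = 0 := by
    rcases hδ with hδ | rfl
    · exact hδ
    · exact hp.defect_eq_zero
  obtain ⟨rfl, hBC, hyz⟩ := hp.eq₂₃
  obtain ⟨rfl, -, hzx⟩ := hp.rotate.eq₂₃
  have hyz := inv_injective hyz
  have hzx := inv_injective hzx
  obtain ⟨-, hAB, -⟩ := hp.rotate.rotate.eq₂₃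
  subst hyz hzx
  have hne : R / (1 + y) ≠ 0 := by positivity
  rw [mul_div_right_comm, mul_div_right_comm] at hBC hAB
  exact ⟨⟨mul_left_cancel₀ hne hAB, mul_left_cancel₀ hne hBC⟩, ⟨rfl, rfl⟩, rfl, rfl⟩

theorem eq_third (h : DiagonalSystem_s7 A A A D D D x x x κ m 0)
    (hAD : A * D = 1) (hm : 27 * m ^ 2 = 25) :
    x = 1 / 3 ∧ 4 * A ^ 4 = 3 := by
  have hx := h.x_pos
  have hκ := h.κ_pos
  have hdiff : (1 - x) * (D ^ 2 - A ^ 2 * (1 + x)) = 0 := by linear_combination h.eqD - h.eqA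
  rcases mul_eq_zero.1 hdiff with h₁ | h₁
  · obtain rfl : x = 1 := by linarith
    have hκ1 : κ = 1 := by
      have := h.κ_sq
      nlinarith
    have : m = 1 := by linear_combination -h.eqD + κ * hAD + hκ1
    rw [this] at hm
    norm_num at hm
  · have hA4 : A ^ 4 * (1 + x) = 1 := by
      linear_combination (A * D + 1) * hAD - A ^ 2 * h₁
    have hX : x * A ^ 2 * (1 + 3 * x) = 3 * κ := by
      linear_combination h.eqX + 3 * κ * hAD - x * h₁
    have hx3 : x ^ 2 * (1 - 3 * x) = 0 := by
      linear_combination (1 + x) * (x * A ^ 2 * (1 + 3 * x) + 3 * κ) * hX + 9 * (1 + x) * h.κ_sq -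
        x ^ 2 * (1 + 3 * x) ^ 2 * hA4
    have hx13 : x = 1 / 3 := by
      rcases mul_eq_zero.1 hx3 with h₂ | h₂
      · exact absurd h₂ (by positivity)
      · linarith
    refine ⟨hx13, ?_⟩
    rw [hx13] at hA4
    linarith

theorem rigid (h : DiagonalSystem_s7 A B C D E F x y z κ m δ) (hδ : δ = 0 ∨ E = F)
    (hvol : A * B * C * D * E * F = 1) (hm : 27 * m ^ 2 = 25) :
    (B = A ∧ C = A) ∧ (E = D ∧ F = D) ∧ (x = 1 / 3 ∧ y = 1 / 3 ∧ z = 1 / 3) ∧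
      A * D = 1 ∧ 4 * A ^ 4 = 3 := by
  have hpos := mul_pos h.A_pos h.D_pos
  obtain ⟨⟨rfl, rfl⟩, ⟨rfl, rfl⟩, rfl, rfl⟩ := h.all_eq hδ
  obtain rfl : δ = 0 := by linear_combination (h.eqF - h.eqE) / 2
  have hAD : A * D = 1 := by
    have : (A * D) ^ 3 = 1 := by linear_combination hvol
    exact (pow_eq_one_iff_of_nonneg hpos.le (by norm_num)).1 this
  obtain ⟨hx, hA4⟩ := h.eq_third hAD hm
  exact ⟨⟨rfl, rfl⟩, ⟨rfl, rfl⟩, ⟨hx, hx, hx⟩, hAD, hA4⟩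

end DiagonalSystem_s7

/-- The system (S2) for `m = -μ`, with each equation of `A, …, F` multiplied by that variable and
the remaining ones grouped by the entries of the coupling. -/
structure CoupledSystem (A B C D E F X Y Z W G m : ℝ) : Prop where
  A_pos : 0 < A
  B_pos : 0 < B
  C_pos : 0 < C
  D_pos : 0 < D
  E_pos : 0 < E
  F_pos : 0 < F
  m_pos : 0 < m
  eqD : D * (E + F - D) - D * X * (D * X - A * (Y * Z - W * G)) = m
  eqE : E * (D + F - E) - E * (Y * (E * Y - B * X * Z) + W * (E * W + C * X * G)) = m
  eqF : F * (D + E - F) - F * (Z * (F * Z - C * X * Y) + G * (F * G + B * X * W)) = m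
  eqA : A * (B + C - A) + A * (Y * Z - W * G) * (D * X - A * (Y * Z - W * G)) -
    A * ((A - C) * (Y ^ 2 + G ^ 2) + (A - B) * (Z ^ 2 + W ^ 2)) = m
  eqB : B * (A + C - B) + B * X * Z * (E * Y - B * X * Z) - B * X * W * (F * G + B * X * W) -
    B * (B - C) * X ^ 2 - B * (B - A) * (Z ^ 2 + W ^ 2) = m
  eqC : C * (A + B - C) + C * X * Y * (F * Z - C * X * Y) - C * X * G * (E * W + C * X * G) -
    C * (C - B) * X ^ 2 - C * (C - A) * (Y ^ 2 + G ^ 2) = m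
  eqX : X * (D ^ 2 + (B - C) ^ 2 + B ^ 2 * (Z ^ 2 + W ^ 2) + C ^ 2 * (Y ^ 2 + G ^ 2)) =
    (A * D + B * E + C * F) * (Y * Z) - (A * D + C * E + B * F) * (W * G)
  eqY : (E ^ 2 + C ^ 2 * X ^ 2 + (A - C) ^ 2) * Y =
    (A * (D * X - A * (Y * Z - W * G)) + (B * E + C * F) * X) * Z
  eqZ : (F ^ 2 + B ^ 2 * X ^ 2 + (A - B) ^ 2) * Z =
    (A * (D * X - A * (Y * Z - W * G)) + (B * E + C * F) * X) * Y
  eqG : (F ^ 2 + C ^ 2 * X ^ 2 + (A - C) ^ 2) * G =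
    -((A * (D * X - A * (Y * Z - W * G)) + (B * F + C * E) * X) * W)
  eqW : (E ^ 2 + B ^ 2 * X ^ 2 + (A - B) ^ 2) * W =
    -((A * (D * X - A * (Y * Z - W * G)) + (B * F + C * E) * X) * G)

theorem SystemS2.coupledSystem {A B C D E F X Y Z W G μ m : ℝ} (hA : 0 < A) (hB : 0 < B)
    (hC : 0 < C) (hD : 0 < D) (hE : 0 < E) (hF : 0 < F) (hm : 0 < m) (hμ : μ = -m)
    (h : SystemS2 A B C D E F X Y Z W G μ) : CoupledSystem A B C D E F X Y Z W G m := by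
  obtain ⟨h₁, eD, eE, eB, eF, eA, eC, eG, eZ, eY, eW, eX⟩ := h
  subst hμ
  exact ⟨hA, hB, hC, hD, hE, hF, hm, by linear_combination D * eD + m * h₁,
    by linear_combination E * eE + m * h₁, by linear_combination F * eF + m * h₁,
    by linear_combination A * eA + m * h₁, by linear_combination B * eB + m * h₁,
    by linear_combination C * eC + m * h₁, by linear_combination -eX, by linear_combination -eY,
    by linear_combination -eZ, by linear_combination -eG, by linear_combination -eW⟩

namespace CoupledSystem

variable {A B C D E F X Y Z W G m : ℝ}

theorem swap (h : CoupledSystem A B C D E F X Y Z W G m) :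
    CoupledSystem A B C D F E X G (-W) (-Z) Y m :=
  ⟨h.A_pos, h.B_pos, h.C_pos, h.D_pos, h.F_pos, h.E_pos, h.m_pos, by linear_combination h.eqD,
    by linear_combination h.eqF, by linear_combination h.eqE, by linear_combination h.eqA,
    by linear_combination h.eqB, by linear_combination h.eqC, by linear_combination h.eqX,
    by linear_combination h.eqG, by linear_combination -h.eqW, by linear_combination h.eqY,
    by linear_combination -h.eqZ⟩

theorem neg (h : CoupledSystem A B C D E F X Y Z W G m) :
    CoupledSystem A B C D E F (-X) Y (-Z) (-W) G m :=
  ⟨h.A_pos, h.B_pos, h.C_pos, h.D_pos, h.E_pos, h.F_pos, h.m_pos, by linear_combination h.eqD,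
    by linear_combination h.eqE, by linear_combination h.eqF, by linear_combination h.eqA,
    by linear_combination h.eqB, by linear_combination h.eqC, by linear_combination -h.eqX,
    by linear_combination h.eqY, by linear_combination -h.eqZ, by linear_combination h.eqG,
    by linear_combination -h.eqW⟩

/-- With vanishing coupling the metric is a product of round metrics. -/
theorem eq_one_of_eq_zero (h : CoupledSystem A B C D E F X 0 0 0 0 m)
    (hvol : A * B * C * D * E * F = 1) : m = 1 := by
  obtain ⟨hA, hB, hC, hD, hE, hF, hm, eqD, eqE, eqF, eqA, eqB, eqC, eqX, -⟩ := h
  have hX : X = 0 := by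
    have : X * (D ^ 2 + (B - C) ^ 2) = 0 := by linear_combination eqX
    exact (mul_eq_zero.1 this).resolve_right (by positivity)
  subst hX
  have key : ∀ {a b c : ℝ}, 0 < a → 0 < b → 0 < c → a * (b + c - a) = m → b * (a + c - b) = m →
      c * (a + b - c) = m → a * b * c = a * m ∧ a ^ 2 = m := by
    intro a b c ha hb hc h₁ h₂ h₃
    have hab : (a - b) * (a + b - c) = 0 := by linear_combination h₂ - h₁
    have hpos : 0 < a + b - c := pos_of_mul_pos_right (h₃ ▸ hm) hc.le
    obtain rfl : a = b := sub_eq_zero.1 ((mul_eq_zero.1 hab).resolve_right hpos.ne')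
    obtain rfl : c = a := by
      have hac : (a - c) * c = 0 := by linear_combination h₃ - h₁
      exact (sub_eq_zero.1 ((mul_eq_zero.1 hac).resolve_right hc.ne')).symm
    exact ⟨by linear_combination c * h₁, by linear_combination h₁⟩
  obtain ⟨hDEF, hD2⟩ := key hD hE hF (by linear_combination eqD) (by linear_combination eqE)
    (by linear_combination eqF)
  obtain ⟨hABC, hA2⟩ := key hA hB hC (by linear_combination eqA) (by linear_combination eqB)
    (by linear_combination eqC)
  have hDA : D = A := (sq_eq_sq₀ hD.le hA.le).1 (hD2.trans hA2.symm)
  have : m ^ 3 = 1 := by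
    rw [← hvol, mul_assoc (A * B * C * D), mul_assoc (A * B * C), ← mul_assoc D, hDEF, hABC, hDA]
    linear_combination -m ^ 2 * hA2
  exact (pow_eq_one_iff_of_nonneg hm.le (by norm_num)).1 this

/-- If one of the two pairs of off-diagonal entries vanishes the system is diagonal. -/
theorem diagonalSystem_of_eq_zero (h : CoupledSystem A B C D E F X Y Z 0 0 m)
    (hne : Y ≠ 0 ∨ Z ≠ 0) :
    DiagonalSystem_s7 A B C D E F (X ^ 2) (Y ^ 2) (Z ^ 2) (X * (Y * Z)) m 0 := by
  obtain ⟨hA, hB, hC, hD, hE, hF, hm, eqD, eqE, eqF, eqA, eqB, eqC, eqX, eqY, eqZ, -⟩ := h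
  have hY : Y ≠ 0 := by
    rintro rfl
    have : (F ^ 2 + B ^ 2 * X ^ 2 + (A - B) ^ 2) * Z = 0 := by linear_combination eqZ
    have hZ := (mul_eq_zero.1 this).resolve_left (by positivity)
    simp [hZ] at hne
  have hZ : Z ≠ 0 := by
    rintro rfl
    have : (E ^ 2 + C ^ 2 * X ^ 2 + (A - C) ^ 2) * Y = 0 := by linear_combination eqY
    exact hY ((mul_eq_zero.1 this).resolve_left (by positivity))
  have hX : X ≠ 0 := by
    rintro rfl
    have h₁ : (A * D + B * E + C * F) * (Y * Z) = 0 := by linear_combination -eqX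
    exact (by positivity : (A * D + B * E + C * F) * (Y * Z) ≠ 0) h₁
  have hκ : 0 < X * (Y * Z) := by
    have h₁ : (A * D + B * E + C * F) * (X * (Y * Z)) =
        X ^ 2 * (D ^ 2 + (B - C) ^ 2 + B ^ 2 * Z ^ 2 + C ^ 2 * Y ^ 2) := by
      linear_combination -X * eqX
    have h₂ : 0 < (A * D + B * E + C * F) * (X * (Y * Z)) := by
      rw [h₁]
      positivity
    exact pos_of_mul_pos_right h₂ (by positivity)
  exact ⟨hA, hB, hC, hD, hE, hF, by positivity, by positivity, by positivity, hκ, hm, by ring,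
    by linear_combination eqD, by linear_combination eqE, by linear_combination eqF,
    by linear_combination eqA, by linear_combination eqB, by linear_combination eqC,
    by linear_combination X * eqX, by linear_combination Y * eqY, by linear_combination Z * eqZ⟩

theorem diagonalSystem_of_eq (h : CoupledSystem A B C D E E X Y Z W G m)
    (hne : ¬(Y = 0 ∧ Z = 0 ∧ W = 0 ∧ G = 0)) :
    ∃ δ, DiagonalSystem_s7 A B C D E E (X ^ 2) (Y ^ 2 + G ^ 2) (Z ^ 2 + W ^ 2)
      (X * (Y * Z - W * G)) m δ := by
  obtain ⟨hA, hB, hC, hD, hE, -, hm, eqD, eqE, eqF, eqA, eqB, eqC, eqX, eqY, eqZ, eqG, eqW⟩ := h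
  have hα : 0 < E ^ 2 + C ^ 2 * X ^ 2 + (A - C) ^ 2 := by positivity
  have hβ : 0 < E ^ 2 + B ^ 2 * X ^ 2 + (A - B) ^ 2 := by positivity
  have hcross : Y * W + G * Z = 0 := by
    have : (E ^ 2 + C ^ 2 * X ^ 2 + (A - C) ^ 2) * (Y * W + G * Z) = 0 := by
      linear_combination W * eqY + Z * eqG
    exact (mul_eq_zero.1 this).resolve_left hα.ne'
  have hp : (Y * Z - W * G) ^ 2 = (Y ^ 2 + G ^ 2) * (Z ^ 2 + W ^ 2) := by
    linear_combination -(Y * W + G * Z) * hcross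
  have hy : 0 < Y ^ 2 + G ^ 2 := by
    refine lt_of_le_of_ne (by positivity) fun h₀ ↦ hne ?_
    obtain ⟨rfl, rfl⟩ : Y = 0 ∧ G = 0 := by
      simpa [add_eq_zero_iff_of_nonneg (sq_nonneg Y) (sq_nonneg G)] using h₀.symm
    exact ⟨rfl, (mul_eq_zero.1 (eqZ.trans (mul_zero _))).resolve_left hβ.ne',
      (mul_eq_zero.1 (eqW.trans (by ring))).resolve_left hβ.ne', rfl⟩
  have hz : 0 < Z ^ 2 + W ^ 2 := by
    refine lt_of_le_of_ne (by positivity) fun h₀ ↦ hne ?_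
    obtain ⟨rfl, rfl⟩ : Z = 0 ∧ W = 0 := by
      simpa [add_eq_zero_iff_of_nonneg (sq_nonneg Z) (sq_nonneg W)] using h₀.symm
    exact ⟨(mul_eq_zero.1 (eqY.trans (mul_zero _))).resolve_left hα.ne', rfl, rfl,
      (mul_eq_zero.1 (eqG.trans (by ring))).resolve_left hα.ne'⟩
  obtain ⟨p, hpdef⟩ : ∃ p, p = Y * Z - W * G := ⟨_, rfl⟩
  have hpne : p ≠ 0 := by
    rintro rfl
    rw [← hpdef] at hp
    exact (mul_pos hy hz).ne (by linear_combination hp)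
  have hXp : X * (D ^ 2 + (B - C) ^ 2 + B ^ 2 * (Z ^ 2 + W ^ 2) + C ^ 2 * (Y ^ 2 + G ^ 2)) =
      (A * D + B * E + C * E) * p := by
    rw [hpdef]
    linear_combination eqX
  have hX : X ≠ 0 := by
    rintro rfl
    rw [zero_mul] at hXp
    exact (mul_ne_zero (by positivity) hpne) hXp.symm
  have hκ : 0 < X * p := by
    have h₂ : 0 < (A * D + B * E + C * E) * (X * p) := by
      have : (A * D + B * E + C * E) * (X * p) = X ^ 2 * (D ^ 2 + (B - C) ^ 2 +
          B ^ 2 * (Z ^ 2 + W ^ 2) + C ^ 2 * (Y ^ 2 + G ^ 2)) := by linear_combination -X * hXp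
      rw [this]
      positivity
    exact pos_of_mul_pos_right h₂ (by positivity)
  refine ⟨E * (D + E - E) - E ^ 2 * (Y ^ 2 + G ^ 2) + B * E * (X * p) - m, ?_⟩
  subst hpdef
  refine ⟨hA, hB, hC, hD, hE, hE, by positivity, hy, hz, hκ, hm, by linear_combination X ^ 2 * hp,
    by linear_combination eqD, by ring, ?_, by linear_combination eqA + A ^ 2 * hp, ?_, ?_,
    by linear_combination X * hXp, ?_, ?_⟩
  · linear_combination eqE + eqF
  · linear_combination eqB
  · linear_combination eqC
  · linear_combination Y * eqY + G * eqG - A ^ 2 * hp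
  · linear_combination Z * eqZ + W * eqW - A ^ 2 * hp

/-- Two proportionality relations with nonnegative factors determine the sign of a product. -/
theorem relations_of_ne_zero {a b r Y Z : ℝ} (ha : 0 < a) (hb : 0 < b) (h₁ : a * Y = r * Z)
    (h₂ : b * Z = r * Y) (hne : Y ≠ 0 ∨ Z ≠ 0) :
    a * b = r ^ 2 ∧ r ≠ 0 ∧ 0 < r * (Y * Z) := by
  have hY : Y ≠ 0 := by
    rintro rfl
    have hZ := (mul_eq_zero.1 (h₂.trans (mul_zero _))).resolve_left hb.ne'
    simp [hZ] at hne
  have hZ : Z ≠ 0 := by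
    rintro rfl
    exact hY ((mul_eq_zero.1 (h₁.trans (mul_zero _))).resolve_left ha.ne')
  have hab : a * b = r ^ 2 :=
    mul_right_cancel₀ (mul_ne_zero hY hZ) (by linear_combination b * Z * h₁ + r * Z * h₂)
  have hpos : 0 < a * Y ^ 2 := by positivity
  refine ⟨hab, ?_, ?_⟩
  · rintro rfl
    exact (mul_pos ha hb).ne' (by linear_combination hab)
  · linear_combination hpos + Y * h₁

theorem signs (h : CoupledSystem A B C D E F X Y Z W G m) (hX : 0 ≤ X) (hYZ : Y ≠ 0 ∨ Z ≠ 0)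
    (hWG : W ≠ 0 ∨ G ≠ 0) :
    0 < X ∧ 0 < Y * Z ∧ W * G < 0 ∧ 0 ≤ D * X - A * (Y * Z - W * G) ∧
      (E ^ 2 + C ^ 2 * X ^ 2 + (A - C) ^ 2) * (F ^ 2 + B ^ 2 * X ^ 2 + (A - B) ^ 2) =
        (A * (D * X - A * (Y * Z - W * G)) + (B * E + C * F) * X) ^ 2 ∧
      (F ^ 2 + C ^ 2 * X ^ 2 + (A - C) ^ 2) * (E ^ 2 + B ^ 2 * X ^ 2 + (A - B) ^ 2) =
        (A * (D * X - A * (Y * Z - W * G)) + (B * F + C * E) * X) ^ 2 := by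
  obtain ⟨hA, hB, hC, hD, hE, hF, -, -, -, -, -, -, -, eqX, eqY, eqZ, eqG, eqW⟩ := h
  obtain ⟨u, hu⟩ : ∃ u, u = D * X - A * (Y * Z - W * G) := ⟨_, rfl⟩
  rw [← hu] at eqY eqZ eqG eqW ⊢
  obtain ⟨hr, hr₀, hrYZ⟩ := relations_of_ne_zero (by positivity) (by positivity) eqY eqZ hYZ
  obtain ⟨hs, hs₀, hsWG⟩ := relations_of_ne_zero (Y := G) (Z := -W)
    (r := A * u + (B * F + C * E) * X)
    (by positivity : 0 < F ^ 2 + C ^ 2 * X ^ 2 + (A - C) ^ 2)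
    (by positivity : 0 < E ^ 2 + B ^ 2 * X ^ 2 + (A - B) ^ 2)
    (by linear_combination eqG) (by linear_combination -eqW) (by simpa [or_comm] using hWG)
  have neg_of_neg : ∀ {a b c d k q r : ℝ}, 0 ≤ c → 0 ≤ d → 0 < k → q < 0 → r = q + k * X →
      (a ^ 2 + c) * (b ^ 2 + d) = r ^ 2 → (k * X) ^ 2 ≤ (a ^ 2 + c) * (b ^ 2 + d) → r < 0 := by
    intro a b c d k q r hc hd hk hq hrq h₁ h₂
    by_contra! hneg
    have : r < k * X := by linarith
    exact absurd (h₂.trans h₁.le) (not_le.2 (pow_lt_pow_left₀ this hneg two_ne_zero))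
  have cs : ∀ {a b c d e f : ℝ}, 0 ≤ e → 0 ≤ f →
      ((b * a + c * d) * X) ^ 2 ≤
        (a ^ 2 + (c ^ 2 * X ^ 2 + e)) * (d ^ 2 + (b ^ 2 * X ^ 2 + f)) := by
    intro a b c d e f he hf
    have h₁ : 0 ≤ (a * d - b * c * X ^ 2) ^ 2 + e * (d ^ 2 + (b ^ 2 * X ^ 2 + f)) +
        f * (a ^ 2 + c ^ 2 * X ^ 2) := by positivity
    linear_combination h₁
  rcases le_or_gt 0 u with hu₀ | hu₀
  · have hrpos : 0 < A * u + (B * E + C * F) * X := lt_of_le_of_ne (by positivity) hr₀.symm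
    have hspos : 0 < A * u + (B * F + C * E) * X := lt_of_le_of_ne (by positivity) hs₀.symm
    have hYZpos := pos_of_mul_pos_right hrYZ hrpos.le
    have hWGneg := pos_of_mul_pos_right hsWG hspos.le
    have hWG' : 0 < -(W * G) := by linarith
    refine ⟨?_, hYZpos, by linarith, hu₀, hr, hs⟩
    have : 0 < X * (D ^ 2 + (B - C) ^ 2 + B ^ 2 * (Z ^ 2 + W ^ 2) +
        C ^ 2 * (Y ^ 2 + G ^ 2)) := by
      have h₁ : 0 < (A * D + B * E + C * F) * (Y * Z) + (A * D + C * E + B * F) * -(W * G) := by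
        positivity
      linarith
    exact pos_of_mul_pos_left this (by positivity)
  · exfalso
    have hq : A * u < 0 := mul_neg_of_pos_of_neg hA hu₀
    have hrneg : A * u + (B * E + C * F) * X < 0 := by
      refine neg_of_neg (a := E) (b := F) (c := C ^ 2 * X ^ 2 + (A - C) ^ 2)
        (d := B ^ 2 * X ^ 2 + (A - B) ^ 2) (by positivity) (by positivity) (by positivity) hq rfl
        (by linear_combination hr) (cs (sq_nonneg _) (sq_nonneg _))
    have hsneg : A * u + (B * F + C * E) * X < 0 := by
      refine neg_of_neg (a := F) (b := E) (c := C ^ 2 * X ^ 2 + (A - C) ^ 2)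
        (d := B ^ 2 * X ^ 2 + (A - B) ^ 2) (by positivity) (by positivity) (by positivity) hq rfl
        (by linear_combination hs) (cs (sq_nonneg _) (sq_nonneg _))
    have hYZneg : 0 < -(Y * Z) := by
      refine pos_of_mul_pos_right (a := -(A * u + (B * E + C * F) * X)) ?_ (by linarith)
      linarith
    have hWGpos : 0 < W * G := by
      refine pos_of_mul_pos_right (a := -(A * u + (B * F + C * E) * X)) ?_ (by linarith)
      linarith
    have h₁ : 0 < (A * D + B * E + C * F) * -(Y * Z) + (A * D + C * E + B * F) * (W * G) := by
      positivity
    have h₂ : 0 ≤ X * (D ^ 2 + (B - C) ^ 2 + B ^ 2 * (Z ^ 2 + W ^ 2) +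
        C ^ 2 * (Y ^ 2 + G ^ 2)) := by positivity
    linarith

theorem factor (h : CoupledSystem A B C D E F X Y Z W G m) (hX : 0 ≤ X) (hYZ : Y ≠ 0 ∨ Z ≠ 0)
    (hWG : W ≠ 0 ∨ G ≠ 0) :
    (B - C) * ((E - F) * ((E + F) * (B + C - 2 * A) -
      2 * X * (A * (D * X - A * (Y * Z - W * G))))) = 0 := by
  obtain ⟨-, -, -, -, hr, hs⟩ := h.signs hX hYZ hWG
  linear_combination hr - hs

theorem false_of_difference_relations {A D x e ε β τ k l : ℝ} (hA : 0 < A) (hx : 0 < x)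
    (hε : |ε| < e) (hτ : 0 < τ) (hτA : τ < A) (hτx : τ < x * (A - τ)) (hk : 0 < k) (hl : |l| ≤ k)
    (hD : D < 2 * e)
    (hEF : 2 * e * k * (A * τ - β ^ 2) = 2 * τ * (β * ε * l) + (2 * e - D))
    (hBC : 2 * ((A + τ) * x + τ) + A + k * (A * e ^ 2 + A * β ^ 2 * (1 + x) + (A + 2 * τ) * ε ^ 2 +
      A * ((A + τ) * x * (A - τ) - τ ^ 2)) + 2 * e * (β * ε * l) = 0) : False := by
  have he : 0 < e := (abs_nonneg ε).trans_lt hε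
  obtain ⟨b, hb⟩ : ∃ b, b = |β| := ⟨_, rfl⟩
  obtain ⟨c, hc⟩ : ∃ c, c = |ε| := ⟨_, rfl⟩
  have hb0 : 0 ≤ b := hb ▸ abs_nonneg β
  have hc0 : 0 ≤ c := hc ▸ abs_nonneg ε
  have hb2 : β ^ 2 = b ^ 2 := by rw [hb, sq_abs]
  have hc2 : ε ^ 2 = c ^ 2 := by rw [hc, sq_abs]
  have hn : -(b * c * k) ≤ β * ε * l := by
    refine neg_le_of_abs_le ?_
    rw [abs_mul, abs_mul, hb, hc]
    gcongr
  obtain ⟨n, hndef⟩ : ∃ n, n = β * ε * l := ⟨_, rfl⟩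
  rw [← hndef] at hEF hBC hn
  rw [hb2] at hEF hBC
  rw [hc2] at hBC
  rw [← hc] at hε
  have hpos : 0 < (A + τ) * x * (A - τ) - τ ^ 2 := by
    have h₁ := mul_pos (add_pos hA hτ) (sub_pos.2 hτx)
    have h₂ := mul_pos hA hτ
    linear_combination h₁ + h₂
  have hrest : 0 < 2 * ((A + τ) * x + τ) + A + k * (A * b ^ 2 * (1 + x) +
      A * ((A + τ) * x * (A - τ) - τ ^ 2)) := by positivity
  rcases le_or_gt (b ^ 2) (A ^ 2 + 2 * A * τ) with hβ | hβ
  · have h₁ : 0 ≤ A * e ^ 2 + (A + 2 * τ) * c ^ 2 - 2 * e * (b * c) := by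
      refine nonneg_of_mul_nonneg_right (a := A) ?_ hA
      have h₂ : 0 ≤ (A * e - b * c) ^ 2 + c ^ 2 * (A ^ 2 + 2 * A * τ - b ^ 2) := by
        have := sub_nonneg.2 hβ
        positivity
      linear_combination h₂
    have h₃ := mul_nonneg hk.le h₁
    have h₄ := mul_nonneg he.le (sub_nonneg.2 hn)
    linarith
  · have h₁ : 0 ≤ k * (A * e ^ 2 + (A + 2 * τ) * c ^ 2) := by positivity
    have h₃ : e * (b ^ 2 - A * τ) < e * (τ * b) := by
      refine lt_of_mul_lt_mul_left (a := 2 * k) ?_ (by positivity)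
      have h₄ := mul_nonneg hτ.le (sub_nonneg.2 hn)
      have h₅ : 0 ≤ k * τ * b * (e - c) := by
        have := sub_pos.2 hε
        positivity
      linear_combination 2 * h₄ + 2 * h₅ + hD - hEF
    have h₄ := lt_of_mul_lt_mul_left h₃ he.le
    have h₅ : A + τ < b := by
      refine lt_of_mul_lt_mul_left (a := τ) ?_ hτ.le
      have := mul_pos hA (sub_pos.2 hτA)
      have := mul_pos hτ (sub_pos.2 hτA)
      linarith
    have h₆ := mul_pos (by linarith : 0 < b - A) (by linarith : 0 < b - τ - τ)
    have h₇ := mul_pos hA (by linarith : 0 < b - τ - τ)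
    have h₈ := mul_pos hτ (by linarith : 0 < b - A)
    linarith

theorem eq_or_eq (h : CoupledSystem A B C D E F X Y Z W G m) (hX : 0 ≤ X)
    (hYZ : Y ≠ 0 ∨ Z ≠ 0) (hWG : W ≠ 0 ∨ G ≠ 0) : B = C ∨ E = F := by
  by_contra! hne
  obtain ⟨hBC, hEF⟩ := hne
  obtain ⟨hX, hYZ₀, hWG₀, hu, hr, hs⟩ := id (h.signs hX hYZ hWG)
  have hfac := h.factor hX.le hYZ hWG
  obtain ⟨hA, hB, hC, hD, hE, hF, hm, eqD, eqE, eqF, -, eqB, eqC, -, eqY, eqZ, eqG, eqW⟩ := h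
  have hfac := ((mul_eq_zero.1 ((mul_eq_zero.1 hfac).resolve_left (sub_ne_zero.2 hBC))).resolve_left
    (sub_ne_zero.2 hEF))
  obtain ⟨u, hudef⟩ : ∃ u, u = D * X - A * (Y * Z - W * G) := ⟨_, rfl⟩
  rw [← hudef] at eqD eqY eqZ eqG eqW hu hr hs hfac
  have hupos : 0 < u := by
    refine lt_of_le_of_ne hu ?_
    rintro rfl
    have h₁ : (E * F - B * C * X ^ 2) ^ 2 + (A - C) ^ 2 * (F ^ 2 + B ^ 2 * X ^ 2 + (A - B) ^ 2) +
        (A - B) ^ 2 * (E ^ 2 + C ^ 2 * X ^ 2) = 0 := by linear_combination hr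
    have h₂ : (A - C) ^ 2 * (F ^ 2 + B ^ 2 * X ^ 2 + (A - B) ^ 2) = 0 := by
      refine le_antisymm ?_ (by positivity)
      have : 0 ≤ (E * F - B * C * X ^ 2) ^ 2 + (A - B) ^ 2 * (E ^ 2 + C ^ 2 * X ^ 2) := by
        positivity
      linarith
    have h₃ : (A - B) ^ 2 * (E ^ 2 + C ^ 2 * X ^ 2) = 0 := by
      refine le_antisymm ?_ (by positivity)
      have : 0 ≤ (E * F - B * C * X ^ 2) ^ 2 := by positivity
      linarith
    have h₄ := pow_eq_zero_iff two_ne_zero |>.1 ((mul_eq_zero.1 h₂).resolve_right (by positivity))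
    have h₅ := pow_eq_zero_iff two_ne_zero |>.1 ((mul_eq_zero.1 h₃).resolve_right (by positivity))
    exact hBC (by linarith)
  obtain ⟨k₁, hk₁⟩ : ∃ k, k = Y * Z / (A * u + (B * E + C * F) * X) := ⟨_, rfl⟩
  obtain ⟨k₂, hk₂⟩ : ∃ k, k = -(W * G) / (A * u + (B * F + C * E) * X) := ⟨_, rfl⟩
  have hr₀ : 0 < A * u + (B * E + C * F) * X := by positivity
  have hs₀ : 0 < A * u + (B * F + C * E) * X := by positivity
  have hk₁pos : 0 < k₁ := hk₁ ▸ div_pos hYZ₀ hr₀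
  have hk₂pos : 0 < k₂ := hk₂ ▸ div_pos (by linarith) hs₀
  have hYZk : Y * Z = (A * u + (B * E + C * F) * X) * k₁ := by rw [hk₁]; field_simp
  have hWGk : W * G = -((A * u + (B * F + C * E) * X) * k₂) := by rw [hk₂]; field_simp
  have hY : Y ^ 2 = (F ^ 2 + B ^ 2 * X ^ 2 + (A - B) ^ 2) * k₁ :=
    mul_left_cancel₀ hr₀.ne' (by
      linear_combination -Y * eqZ + (F ^ 2 + B ^ 2 * X ^ 2 + (A - B) ^ 2) * hYZk)
  have hZ : Z ^ 2 = (E ^ 2 + C ^ 2 * X ^ 2 + (A - C) ^ 2) * k₁ :=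
    mul_left_cancel₀ hr₀.ne' (by
      linear_combination -Z * eqY + (E ^ 2 + C ^ 2 * X ^ 2 + (A - C) ^ 2) * hYZk)
  have hG : G ^ 2 = (E ^ 2 + B ^ 2 * X ^ 2 + (A - B) ^ 2) * k₂ :=
    mul_left_cancel₀ hs₀.ne' (by
      linear_combination G * eqW - (E ^ 2 + B ^ 2 * X ^ 2 + (A - B) ^ 2) * hWGk)
  have hW : W ^ 2 = (F ^ 2 + C ^ 2 * X ^ 2 + (A - C) ^ 2) * k₂ :=
    mul_left_cancel₀ hs₀.ne' (by
      linear_combination W * eqG - (F ^ 2 + C ^ 2 * X ^ 2 + (A - C) ^ 2) * hWGk)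
  clear eqY eqZ eqG eqW hr hs hk₁ hk₂ hYZ hWG
  obtain ⟨e, ε, rfl, rfl⟩ : ∃ e ε, E = e + ε ∧ F = e - ε :=
    ⟨(E + F) / 2, (E - F) / 2, by ring, by ring⟩
  obtain ⟨τ, β, rfl, rfl⟩ : ∃ τ β, B = A + τ + β ∧ C = A + τ - β :=
    ⟨(B + C) / 2 - A, (B - C) / 2, by ring, by ring⟩
  have hβ₀ : β ≠ 0 := fun h₀ ↦ hBC (by rw [h₀]; ring)
  have hε₀ : ε ≠ 0 := fun h₀ ↦ hEF (by rw [h₀]; ring)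
  have he : 0 < e := by linarith
  have hqX : A * u * X = 2 * e * τ := by linear_combination -hfac / 2
  have hτ : 0 < τ := by
    have : 0 < 2 * e * τ := hqX ▸ (by positivity)
    exact pos_of_mul_pos_right this (by positivity)
  have hDe : D + X * u < 2 * e := by
    have : 0 < D * (2 * e - D - X * u) := by linear_combination hm - eqD
    linarith [pos_of_mul_pos_right this hD.le]
  have hXu : 0 < X * u := by positivity
  have huD : u < D * X := by
    have := mul_pos hA (by linarith : 0 < Y * Z - W * G)
    linarith
  have hτA : τ < A := by
    refine lt_of_mul_lt_mul_left (a := 2 * e) ?_ (by positivity)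
    have := mul_pos hA (by linarith : 0 < 2 * e - X * u)
    linear_combination this - hqX
  have hτx : τ < X ^ 2 * (A - τ) := by
    refine lt_of_mul_lt_mul_left (a := 2 * e) ?_ (by positivity)
    have h₁ : 0 < A * X * (D * X - u) := by
      have := sub_pos.2 huD
      positivity
    have h₂ : 0 < A * X ^ 2 * (2 * e - D - X * u) := by
      have : 0 < 2 * e - D - X * u := by linarith
      positivity
    linear_combination h₁ + h₂ - (1 + X ^ 2) * hqX
  refine false_of_difference_relations (D := D) (e := e) (k := k₁ + k₂) (l := k₁ - k₂) (β := β)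
    (ε := ε) hA
    (by positivity : 0 < X ^ 2) (abs_lt.2 ⟨by linarith, by linarith⟩) hτ hτA hτx (by positivity)
    (abs_le.2 ⟨by linarith, by linarith⟩) (by linarith) ?_ ?_
  · refine mul_left_cancel₀ (by simpa using hε₀ : 2 * ε ≠ 0) ?_
    linear_combination eqE - eqF + (e + ε) ^ 2 * (hY + hW) - (e - ε) ^ 2 * (hZ + hG) -
      ((A + τ + β) * (e + ε) - (A + τ - β) * (e - ε)) * (X * hYZk + k₁ * hqX) +
      ((A + τ - β) * (e + ε) - (A + τ + β) * (e - ε)) * (X * hWGk - k₂ * hqX)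
  · refine mul_left_cancel₀ (by simpa using hβ₀ : -2 * β ≠ 0) ?_
    linear_combination eqB - eqC + ((A + τ + β) ^ 2 * X ^ 2 + (A + τ + β) * (τ + β)) * (hZ + hW) -
      ((A + τ - β) ^ 2 * X ^ 2 + (A + τ - β) * (τ - β)) * (hY + hG) -
      ((A + τ + β) * (e + ε) - (A + τ - β) * (e - ε)) * (X * hYZk + k₁ * hqX) +
      ((A + τ + β) * (e - ε) - (A + τ - β) * (e + ε)) * (X * hWGk - k₂ * hqX)

theorem eq_of_eq (h : CoupledSystem A B B D E F X Y Z W G m) (hX : 0 ≤ X)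
    (hYZ : Y ≠ 0 ∨ Z ≠ 0) (hWG : W ≠ 0 ∨ G ≠ 0) : E = F := by
  by_contra hEF
  obtain ⟨hX, hYZ₀, hWG₀, hu, -, -⟩ := h.signs hX hYZ hWG
  obtain ⟨hA, hB, -, hD, hE, hF, hm, eqD, eqE, eqF, -, -, -, eqX, eqY, eqZ, eqG, eqW⟩ := h
  obtain ⟨p, hp⟩ : ∃ p, p = Y * Z - W * G := ⟨_, rfl⟩
  rw [← hp] at eqD eqY eqZ eqG eqW hu
  obtain ⟨u, hudef⟩ : ∃ u, u = D * X - A * p := ⟨_, rfl⟩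
  rw [← hudef] at eqD eqY eqZ eqG eqW hu
  obtain ⟨τ, hτ⟩ : ∃ τ, τ = B ^ 2 * X ^ 2 + (A - B) ^ 2 := ⟨_, rfl⟩
  obtain ⟨r, hr⟩ : ∃ r, r = A * u + B * (E + F) * X := ⟨_, rfl⟩
  have hτ₀ : 0 < τ := by rw [hτ]; positivity
  have hr₀ : 0 < r := by rw [hr]; positivity
  have hp₀ : 0 < p := by linarith
  replace eqY : (E ^ 2 + τ) * Y = r * Z := by rw [hτ, hr]; linear_combination eqY
  replace eqZ : (F ^ 2 + τ) * Z = r * Y := by rw [hτ, hr]; linear_combination eqZ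
  replace eqG : (F ^ 2 + τ) * G = -(r * W) := by rw [hτ, hr]; linear_combination eqG
  replace eqW : (E ^ 2 + τ) * W = -(r * G) := by rw [hτ, hr]; linear_combination eqW
  obtain ⟨y, hy⟩ : ∃ y, y = Y ^ 2 + W ^ 2 := ⟨_, rfl⟩
  obtain ⟨z, hz⟩ : ∃ z, z = Z ^ 2 + G ^ 2 := ⟨_, rfl⟩
  have hY : Y ≠ 0 := by
    rintro rfl
    simp at hYZ₀
  have hT : 0 < y + z := by
    rw [hy, hz]
    positivity
  have hpy : p * (F ^ 2 + τ) = r * y := by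
    rw [hp, hy]
    linear_combination Y * eqZ - W * eqG
  have hpz : p * (E ^ 2 + τ) = r * z := by
    rw [hp, hz]
    linear_combination Z * eqY - G * eqW
  have hyz : y * (E ^ 2 + τ) = z * (F ^ 2 + τ) := by
    rw [hy, hz]
    linear_combination Y * eqY - Z * eqZ + W * eqW - G * eqG
  have hdiff : τ * (z - y) = (E - F) * (D + B * X * p - (E + F)) := by
    have : E ^ 2 * y - F ^ 2 * z = (E - F) * (D + B * X * p - (E + F)) := by
      rw [hy, hz, hp]
      linear_combination eqF - eqE
    linear_combination this - hyz
  have hmul : (D + B * X * p - (E + F)) * (E ^ 2 + τ + (F ^ 2 + τ)) = τ * (y + z) * (E + F) := by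
    refine mul_left_cancel₀ (sub_ne_zero.2 hEF) ?_
    linear_combination -(E ^ 2 + τ + (F ^ 2 + τ)) * hdiff - 2 * τ * hyz
  have hmain : (D + B * X * p - (E + F)) * r = τ * (E + F) * p := by
    refine mul_left_cancel₀ hT.ne' ?_
    linear_combination p * hmul - (D + B * X * p - (E + F)) * (hpy + hpz)
  have hXeq : D * u + B ^ 2 * (y + z) * X = B * (E + F) * p := by
    rw [hudef, hy, hz, hp]
    linear_combination eqX
  obtain ⟨M, hM⟩ : ∃ M, M = E + F - D - X * u := ⟨_, rfl⟩
  have hM₀ : 0 < M := by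
    have : 0 < D * M := by
      rw [hM]
      linear_combination hm - eqD
    exact pos_of_mul_pos_right this hD.le
  have hXu : 0 ≤ X * u := by positivity
  have key : (A - B) ^ 2 * (D * u + B ^ 2 * (y + z) * X) +
      B * (A * u + B * (E + F) * X) * (X * u + M) = A * B ^ 2 * u * X * p := by
    rw [hXeq, hM]
    rw [hτ, hr] at hmain
    linear_combination -B * hmain
  have h₁ : 0 ≤ (A - B) ^ 2 * (D * u + B ^ 2 * (y + z) * X) := by positivity
  have h₂ : 0 ≤ B * (A * u) * (X * u + M) := by positivity
  have h₃ : 0 < B * (B * (E + F) * X) * M := by positivity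
  have h₄ : 0 ≤ B ^ 2 * X * (X * u) * (E + F - D) := by
    have : 0 ≤ E + F - D := by linarith
    positivity
  have h₅ : 0 ≤ B ^ 2 * X * u * u := by positivity
  have : (0 : ℝ) < 0 := by
    linear_combination h₁ + h₂ + h₃ + h₄ + h₅ + key + B ^ 2 * X * u * hudef
  exact lt_irrefl _ this

theorem eq_of_ne_zero (h : CoupledSystem A B C D E F X Y Z W G m)
    (hYZ : Y ≠ 0 ∨ Z ≠ 0) (hWG : W ≠ 0 ∨ G ≠ 0) : E = F := by
  have key : ∀ {X Z W : ℝ}, CoupledSystem A B C D E F X Y Z W G m → 0 ≤ X → (Y ≠ 0 ∨ Z ≠ 0) →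
      (W ≠ 0 ∨ G ≠ 0) → E = F := by
    intro X Z W h hX hYZ hWG
    rcases h.eq_or_eq hX hYZ hWG with rfl | hEF
    · exact h.eq_of_eq hX hYZ hWG
    · exact hEF
  rcases le_total 0 X with hX | hX
  · exact key h hX hYZ hWG
  · exact key h.neg (neg_nonneg.2 hX) (by simpa using hYZ) (by simpa using hWG)

/-- A solution of the coupled system which is not a product metric is diagonalizable. -/
theorem exists_diagonalSystem (h : CoupledSystem A B C D E F X Y Z W G m)
    (hne : ¬(Y = 0 ∧ Z = 0 ∧ W = 0 ∧ G = 0)) :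
    (∃ δ, (δ = 0 ∨ E = F) ∧ DiagonalSystem_s7 A B C D E F (X ^ 2) (Y ^ 2 + G ^ 2) (Z ^ 2 + W ^ 2)
      (X * (Y * Z - W * G)) m δ) ∨
    ∃ δ, (δ = 0 ∨ F = E) ∧ DiagonalSystem_s7 A B C D F E (X ^ 2) (Y ^ 2 + G ^ 2) (Z ^ 2 + W ^ 2)
      (X * (Y * Z - W * G)) m δ := by
  by_cases hYZ : Y ≠ 0 ∨ Z ≠ 0
  · by_cases hWG : W ≠ 0 ∨ G ≠ 0
    · obtain rfl := h.eq_of_ne_zero hYZ hWG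
      obtain ⟨δ, hδ⟩ := h.diagonalSystem_of_eq hne
      exact Or.inl ⟨δ, Or.inr rfl, hδ⟩
    · push Not at hWG
      obtain ⟨rfl, rfl⟩ := hWG
      refine Or.inl ⟨0, Or.inl rfl, ?_⟩
      simpa using h.diagonalSystem_of_eq_zero hYZ
  · push Not at hYZ
    obtain ⟨rfl, rfl⟩ := hYZ
    refine Or.inr ⟨0, Or.inl rfl, ?_⟩
    have hs := h.swap
    simp only [neg_zero] at hs
    have := hs.diagonalSystem_of_eq_zero (by simp at hne ⊢; tauto)
    simpa [mul_comm] using this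

end CoupledSystem

/-- Classification of the solutions of (S2) with `μ = -5/(3√3)` and positive
`A,…,F`: necessarily `A = B = C = 3^{1/4}/√2`, `D = E = F = √2/3^{1/4}`,
`X ∈ {-1/√3, 1/√3}`, `Y² + 𝒞² = 1/3`, `Z = √3·XY` and `W = -√3·X𝒞`. -/
theorem systemS2_mu_nearlyKaehler_classification
    (A B C D E F X Y Z W 𝒞 μ : ℝ)
    (hA : 0 < A) (hB : 0 < B) (hC : 0 < C)
    (hD : 0 < D) (hE : 0 < E) (hF : 0 < F)
    (hμ : μ = -5/(3*Real.sqrt 3))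
    (hsol : SystemS2 A B C D E F X Y Z W 𝒞 μ) :
    A = Real.sqrt (Real.sqrt 3) / Real.sqrt 2 ∧
    B = Real.sqrt (Real.sqrt 3) / Real.sqrt 2 ∧
    C = Real.sqrt (Real.sqrt 3) / Real.sqrt 2 ∧
    D = Real.sqrt 2 / Real.sqrt (Real.sqrt 3) ∧
    E = Real.sqrt 2 / Real.sqrt (Real.sqrt 3) ∧
    F = Real.sqrt 2 / Real.sqrt (Real.sqrt 3) ∧
    (X = -(Real.sqrt 3)⁻¹ ∨ X = (Real.sqrt 3)⁻¹) ∧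
    Y^2 + 𝒞^2 = 1/3 ∧
    Z = Real.sqrt 3 * X * Y ∧
    W = -(Real.sqrt 3 * X * 𝒞) := by
  have hs : 0 < √(3 : ℝ) := by positivity
  have hs2 : √(3 : ℝ) ^ 2 = 3 := Real.sq_sqrt (by norm_num)
  obtain ⟨m, hm⟩ : ∃ m, m = 5 / (3 * √(3 : ℝ)) := ⟨_, rfl⟩
  have hm₀ : 0 < m := by rw [hm]; positivity
  have hm2 : 27 * m ^ 2 = 25 := by
    rw [hm, div_pow, mul_pow, hs2]
    norm_num
  have hvol : A * B * C * D * E * F = 1 := by linear_combination hsol.1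
  have h := hsol.coupledSystem hA hB hC hD hE hF hm₀ (by rw [hμ, hm]; ring)
  have hne : ¬(Y = 0 ∧ Z = 0 ∧ W = 0 ∧ 𝒞 = 0) := by
    rintro ⟨rfl, rfl, rfl, rfl⟩
    rw [h.eq_one_of_eq_zero hvol] at hm2
    norm_num at hm2
  obtain ⟨⟨hBA, hCA⟩, ⟨hED, hFD⟩, ⟨hx, hy, hz⟩, hAD, hA4, hκ, hκ2⟩ :
      (B = A ∧ C = A) ∧ (E = D ∧ F = D) ∧
      (X ^ 2 = 1 / 3 ∧ Y ^ 2 + 𝒞 ^ 2 = 1 / 3 ∧ Z ^ 2 + W ^ 2 = 1 / 3) ∧ A * D = 1 ∧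
      4 * A ^ 4 = 3 ∧ 0 < X * (Y * Z - W * 𝒞) ∧ (X * (Y * Z - W * 𝒞)) ^ 2 =
        X ^ 2 * (Y ^ 2 + 𝒞 ^ 2) * (Z ^ 2 + W ^ 2) := by
    rcases h.exists_diagonalSystem hne with ⟨δ, hδ, hd⟩ | ⟨δ, hδ, hd⟩
    · obtain ⟨h₁, h₂, h₃, h₄, h₅⟩ := hd.rigid hδ hvol hm2
      exact ⟨h₁, h₂, h₃, h₄, h₅, hd.κ_pos, hd.κ_sq⟩
    · obtain ⟨h₁, h₂, h₃, h₄, h₅⟩ := hd.rigid hδ (by linear_combination hvol) hm2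
      exact ⟨h₁, h₂.symm, h₃, h₄, h₅, hd.κ_pos, hd.κ_sq⟩
  rw [hx, hy, hz] at hκ2
  have hκ' : 3 * √3 * (X * (Y * Z - W * 𝒞)) = 1 := by
    refine (sq_eq_sq₀ (by positivity) zero_le_one).1 ?_
    linear_combination 27 * hκ2 + 9 * (X * (Y * Z - W * 𝒞)) ^ 2 * hs2
  have hdist : (Z - √3 * X * Y) ^ 2 + (W + √3 * X * 𝒞) ^ 2 = 0 := by
    linear_combination hz + 3 * X ^ 2 * hy + hx - 2 / 3 * hκ' + X ^ 2 * (Y ^ 2 + 𝒞 ^ 2) * hs2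
  obtain ⟨hZ, hW⟩ := (add_eq_zero_iff_of_nonneg (sq_nonneg _) (sq_nonneg _)).1 hdist
  have hA2 : 2 * A ^ 2 = √3 :=
    (sq_eq_sq₀ (by positivity) hs.le).1 (by linear_combination hA4 - hs2)
  have hAeq : A = √(√3) / √2 := by
    rw [← Real.sqrt_div hs.le, eq_comm, Real.sqrt_eq_iff_mul_self_eq (by positivity) hA.le]
    linear_combination -hA2 / 2
  have hDeq : D = √2 / √(√3) := by
    rw [eq_div_of_mul_eq hA.ne' (by linear_combination hAD : D * A = 1), hAeq, one_div_div]
  subst hBA hCA hED hFD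
  refine ⟨hAeq, hAeq, hAeq, hDeq, hDeq, hDeq, ?_, hy, ?_, ?_⟩
  · refine (sq_eq_sq_iff_eq_or_eq_neg.1 ?_).symm
    rw [hx, inv_pow, hs2]
    norm_num
  · exact sub_eq_zero.1 (pow_eq_zero_iff two_ne_zero |>.1 hZ)
  · exact eq_neg_of_add_eq_zero_left (pow_eq_zero_iff two_ne_zero |>.1 hW)
end
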